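/- arXiv:1710.00198 — 2 statements merged into one kernel-verified Lean document; each statement's English description precedes it below -/
import Mathlib

section
/- Fix integers n, m ≥ 1 and k₁, k₂ ≥ 0, a real ε ∈ (0, π/4) and a real C > π/2. Then there exist constants K > 0 and M > 0 such that for all (x, t) ∈ ℝ^{2n} × ℝ^m with |x| ≥ M and ω := 4|t|/|x|² ∈ [ε, π/2 − ε] ∪ [π/2 + ε, C], one has |p_{1,k₁,k₂}(x,t) − |x|^{−m} e^{−d(x,t)²/4} Ψ(ω) · (−1)^{k₁+k₂} y_ω^{n+k₁+k₂} cos(y_ω)^{k₁}/sin(y_ω)^{n+k₁}| ≤ K |x|^{−m−2} e^{−d(x,t)²/4} Ψ(ω), where Ψ(ω) = (1/(4ⁿ π^{n+m})) √((2π)^m y_ω^{m−1} sin(y_ω)³ / (2 ω^{m−1} (sin(y_ω) − y_ω cos(y_ω)))). -/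
open Real Complex MeasureTheory
open scoped Classical

/-- θ(y) = (2y − sin(2y))/(2 sin²(y)) for y ≠ 0, θ(0) = 0. -/
noncomputable def theta (y : ℝ) : ℝ :=
  if y = 0 then 0 else (2 * y - Real.sin (2 * y)) / (2 * Real.sin y ^ 2)

/-- The radial derivative p_{1,k₁,k₂} of the heat kernel at time 1 on an H-type group
with centre of dimension m, with R = |x|²/4 (integrand extended by continuity at λ = 0). -/
noncomputable def pT (n m k₁ k₂ : ℕ) (hm : 0 < m)
    (x : EuclideanSpace ℝ (Fin (2 * n))) (t : EuclideanSpace ℝ (Fin m)) : ℂ :=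
  ((-1 : ℂ) ^ k₁ * Complex.I ^ k₂ / ((4 * (π : ℂ)) ^ n * (2 * (π : ℂ)) ^ m)) *
    ∫ lam : EuclideanSpace ℝ (Fin m),
      if lam = 0 then (if k₂ = 0 then Complex.exp (-((‖x‖ ^ 2 / 4 : ℝ) : ℂ)) else 0)
      else
        Complex.exp (Complex.I * ((‖t‖ : ℝ) : ℂ) * ((lam ⟨0, hm⟩ : ℝ) : ℂ)
            - ((‖x‖ ^ 2 / 4 * ‖lam‖ * Real.cosh ‖lam‖ / Real.sinh ‖lam‖ : ℝ) : ℂ)) *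
          (((‖lam‖ : ℝ) : ℂ) ^ (n + k₁) * ((Real.cosh ‖lam‖ : ℝ) : ℂ) ^ k₁
            / ((Real.sinh ‖lam‖ : ℝ) : ℂ) ^ (n + k₁)) *
          ((lam ⟨0, hm⟩ : ℝ) : ℂ) ^ k₂

/-- The numbers `(k + 1)² π²`; the squares of the poles of `s ↦ s coth s` are their negatives. -/
noncomputable def poleSq (k : ℕ) : ℝ := ((k : ℝ) + 1) ^ 2 * π ^ 2

/-- The function `z` with `s coth s = cothSeries (s²)`, as a Mittag-Leffler series. -/
noncomputable def cothSeries (z : ℂ) : ℂ := 1 + 2 * ∑' k : ℕ, z / (z + (poleSq k : ℂ))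

/-- The sums which occur as Taylor coefficients of `cothSeries` at `-a`. -/
noncomputable def cothCoeff (j : ℕ) (a : ℝ) : ℝ := ∑' k : ℕ, poleSq k / (poleSq k - a) ^ j

/-- The sum of the inverse squares. -/
noncomputable def invSqSum : ℝ := ∑' k : ℕ, 1 / ((k : ℝ) + 1) ^ 2

lemma poleSq_pos (k : ℕ) : 0 < poleSq k := by
  unfold poleSq; positivity

lemma summable_invSq : Summable fun k : ℕ => 1 / ((k : ℝ) + 1) ^ 2 := by
  have h := (summable_nat_add_iff 1).2 (Real.summable_one_div_nat_pow.2 (show 1 < 2 by norm_num))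
  simpa using h

lemma invSqSum_nonneg : 0 ≤ invSqSum := tsum_nonneg fun k => by positivity

lemma mul_le_poleSq_sub {a δ : ℝ} (ha : 0 ≤ a) (hδ : δ ≤ π ^ 2 - a) (k : ℕ) :
    ((k : ℝ) + 1) ^ 2 * δ ≤ poleSq k - a := by
  have hk : (1 : ℝ) ≤ ((k : ℝ) + 1) ^ 2 := by
    have : (0 : ℝ) ≤ k := k.cast_nonneg
    nlinarith
  unfold poleSq
  nlinarith

lemma poleSq_sub_pos {a δ : ℝ} (ha : 0 ≤ a) (hδ0 : 0 < δ) (hδ : δ ≤ π ^ 2 - a) (k : ℕ) :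
    0 < poleSq k - a :=
  lt_of_lt_of_le (by positivity) (mul_le_poleSq_sub ha hδ k)

lemma le_norm_add_poleSq {a δ : ℝ} (ha : 0 ≤ a) (hδ : δ ≤ π ^ 2 - a) {z : ℂ} (hz : -a ≤ z.re)
    (k : ℕ) : ((k : ℝ) + 1) ^ 2 * δ ≤ ‖z + (poleSq k : ℂ)‖ := by
  have h1 := mul_le_poleSq_sub ha hδ k
  have h2 := Complex.re_le_norm (z + (poleSq k : ℂ))
  rw [Complex.add_re, Complex.ofReal_re] at h2
  linarith

lemma norm_cothSeries_term_le {a δ : ℝ} (ha : 0 ≤ a) (hδ0 : 0 < δ) (hδ : δ ≤ π ^ 2 - a) {z : ℂ}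
    (hz : -a ≤ z.re) (k : ℕ) :
    ‖z / (z + (poleSq k : ℂ))‖ ≤ ‖z‖ / δ * (1 / ((k : ℝ) + 1) ^ 2) := by
  have h := le_norm_add_poleSq ha hδ hz k
  have h0 : 0 < ((k : ℝ) + 1) ^ 2 * δ := by positivity
  rw [norm_div, div_mul_div_comm, mul_one, mul_comm δ]
  gcongr

lemma summable_cothSeries {a δ : ℝ} (ha : 0 ≤ a) (hδ0 : 0 < δ) (hδ : δ ≤ π ^ 2 - a) {z : ℂ}
    (hz : -a ≤ z.re) : Summable fun k : ℕ => z / (z + (poleSq k : ℂ)) :=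
  Summable.of_norm_bounded (summable_invSq.mul_left _) (norm_cothSeries_term_le ha hδ0 hδ hz)

lemma norm_cothSeries_le {a δ : ℝ} (ha : 0 ≤ a) (hδ0 : 0 < δ) (hδ : δ ≤ π ^ 2 - a) {z : ℂ}
    (hz : -a ≤ z.re) : ‖cothSeries z‖ ≤ 1 + 2 * (‖z‖ / δ * invSqSum) := by
  have h : ‖∑' k : ℕ, z / (z + (poleSq k : ℂ))‖ ≤ ‖z‖ / δ * invSqSum :=
    tsum_of_norm_bounded (summable_invSq.hasSum.mul_left _) (norm_cothSeries_term_le ha hδ0 hδ hz)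
  unfold cothSeries
  refine (norm_add_le _ _).trans ?_
  rw [norm_mul, norm_one, Complex.norm_ofNat]
  gcongr

lemma isOpen_re_gt_norm_lt (a r : ℝ) : IsOpen {w : ℂ | a < w.re ∧ ‖w‖ < r} :=
  (isOpen_lt continuous_const Complex.continuous_re).inter
    (isOpen_lt continuous_norm continuous_const)

lemma add_poleSq_ne_zero {a δ : ℝ} (ha : 0 ≤ a) (hδ0 : 0 < δ) (hδ : δ ≤ π ^ 2 - a) {z : ℂ}
    (hz : -a ≤ z.re) (k : ℕ) : z + (poleSq k : ℂ) ≠ 0 := by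
  rw [← norm_pos_iff]
  exact lt_of_lt_of_le (by positivity) (le_norm_add_poleSq ha hδ hz k)

lemma exists_halfplane {z : ℂ} (hz : -π ^ 2 < z.re) :
    ∃ a δ : ℝ, 0 ≤ a ∧ 0 < δ ∧ δ ≤ π ^ 2 - a ∧ -a < z.re := by
  refine ⟨max 0 ((π ^ 2 - z.re) / 2), π ^ 2 - max 0 ((π ^ 2 - z.re) / 2), le_max_left _ _, ?_,
    le_rfl, ?_⟩
  · rw [sub_pos]
    exact max_lt (by positivity) (by linarith)
  · have := le_max_right 0 ((π ^ 2 - z.re) / 2)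
    have : 0 < π ^ 2 := by positivity
    linarith

lemma differentiableAt_cothSeries {z : ℂ} (hz : -π ^ 2 < z.re) :
    DifferentiableAt ℂ cothSeries z := by
  obtain ⟨a, δ, ha, hδ0, hδ, hza⟩ := exists_halfplane hz
  have hU := isOpen_re_gt_norm_lt (-a) (‖z‖ + 1)
  have hd : DifferentiableOn ℂ (fun w : ℂ => ∑' k : ℕ, w / (w + (poleSq k : ℂ)))
      {w : ℂ | -a < w.re ∧ ‖w‖ < ‖z‖ + 1} := by
    refine differentiableOn_tsum_of_summable_norm (summable_invSq.mul_left ((‖z‖ + 1) / δ)) ?_ hU ?_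
    · intro k w hw
      have := add_poleSq_ne_zero ha hδ0 hδ hw.1.le k
      exact DifferentiableWithinAt.fun_div (by fun_prop) (by fun_prop) this
    · intro k w hw
      refine (norm_cothSeries_term_le ha hδ0 hδ hw.1.le k).trans ?_
      have := hw.2.le
      gcongr
  have h := hd.differentiableAt (hU.mem_nhds ⟨hza, by simp⟩)
  unfold cothSeries
  fun_prop

lemma cothSeries_conj (z : ℂ) :
    cothSeries (starRingEnd ℂ z) = starRingEnd ℂ (cothSeries z) := by
  simp [cothSeries, Complex.conj_tsum, map_ofNat]

lemma cothSeries_zero : cothSeries 0 = 1 := by simp [cothSeries]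

lemma re_cothSeries {a δ : ℝ} (ha : 0 ≤ a) (hδ0 : 0 < δ) (hδ : δ ≤ π ^ 2 - a) {z : ℂ}
    (hz : -a ≤ z.re) :
    (cothSeries z).re = 1 + 2 * ∑' k : ℕ, (z / (z + (poleSq k : ℂ))).re := by
  rw [cothSeries, ← Complex.re_tsum (summable_cothSeries ha hδ0 hδ hz)]
  simp

lemma re_term_ge {c a p : ℝ} (ha : 0 ≤ a) (hca : 0 < c - a) (hp : 0 ≤ p) {z : ℂ}
    (hz : -a + p ≤ z.re) :
    (((-a : ℝ) : ℂ) / (((-a : ℝ) : ℂ) + c)).re + ((p : ℂ) / ((p : ℂ) + c)).re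
      ≤ (z / (z + (c : ℂ))).re := by
  have hc : 0 < c := by linarith
  have hre : c - a + p ≤ (z + c).re := by simp; linarith
  have hn : c - a + p ≤ ‖z + c‖ := hre.trans (Complex.re_le_norm _)
  have hne : z + c ≠ 0 := by
    rw [← norm_pos_iff]; linarith
  have e1 : z / (z + (c : ℂ)) = 1 - (c : ℂ) / (z + c) := by field_simp; ring
  have e2 : ((-a : ℝ) : ℂ) / (((-a : ℝ) : ℂ) + c) = ((-a / (c - a) : ℝ) : ℂ) := by
    push_cast; ring
  have e3 : (p : ℂ) / ((p : ℂ) + c) = ((p / (p + c) : ℝ) : ℂ) := by push_cast; ring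
  rw [e1, e2, e3, Complex.ofReal_re, Complex.ofReal_re, Complex.sub_re, Complex.one_re]
  have h1 : ((c : ℂ) / (z + c)).re ≤ c / (c - a + p) := by
    refine (Complex.re_le_norm _).trans ?_
    rw [norm_div, Complex.norm_of_nonneg hc.le]
    gcongr
  have h2 : -a / (c - a) + p / (p + c) ≤ 1 - c / (c - a + p) := by
    have e : 1 - c / (c - a + p) - (-a / (c - a) + p / (p + c))
        = p * (a * (2 * c - a) + a * p) / ((c - a + p) * (c - a) * (p + c)) := by
      have : c - a + p ≠ 0 := by positivity
      have : p + c ≠ 0 := by positivity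
      field_simp
      ring
    have : 0 ≤ p * (a * (2 * c - a) + a * p) / ((c - a + p) * (c - a) * (p + c)) := by
      have : 0 ≤ 2 * c - a := by linarith
      positivity
    linarith
  linarith

/-- The real part of `cothSeries` on a half plane is bounded below by its values on the axis. -/
lemma re_cothSeries_ge {a δ p : ℝ} (ha : 0 ≤ a) (hδ0 : 0 < δ) (hδ : δ ≤ π ^ 2 - a) (hp : 0 ≤ p)
    {z : ℂ} (hz : -a + p ≤ z.re) :
    (cothSeries ((-a : ℝ) : ℂ)).re + (cothSeries (p : ℂ)).re - 1 ≤ (cothSeries z).re := by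
  have hz1 : -a ≤ z.re := by linarith
  have hz2 : -a ≤ (((-a : ℝ) : ℂ)).re := by simp
  have hz3 : -a ≤ ((p : ℂ)).re := by simp; linarith
  rw [re_cothSeries ha hδ0 hδ hz1, re_cothSeries ha hδ0 hδ hz2, re_cothSeries ha hδ0 hδ hz3]
  have s1 := (Complex.hasSum_re (summable_cothSeries ha hδ0 hδ hz1).hasSum).summable
  have s2 := (Complex.hasSum_re (summable_cothSeries ha hδ0 hδ hz2).hasSum).summable
  have s3 := (Complex.hasSum_re (summable_cothSeries ha hδ0 hδ hz3).hasSum).summable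
  have := (s2.add s3).tsum_le_tsum (fun k => re_term_ge ha (poleSq_sub_pos ha hδ0 hδ k) hp hz) s1
  rw [s2.tsum_add s3] at this
  linarith

lemma cothCoeff_term_bound {a δ : ℝ} (ha : 0 ≤ a) (hδ0 : 0 < δ) (hδ1 : δ ≤ 1)
    (hδ : δ ≤ π ^ 2 - a) {j : ℕ} (hj2 : 2 ≤ j) (hj5 : j ≤ 5) (k : ℕ) :
    ‖poleSq k / (poleSq k - a) ^ j‖ ≤ π ^ 2 / δ ^ 5 * (1 / ((k : ℝ) + 1) ^ 2) := by
  have h := mul_le_poleSq_sub ha hδ k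
  have h0 := poleSq_sub_pos ha hδ0 hδ k
  have hk : (1 : ℝ) ≤ (k : ℝ) + 1 := by
    have : (0 : ℝ) ≤ k := k.cast_nonneg
    linarith
  rw [Real.norm_of_nonneg (by have := poleSq_pos k; positivity), div_mul_div_comm, mul_one,
    div_le_div_iff₀ (by positivity) (by positivity), poleSq]
  have h1 : (((k : ℝ) + 1) ^ 2 * δ) ^ j ≤ (poleSq k - a) ^ j := by gcongr
  have h2 : ((k : ℝ) + 1) ^ 2 * ((k : ℝ) + 1) ^ 2 ≤ (((k : ℝ) + 1) ^ 2) ^ j := by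
    rw [← pow_two]
    exact pow_le_pow_right₀ (by nlinarith) hj2
  have h3 : δ ^ 5 ≤ δ ^ j := pow_le_pow_of_le_one hδ0.le hδ1 hj5
  calc ((k : ℝ) + 1) ^ 2 * π ^ 2 * (δ ^ 5 * ((k : ℝ) + 1) ^ 2)
      = π ^ 2 * ((((k : ℝ) + 1) ^ 2 * ((k : ℝ) + 1) ^ 2) * δ ^ 5) := by ring
    _ ≤ π ^ 2 * ((((k : ℝ) + 1) ^ 2) ^ j * δ ^ j) := by gcongr
    _ = π ^ 2 * (((k : ℝ) + 1) ^ 2 * δ) ^ j := by rw [mul_pow]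
    _ ≤ _ := mul_le_mul_of_nonneg_left (by simpa only [poleSq] using h1) (by positivity)

lemma summable_cothCoeff {a δ : ℝ} (ha : 0 ≤ a) (hδ0 : 0 < δ) (hδ1 : δ ≤ 1)
    (hδ : δ ≤ π ^ 2 - a) {j : ℕ} (hj2 : 2 ≤ j) (hj5 : j ≤ 5) :
    Summable fun k : ℕ => poleSq k / (poleSq k - a) ^ j :=
  Summable.of_norm_bounded (summable_invSq.mul_left _)
    (cothCoeff_term_bound ha hδ0 hδ1 hδ hj2 hj5)

lemma cothCoeff_le {a δ : ℝ} (ha : 0 ≤ a) (hδ0 : 0 < δ) (hδ1 : δ ≤ 1)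
    (hδ : δ ≤ π ^ 2 - a) {j : ℕ} (hj2 : 2 ≤ j) (hj5 : j ≤ 5) :
    cothCoeff j a ≤ π ^ 2 / δ ^ 5 * invSqSum :=
  (le_abs_self _).trans (tsum_of_norm_bounded (summable_invSq.hasSum.mul_left _)
    (cothCoeff_term_bound ha hδ0 hδ1 hδ hj2 hj5))

lemma cothCoeff_nonneg {a δ : ℝ} (ha : 0 ≤ a) (hδ0 : 0 < δ) (hδ : δ ≤ π ^ 2 - a) (j : ℕ) :
    0 ≤ cothCoeff j a :=
  tsum_nonneg fun k => by
    have := poleSq_sub_pos ha hδ0 hδ k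
    have := poleSq_pos k
    positivity

lemma pi_sq_div_le_cothCoeff_two {a δ : ℝ} (ha : 0 ≤ a) (hδ0 : 0 < δ) (hδ1 : δ ≤ 1)
    (hδ : δ ≤ π ^ 2 - a) : π ^ 2 / (π ^ 2 - a) ^ 2 ≤ cothCoeff 2 a := by
  have := (summable_cothCoeff ha hδ0 hδ1 hδ le_rfl (by norm_num)).le_tsum 0 (fun k _ => by
    have := poleSq_sub_pos ha hδ0 hδ k
    have := poleSq_pos k
    positivity)
  simpa [poleSq, cothCoeff] using this

lemma taylor_term {A c : ℝ} (hA : 0 < A) (hc : 0 < c) {ζ : ℂ} (hζ : 0 ≤ ζ.re) :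
    ‖((A - c : ℝ) + ζ) / ((A - c : ℝ) + ζ + c) - (((A - c : ℝ) : ℂ) / ((A - c : ℝ) + c)
      + (c / A ^ 2 : ℝ) * ζ - (c / A ^ 3 : ℝ) * ζ ^ 2 + (c / A ^ 4 : ℝ) * ζ ^ 3)‖
      ≤ (c / A ^ 5) * ‖ζ‖ ^ 4 := by
  have hre : A ≤ ‖(A : ℂ) + ζ‖ := by
    refine le_trans ?_ (Complex.re_le_norm _)
    simp; linarith
  have hne : (A : ℂ) + ζ ≠ 0 := by
    rw [← norm_pos_iff]; linarith
  have hA' : (A : ℂ) ≠ 0 := by exact_mod_cast hA.ne'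
  have e0 : ((A - c : ℝ) : ℂ) + ζ + c = A + ζ := by push_cast; ring
  have e1 : ((A - c : ℝ) : ℂ) + c = A := by push_cast; ring
  have e : ((A - c : ℝ) + ζ) / ((A - c : ℝ) + ζ + c) - (((A - c : ℝ) : ℂ) / ((A - c : ℝ) + c)
      + (c / A ^ 2 : ℝ) * ζ - (c / A ^ 3 : ℝ) * ζ ^ 2 + (c / A ^ 4 : ℝ) * ζ ^ 3)
      = - ((c : ℂ) * ζ ^ 4 / (A ^ 4 * (A + ζ))) := by
    rw [e0, e1]
    push_cast
    field_simp
    ring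
  rw [e, norm_neg, norm_div, norm_mul, norm_mul, norm_pow, norm_pow,
    Complex.norm_of_nonneg hc.le, Complex.norm_of_nonneg hA.le, div_mul_eq_mul_div]
  have : A ^ 5 ≤ A ^ 4 * ‖(A : ℂ) + ζ‖ := by
    rw [pow_succ]; gcongr
  gcongr

/-- Third order Taylor expansion of `cothSeries` with a remainder bound on a whole half plane. -/
lemma cothSeries_taylor {a δ : ℝ} (ha : 0 ≤ a) (hδ0 : 0 < δ) (hδ1 : δ ≤ 1)
    (hδ : δ ≤ π ^ 2 - a) {ζ : ℂ} (hζ : 0 ≤ ζ.re) :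
    ‖cothSeries ((-a : ℝ) + ζ) - (cothSeries ((-a : ℝ) : ℂ) + 2 * cothCoeff 2 a * ζ
      - 2 * cothCoeff 3 a * ζ ^ 2 + 2 * cothCoeff 4 a * ζ ^ 3)‖ ≤ 2 * cothCoeff 5 a * ‖ζ‖ ^ 4 := by
  have hz1 : -a ≤ (((-a : ℝ) : ℂ) + ζ).re := by simp; linarith
  have hz2 : -a ≤ (((-a : ℝ) : ℂ)).re := by simp
  have s0 := (summable_cothSeries ha hδ0 hδ hz1).hasSum
  have s1 := (summable_cothSeries ha hδ0 hδ hz2).hasSum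
  have t (j : ℕ) (hj2 : 2 ≤ j) (hj5 : j ≤ 5) :
      HasSum (fun k => ((poleSq k / (poleSq k - a) ^ j : ℝ) : ℂ)) (cothCoeff j a : ℂ) :=
    Complex.hasSum_ofReal.2 (summable_cothCoeff ha hδ0 hδ1 hδ hj2 hj5).hasSum
  have s := s0.sub (((s1.add ((t 2 (by norm_num) (by norm_num)).mul_right ζ)).sub
    ((t 3 (by norm_num) (by norm_num)).mul_right (ζ ^ 2))).add
    ((t 4 (by norm_num) (by norm_num)).mul_right (ζ ^ 3)))
  have b := tsum_of_norm_bounded ((summable_cothCoeff ha hδ0 hδ1 hδ (j := 5) (by norm_num)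
    le_rfl).hasSum.mul_right (‖ζ‖ ^ 4)) (fun k => by
      have := taylor_term (poleSq_sub_pos ha hδ0 hδ k) (poleSq_pos k) hζ
      rw [show poleSq k - a - poleSq k = -a by ring] at this
      exact this)
  rw [s.tsum_eq] at b
  have e : cothSeries ((-a : ℝ) + ζ) - (cothSeries ((-a : ℝ) : ℂ) + 2 * cothCoeff 2 a * ζ
      - 2 * cothCoeff 3 a * ζ ^ 2 + 2 * cothCoeff 4 a * ζ ^ 3)
      = 2 * (∑' k : ℕ, (((-a : ℝ) : ℂ) + ζ) / (((-a : ℝ) : ℂ) + ζ + (poleSq k : ℂ))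
        - (∑' k : ℕ, ((-a : ℝ) : ℂ) / (((-a : ℝ) : ℂ) + (poleSq k : ℂ)) + cothCoeff 2 a * ζ
          - cothCoeff 3 a * ζ ^ 2 + cothCoeff 4 a * ζ ^ 3)) := by
    unfold cothSeries; ring
  rw [e, norm_mul, Complex.norm_ofNat, mul_assoc]
  gcongr
  exact b

lemma mul_I_div_pi_mem {s : ℂ} (hs : -π ^ 2 < (s ^ 2).re) (hs0 : s ≠ 0) :
    s * I / π ∈ Complex.integerComplement := by
  rw [Complex.mem_integerComplement_iff]
  rintro ⟨n, hn⟩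
  have hpi : (π : ℂ) ≠ 0 := by exact_mod_cast Real.pi_ne_zero
  have h1 : s = -(n * π * I) := by
    rw [eq_div_iff hpi] at hn
    linear_combination I * hn + s * Complex.I_sq
  have h2 : s ^ 2 = ((-((n : ℝ) ^ 2 * π ^ 2) : ℝ) : ℂ) := by
    rw [h1]; push_cast
    linear_combination (n * π) ^ 2 * Complex.I_sq
  rw [h2, Complex.ofReal_re] at hs
  have hn0 : n = 0 := by
    by_contra h
    have h3 : (1 : ℝ) ≤ (n : ℝ) ^ 2 := by
      have : (1 : ℤ) ≤ n ^ 2 := by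
        have := sq_nonneg n
        have : n ^ 2 ≠ 0 := pow_ne_zero 2 h
        omega
      exact_mod_cast this
    have : 0 < π ^ 2 := by positivity
    nlinarith
  exact hs0 (by rw [h1, hn0]; simp)

lemma cothSeries_sq_mul_sinh {s : ℂ} (hs : -π ^ 2 < (s ^ 2).re) :
    cothSeries (s ^ 2) * Complex.sinh s = s * Complex.cosh s := by
  rcases eq_or_ne s 0 with rfl | hs0
  · simp
  have hpi : (π : ℂ) ≠ 0 := by exact_mod_cast Real.pi_ne_zero
  have hmem := mul_I_div_pi_mem hs hs0
  have hx := cot_series_rep' hmem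
  have hsin := sin_pi_mul_ne_zero hmem
  have e1 : (π : ℂ) * (s * I / π) = s * I := by field_simp
  rw [e1, Complex.cot, Complex.sin_mul_I, Complex.cos_mul_I] at hx
  rw [e1, Complex.sin_mul_I] at hsin
  have hsh : Complex.sinh s ≠ 0 := left_ne_zero_of_mul hsin
  obtain ⟨a, δ, ha, hδ0, hδ, hza⟩ := exists_halfplane hs
  have e2 : ∀ n : ℕ, (1 / (s * I / π - (n + 1)) + 1 / (s * I / π + (n + 1)))
      = 2 * π / (s * I) * (s ^ 2 / (s ^ 2 + (poleSq n : ℂ))) := by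
    intro n
    have h1 := add_poleSq_ne_zero ha hδ0 hδ hza.le n
    have h2 : s * I / π - (n + 1) ≠ 0 := by
      simpa [sub_eq_add_neg] using integerComplement_add_ne_zero hmem (-(n + 1) : ℤ)
    have h3 : s * I / π + (n + 1) ≠ 0 := by
      simpa using (integerComplement_add_ne_zero hmem ((n : ℤ) + 1))
    have h4 : (s * I / π - (n + 1)) * (s * I / π + (n + 1)) =
        - (s ^ 2 + (poleSq n : ℂ)) / π ^ 2 := by
      unfold poleSq; push_cast
      field_simp
      linear_combination s ^ 2 * Complex.I_sq
    rw [div_add_div _ _ h2 h3, h4]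
    have hI := Complex.I_ne_zero
    field_simp
    linear_combination (-2 * s) * Complex.I_sq
  rw [tsum_congr e2, tsum_mul_left] at hx
  set T := ∑' k : ℕ, s ^ 2 / (s ^ 2 + (poleSq k : ℂ)) with hT
  have hI := Complex.I_ne_zero
  unfold cothSeries
  rw [← hT]
  field_simp at hx
  have := Complex.I_sq
  linear_combination (-1 : ℂ) * hx

/-- The partial products of the Euler product for `s / sinh s`, as functions of `z = s²`. -/
noncomputable def sinhProd (N : ℕ) (z : ℂ) : ℂ :=
  ∏ k ∈ Finset.range N, (poleSq k : ℂ) / (z + (poleSq k : ℂ))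

/-- The function `z` with `s / sinh s = sinhQuot (s²)`, as the limit of `sinhProd`. -/
noncomputable def sinhQuot (z : ℂ) : ℂ := 1 + ∑' k : ℕ, (sinhProd (k + 1) z - sinhProd k z)

lemma sinhProd_succ (N : ℕ) (z : ℂ) :
    sinhProd (N + 1) z = sinhProd N z * ((poleSq N : ℂ) / (z + (poleSq N : ℂ))) := by
  rw [sinhProd, Finset.prod_range_succ, sinhProd]

lemma norm_sinhProd_le {a δ : ℝ} (ha : 0 ≤ a) (hδ0 : 0 < δ) (hδ : δ ≤ π ^ 2 - a) {z : ℂ}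
    (hz : -a ≤ z.re) (N : ℕ) : ‖sinhProd N z‖ ≤ Real.exp (a / δ * invSqSum) := by
  have hterm : ∀ k : ℕ, ‖(poleSq k : ℂ) / (z + (poleSq k : ℂ))‖
      ≤ Real.exp (a / δ * (1 / ((k : ℝ) + 1) ^ 2)) := by
    intro k
    have h1 : poleSq k - a ≤ ‖z + (poleSq k : ℂ)‖ := by
      refine le_trans ?_ (Complex.re_le_norm _)
      simp; linarith
    have h0 := poleSq_sub_pos ha hδ0 hδ k
    have h2 := mul_le_poleSq_sub ha hδ k
    have h3 := poleSq_pos k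
    rw [norm_div, Complex.norm_of_nonneg h3.le]
    calc poleSq k / ‖z + (poleSq k : ℂ)‖ ≤ poleSq k / (poleSq k - a) := by gcongr
      _ = a / (poleSq k - a) + 1 := by field_simp; ring
      _ ≤ a / (((k : ℝ) + 1) ^ 2 * δ) + 1 := by gcongr
      _ = a / δ * (1 / ((k : ℝ) + 1) ^ 2) + 1 := by field_simp
      _ ≤ _ := Real.add_one_le_exp _
  unfold sinhProd
  rw [norm_prod]
  calc ∏ k ∈ Finset.range N, ‖(poleSq k : ℂ) / (z + (poleSq k : ℂ))‖
      ≤ ∏ k ∈ Finset.range N, Real.exp (a / δ * (1 / ((k : ℝ) + 1) ^ 2)) :=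
        Finset.prod_le_prod (fun _ _ => norm_nonneg _) (fun k _ => hterm k)
    _ = Real.exp (a / δ * ∑ k ∈ Finset.range N, (1 / ((k : ℝ) + 1) ^ 2)) := by
        rw [← Real.exp_sum, Finset.mul_sum]
    _ ≤ _ := by
        gcongr
        exact summable_invSq.sum_le_tsum _ (fun k _ => by positivity)

lemma norm_sinhProd_sub_le {a δ : ℝ} (ha : 0 ≤ a) (hδ0 : 0 < δ) (hδ : δ ≤ π ^ 2 - a) {z : ℂ}
    (hz : -a ≤ z.re) (k : ℕ) : ‖sinhProd (k + 1) z - sinhProd k z‖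
      ≤ Real.exp (a / δ * invSqSum) * (‖z‖ / δ) * (1 / ((k : ℝ) + 1) ^ 2) := by
  have hne := add_poleSq_ne_zero ha hδ0 hδ hz k
  have e : sinhProd (k + 1) z - sinhProd k z = - (sinhProd k z * (z / (z + (poleSq k : ℂ)))) := by
    rw [sinhProd_succ]; field_simp; ring
  rw [e, norm_neg, norm_mul, mul_assoc]
  gcongr
  · exact norm_sinhProd_le ha hδ0 hδ hz k
  · exact norm_cothSeries_term_le ha hδ0 hδ hz k

lemma tendsto_sinhProd {a δ : ℝ} (ha : 0 ≤ a) (hδ0 : 0 < δ) (hδ : δ ≤ π ^ 2 - a) {z : ℂ}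
    (hz : -a ≤ z.re) :
    Filter.Tendsto (fun N => sinhProd N z) Filter.atTop (nhds (sinhQuot z)) := by
  have hs : Summable fun k => sinhProd (k + 1) z - sinhProd k z :=
    Summable.of_norm_bounded (summable_invSq.mul_left _) (norm_sinhProd_sub_le ha hδ0 hδ hz)
  have h := (hs.hasSum.tendsto_sum_nat).const_add 1
  refine h.congr fun N => ?_
  rw [Finset.sum_range_sub (fun k => sinhProd k z)]
  simp [sinhProd]

lemma norm_sinhQuot_le {a δ : ℝ} (ha : 0 ≤ a) (hδ0 : 0 < δ) (hδ : δ ≤ π ^ 2 - a) {z : ℂ}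
    (hz : -a ≤ z.re) : ‖sinhQuot z‖ ≤ Real.exp (a / δ * invSqSum) :=
  le_of_tendsto (tendsto_sinhProd ha hδ0 hδ hz).norm
    (Filter.Eventually.of_forall (norm_sinhProd_le ha hδ0 hδ hz))

lemma differentiableAt_sinhQuot {z : ℂ} (hz : -π ^ 2 < z.re) :
    DifferentiableAt ℂ sinhQuot z := by
  obtain ⟨a, δ, ha, hδ0, hδ, hza⟩ := exists_halfplane hz
  have hU := isOpen_re_gt_norm_lt (-a) (‖z‖ + 1)
  have hP : ∀ N : ℕ, DifferentiableOn ℂ (sinhProd N) {w : ℂ | -a < w.re ∧ ‖w‖ < ‖z‖ + 1} := by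
    intro N
    unfold sinhProd
    refine DifferentiableOn.fun_finsetProd fun k _ => ?_
    intro w hw
    exact DifferentiableWithinAt.fun_div (by fun_prop) (by fun_prop)
      (add_poleSq_ne_zero ha hδ0 hδ hw.1.le k)
  have hd : DifferentiableOn ℂ (fun w : ℂ => ∑' k : ℕ, (sinhProd (k + 1) w - sinhProd k w))
      {w : ℂ | -a < w.re ∧ ‖w‖ < ‖z‖ + 1} := by
    refine differentiableOn_tsum_of_summable_norm
      (summable_invSq.mul_left (Real.exp (a / δ * invSqSum) * ((‖z‖ + 1) / δ)))
      (fun k => (hP (k + 1)).sub (hP k)) hU ?_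
    intro k w hw
    refine (norm_sinhProd_sub_le ha hδ0 hδ hw.1.le k).trans ?_
    have := hw.2.le
    gcongr
  have h := hd.differentiableAt (hU.mem_nhds ⟨hza, by simp⟩)
  unfold sinhQuot
  fun_prop

lemma sinhQuot_zero : sinhQuot 0 = 1 := by
  have h : ∀ N, sinhProd N 0 = 1 := fun N => Finset.prod_eq_one fun k _ => by
    rw [zero_add, div_self]
    exact_mod_cast (poleSq_pos k).ne'
  simp [sinhQuot, h]

lemma sinhProd_conj (N : ℕ) (z : ℂ) :
    sinhProd N (starRingEnd ℂ z) = starRingEnd ℂ (sinhProd N z) := by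
  simp [sinhProd]

lemma sinhQuot_conj (z : ℂ) :
    sinhQuot (starRingEnd ℂ z) = starRingEnd ℂ (sinhQuot z) := by
  simp [sinhQuot, Complex.conj_tsum, sinhProd_conj]

lemma sinhQuot_sq_mul_sinh {s : ℂ} (hs : -π ^ 2 < (s ^ 2).re) :
    sinhQuot (s ^ 2) * Complex.sinh s = s := by
  obtain ⟨a, δ, ha, hδ0, hδ, hza⟩ := exists_halfplane hs
  have hpi : (π : ℂ) ≠ 0 := by exact_mod_cast Real.pi_ne_zero
  have h1 := tendsto_euler_sin_prod (s * I / π)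
  have h2 := (tendsto_sinhProd ha hδ0 hδ hza.le).mul h1
  have e1 : (π : ℂ) * (s * I / π) = s * I := by field_simp
  rw [e1, Complex.sin_mul_I] at h2
  have h3 : ∀ N : ℕ, sinhProd N (s ^ 2) *
      (s * I * ∏ j ∈ Finset.range N, (1 - (s * I / π) ^ 2 / ((j : ℂ) + 1) ^ 2)) = s * I := by
    intro N
    have : sinhProd N (s ^ 2) *
      ∏ j ∈ Finset.range N, (1 - (s * I / π) ^ 2 / ((j : ℂ) + 1) ^ 2) = 1 := by
      rw [sinhProd, ← Finset.prod_mul_distrib]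
      refine Finset.prod_eq_one fun k _ => ?_
      have hne := add_poleSq_ne_zero ha hδ0 hδ hza.le k
      have hk : (k : ℂ) + 1 ≠ 0 := by exact_mod_cast k.succ_ne_zero
      have : (1 - (s * I / π) ^ 2 / ((k : ℂ) + 1) ^ 2) = (s ^ 2 + (poleSq k : ℂ)) / poleSq k := by
        unfold poleSq; push_cast
        field_simp
        linear_combination (-s ^ 2) * Complex.I_sq
      rw [this]
      have hp : (poleSq k : ℂ) ≠ 0 := by exact_mod_cast (poleSq_pos k).ne'
      field_simp
    linear_combination s * I * this
  have h4 := tendsto_nhds_unique h2 (tendsto_const_nhds.congr fun N => (h3 N).symm)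
  have hI := Complex.I_ne_zero
  apply mul_right_cancel₀ hI
  linear_combination h4

lemma prod_taylor {A : ℕ → ℝ} (hA : ∀ k, 0 < A k) {ζ : ℂ} (hζ : 0 ≤ ζ.re) (N : ℕ) :
    ‖∏ k ∈ Finset.range N, ((A k : ℂ) / (A k + ζ))‖ ≤ 1 ∧
    ‖∏ k ∈ Finset.range N, ((A k : ℂ) / (A k + ζ)) - 1‖
      ≤ (∑ k ∈ Finset.range N, 1 / A k) * ‖ζ‖ ∧
    ‖∏ k ∈ Finset.range N, ((A k : ℂ) / (A k + ζ)) -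
      (1 - (∑ k ∈ Finset.range N, 1 / A k : ℝ) * ζ)‖
      ≤ (∑ k ∈ Finset.range N, 1 / A k) ^ 2 * ‖ζ‖ ^ 2 := by
  induction N with
  | zero => simp
  | succ N ih =>
    obtain ⟨i1, i2, i3⟩ := ih
    rw [Finset.prod_range_succ, Finset.sum_range_succ]
    set P := ∏ k ∈ Finset.range N, ((A k : ℂ) / (A k + ζ))
    set σ := ∑ k ∈ Finset.range N, 1 / A k
    have hσ : 0 ≤ σ := Finset.sum_nonneg fun k _ => by have := hA k; positivity
    have hAN := hA N
    have hn : A N ≤ ‖(A N : ℂ) + ζ‖ := by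
      refine le_trans ?_ (Complex.re_le_norm _)
      simp; linarith
    have hne : (A N : ℂ) + ζ ≠ 0 := by
      rw [← norm_pos_iff]; linarith
    have hAN' : (A N : ℂ) ≠ 0 := by exact_mod_cast hAN.ne'
    have hf : ‖(A N : ℂ) / (A N + ζ)‖ ≤ 1 := by
      rw [norm_div, Complex.norm_of_nonneg hAN.le]
      exact div_le_one_of_le₀ hn (norm_nonneg _)
    have hf1 : ‖(1 / A N : ℝ) * ζ * ((A N : ℂ) / (A N + ζ))‖ ≤ 1 / A N * ‖ζ‖ := by
      rw [norm_mul, norm_mul, Complex.norm_of_nonneg (by positivity)]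
      exact mul_le_of_le_one_right (by positivity) hf
    have j1 : ‖P * ((A N : ℂ) / (A N + ζ))‖ ≤ 1 := by
      rw [norm_mul]; exact mul_le_one₀ i1 (norm_nonneg _) hf
    have e2 : P * ((A N : ℂ) / (A N + ζ)) - 1
        = (P - 1) - P * ((1 / A N : ℝ) * ζ * ((A N : ℂ) / (A N + ζ))) := by
      push_cast; field_simp; ring
    have j2 : ‖P * ((A N : ℂ) / (A N + ζ)) - 1‖ ≤ (σ + 1 / A N) * ‖ζ‖ := by
      rw [e2, add_mul]
      refine (norm_sub_le _ _).trans (add_le_add i2 ?_)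
      rw [norm_mul]
      calc _ ≤ 1 * ‖(1 / A N : ℝ) * ζ * ((A N : ℂ) / (A N + ζ))‖ := by gcongr
        _ ≤ _ := by rw [one_mul]; exact hf1
    refine ⟨j1, j2, ?_⟩
    have e3 : P * ((A N : ℂ) / (A N + ζ)) - (1 - (σ + 1 / A N : ℝ) * ζ)
        = (P - (1 - σ * ζ)) - (1 / A N : ℝ) * ζ * (P * ((A N : ℂ) / (A N + ζ)) - 1) := by
      push_cast; field_simp; ring
    rw [e3]
    refine (norm_sub_le _ _).trans ((add_le_add i3 ?_).trans
      (b := σ ^ 2 * ‖ζ‖ ^ 2 + 1 / A N * ‖ζ‖ * ((σ + 1 / A N) * ‖ζ‖)) ?_)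
    · rw [norm_mul, norm_mul, Complex.norm_of_nonneg (by positivity)]
      gcongr
    · have : 0 ≤ σ * (1 / A N) * ‖ζ‖ ^ 2 := by positivity
      nlinarith

/-- First order Taylor expansion of `sinhQuot` with a remainder bound on a whole half plane. -/
lemma sinhQuot_taylor {a δ : ℝ} (ha : 0 ≤ a) (hδ0 : 0 < δ) (hδ : δ ≤ π ^ 2 - a) :
    ∃ σ : ℝ, 0 ≤ σ ∧ σ ≤ invSqSum / δ ∧ ∀ ζ : ℂ, 0 ≤ ζ.re →
      ‖sinhQuot ((-a : ℝ) + ζ) - sinhQuot ((-a : ℝ) : ℂ) * (1 - σ * ζ)‖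
        ≤ ‖sinhQuot ((-a : ℝ) : ℂ)‖ * (σ ^ 2 * ‖ζ‖ ^ 2) := by
  have hpos := poleSq_sub_pos ha hδ0 hδ
  have hb : ∀ k : ℕ, 1 / (poleSq k - a) ≤ 1 / δ * (1 / ((k : ℝ) + 1) ^ 2) := by
    intro k
    have := mul_le_poleSq_sub ha hδ k
    rw [div_mul_div_comm, one_mul, mul_comm δ]
    gcongr
  have hs : Summable fun k : ℕ => 1 / (poleSq k - a) :=
    Summable.of_nonneg_of_le (fun k => by have := hpos k; positivity) hb (summable_invSq.mul_left _)
  refine ⟨∑' k : ℕ, 1 / (poleSq k - a), tsum_nonneg fun k => by have := hpos k; positivity, ?_, ?_⟩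
  · have := hs.tsum_le_tsum hb (summable_invSq.mul_left _)
    rw [tsum_mul_left] at this
    rw [div_eq_inv_mul, ← one_div]
    exact this
  intro ζ hζ
  have hz1 : -a ≤ (((-a : ℝ) : ℂ) + ζ).re := by simp; linarith
  have hz2 : -a ≤ (((-a : ℝ) : ℂ)).re := by simp
  have l1 := tendsto_sinhProd ha hδ0 hδ hz1
  have l2 := tendsto_sinhProd ha hδ0 hδ hz2
  have l3 := hs.hasSum.tendsto_sum_nat
  have l4 := (Complex.continuous_ofReal.tendsto _).comp l3
  refine le_of_tendsto_of_tendsto'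
    (l1.sub (l2.mul ((l4.mul_const ζ).const_sub 1))).norm
    (l2.norm.mul ((l3.pow 2).mul_const (‖ζ‖ ^ 2))) fun N => ?_
  have e : sinhProd N ((-a : ℝ) + ζ) = sinhProd N ((-a : ℝ) : ℂ) *
      ∏ k ∈ Finset.range N, (((poleSq k - a : ℝ) : ℂ) / ((poleSq k - a : ℝ) + ζ)) := by
    unfold sinhProd
    rw [← Finset.prod_mul_distrib]
    refine Finset.prod_congr rfl fun k _ => ?_
    have h1 := add_poleSq_ne_zero ha hδ0 hδ hz1 k
    have h2 := add_poleSq_ne_zero ha hδ0 hδ hz2 k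
    have h3 : ((poleSq k - a : ℝ) : ℂ) = ((-a : ℝ) : ℂ) + poleSq k := by push_cast; ring
    have h4 : ((-a : ℝ) : ℂ) + poleSq k + ζ = ((-a : ℝ) : ℂ) + ζ + poleSq k := by ring
    rw [h3, h4]
    field_simp
  have := (prod_taylor hpos hζ N).2.2
  rw [e, ← mul_sub, norm_mul]
  gcongr
  exact this

lemma cothSeries_real {r : ℝ} (hr : r ≠ 0) :
    cothSeries ((r ^ 2 : ℝ) : ℂ) = ((r * Real.cosh r / Real.sinh r : ℝ) : ℂ) := by
  have h := cothSeries_sq_mul_sinh (s := (r : ℂ)) (by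
    have : 0 < π ^ 2 := by positivity
    rw [← Complex.ofReal_pow, Complex.ofReal_re]
    nlinarith [sq_nonneg r])
  have hs : (Real.sinh r : ℂ) ≠ 0 := by
    exact_mod_cast Real.sinh_ne_zero.2 hr
  push_cast at hs ⊢
  rw [eq_div_iff hs, h]

lemma sinhQuot_real {r : ℝ} (hr : r ≠ 0) :
    sinhQuot ((r ^ 2 : ℝ) : ℂ) = ((r / Real.sinh r : ℝ) : ℂ) := by
  have h := sinhQuot_sq_mul_sinh (s := (r : ℂ)) (by
    have : 0 < π ^ 2 := by positivity
    rw [← Complex.ofReal_pow, Complex.ofReal_re]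
    nlinarith [sq_nonneg r])
  have hs : (Real.sinh r : ℂ) ≠ 0 := by
    exact_mod_cast Real.sinh_ne_zero.2 hr
  push_cast at hs ⊢
  rw [eq_div_iff hs, h]

lemma cothSeries_neg_sq {y : ℝ} (hy0 : 0 < y) (hy : y < π) :
    cothSeries ((-(y ^ 2) : ℝ) : ℂ) = ((y * Real.cos y / Real.sin y : ℝ) : ℂ) := by
  have e : ((y : ℂ) * I) ^ 2 = ((-(y ^ 2) : ℝ) : ℂ) := by
    push_cast; rw [mul_pow, Complex.I_sq]; ring
  have h := cothSeries_sq_mul_sinh (s := (y : ℂ) * I) (by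
    rw [e, Complex.ofReal_re]; nlinarith)
  rw [e, Complex.sinh_mul_I, Complex.cosh_mul_I] at h
  have hs : (Real.sin y : ℂ) ≠ 0 := by
    exact_mod_cast (Real.sin_pos_of_pos_of_lt_pi hy0 hy).ne'
  rw [Complex.ofReal_div, eq_div_iff hs]
  push_cast at h ⊢
  apply mul_right_cancel₀ Complex.I_ne_zero
  linear_combination h

lemma sinhQuot_neg_sq {y : ℝ} (hy0 : 0 < y) (hy : y < π) :
    sinhQuot ((-(y ^ 2) : ℝ) : ℂ) = ((y / Real.sin y : ℝ) : ℂ) := by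
  have e : ((y : ℂ) * I) ^ 2 = ((-(y ^ 2) : ℝ) : ℂ) := by
    push_cast; rw [mul_pow, Complex.I_sq]; ring
  have h := sinhQuot_sq_mul_sinh (s := (y : ℂ) * I) (by
    rw [e, Complex.ofReal_re]; nlinarith)
  rw [e, Complex.sinh_mul_I] at h
  have hs : (Real.sin y : ℂ) ≠ 0 := by
    exact_mod_cast (Real.sin_pos_of_pos_of_lt_pi hy0 hy).ne'
  rw [Complex.ofReal_div, eq_div_iff hs]
  push_cast at h ⊢
  apply mul_right_cancel₀ Complex.I_ne_zero
  linear_combination h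

lemma theta_of_pos {y : ℝ} (hy0 : 0 < y) :
    theta y = (2 * y - Real.sin (2 * y)) / (2 * Real.sin y ^ 2) := by
  rw [theta, if_neg hy0.ne']

lemma hasDerivAt_mul_cot {y : ℝ} (hy0 : 0 < y) (hy : y < π) :
    HasDerivAt (fun y : ℝ => y * Real.cos y / Real.sin y) (-theta y) y := by
  have hs := (Real.sin_pos_of_pos_of_lt_pi hy0 hy).ne'
  have h := ((hasDerivAt_id y).mul (Real.hasDerivAt_cos y)).div (Real.hasDerivAt_sin y) hs
  refine h.congr_deriv ?_
  rw [theta_of_pos hy0, Real.sin_two_mul]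
  simp only [id, Pi.mul_apply]
  field_simp
  linear_combination (-y) * Real.sin_sq_add_cos_sq y

lemma hasDerivAt_theta {y : ℝ} (hy0 : 0 < y) (hy : y < π) :
    HasDerivAt theta (2 * (Real.sin y - y * Real.cos y) / Real.sin y ^ 3) y := by
  have hs := (Real.sin_pos_of_pos_of_lt_pi hy0 hy).ne'
  have h2 : HasDerivAt (fun y : ℝ => Real.sin (2 * y)) (Real.cos (2 * y) * 2) y := by
    have := (hasDerivAt_id y).const_mul 2
    simpa using this.sin
  have h := (((hasDerivAt_id y).const_mul 2).sub h2).div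
    (((Real.hasDerivAt_sin y).pow 2).const_mul 2) (by simpa using hs)
  refine (h.congr_deriv ?_).congr_of_eventuallyEq ?_
  · simp only [id, Pi.sub_apply, Pi.pow_apply]
    rw [Real.cos_two_mul, Real.sin_two_mul]
    field_simp
    push_cast
    ring
  · filter_upwards [eventually_gt_nhds hy0] with z hz
    rw [theta_of_pos hz]
    simp

lemma exists_gap {y : ℝ} (hy0 : 0 < y) (hy : y < π) :
    ∃ b δ : ℝ, y < b ∧ 0 < δ ∧ δ ≤ 1 ∧ ∀ x ∈ Set.Ioo 0 b, δ ≤ π ^ 2 - x ^ 2 := by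
  obtain ⟨b, hyb, hb⟩ := exists_between hy
  refine ⟨b, min 1 (π ^ 2 - b ^ 2), hyb, lt_min one_pos ?_, min_le_left _ _, fun x hx => ?_⟩
  · nlinarith
  · refine (min_le_right _ _).trans ?_
    have := hx.1
    have := hx.2
    nlinarith

lemma hasDerivAt_tsum_pole {y : ℝ} (hy0 : 0 < y) (hy : y < π) {j : ℕ} (hj1 : 1 ≤ j) (hj4 : j ≤ 4)
    {g : ℕ → ℝ → ℝ}
    (hg : ∀ k x, poleSq k - x ^ 2 ≠ 0 →
      HasDerivAt (g k) (2 * j * x * (poleSq k / (poleSq k - x ^ 2) ^ (j + 1))) x)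
    (hs : Summable fun k => g k y) :
    HasDerivAt (fun x => ∑' k, g k x) (2 * j * y * cothCoeff (j + 1) (y ^ 2)) y := by
  obtain ⟨b, δ, hyb, hδ0, hδ1, hδ⟩ := exists_gap hy0 hy
  have h := hasDerivAt_tsum_of_isPreconnected (t := Set.Ioo 0 b)
    (g := g) (g' := fun k x => 2 * j * x * (poleSq k / (poleSq k - x ^ 2) ^ (j + 1))) (y := y)
    (y₀ := y) (summable_invSq.mul_left (2 * j * b * (π ^ 2 / δ ^ 5))) isOpen_Ioo isPreconnected_Ioo
    (fun k x hx => hg k x (poleSq_sub_pos (sq_nonneg x) hδ0 (hδ x hx) k).ne')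
    (fun k x hx => ?_) ⟨hy0, hyb⟩ hs ⟨hy0, hyb⟩
  · rwa [tsum_mul_left] at h
  · have h1 := cothCoeff_term_bound (sq_nonneg x) hδ0 hδ1 (hδ x hx) (j := j + 1) (by omega)
      (by omega) k
    have hx0 := hx.1
    have hxb := hx.2.le
    have hb0 : 0 < b := hx0.trans hx.2
    rw [norm_mul, Real.norm_of_nonneg (by positivity), mul_assoc _ (π ^ 2 / δ ^ 5)]
    gcongr

lemma cothSeries_real_series {y δ : ℝ} (hδ0 : 0 < δ) (hδ : δ ≤ π ^ 2 - y ^ 2) :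
    Summable (fun k => 1 - poleSq k / (poleSq k - y ^ 2)) ∧
    (cothSeries ((-(y ^ 2) : ℝ) : ℂ)).re = 1 + 2 * ∑' k, (1 - poleSq k / (poleSq k - y ^ 2)) := by
  have hz : -(y ^ 2) ≤ ((-(y ^ 2) : ℝ) : ℂ).re := by rw [Complex.ofReal_re]
  have e : (fun k => (((-(y ^ 2) : ℝ) : ℂ) / (((-(y ^ 2) : ℝ) : ℂ) + (poleSq k : ℂ))).re)
      = fun k => 1 - poleSq k / (poleSq k - y ^ 2) := by
    funext k
    have h1 := (poleSq_sub_pos (sq_nonneg y) hδ0 hδ k).ne'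
    rw [← Complex.ofReal_add, ← Complex.ofReal_div, Complex.ofReal_re, neg_add_eq_sub]
    field_simp
    ring
  have s := (Complex.hasSum_re (summable_cothSeries (sq_nonneg y) hδ0 hδ hz).hasSum).summable
  rw [e] at s
  exact ⟨s, by rw [re_cothSeries (sq_nonneg y) hδ0 hδ hz, e]⟩

lemma theta_eq {y : ℝ} (hy0 : 0 < y) (hy : y < π) :
    theta y = 4 * y * cothCoeff 2 (y ^ 2) := by
  obtain ⟨b, δ, hyb, hδ0, hδ1, hδ⟩ := exists_gap hy0 hy
  have h1 := hasDerivAt_tsum_pole hy0 hy (j := 1) le_rfl (by norm_num)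
    (g := fun k x => - (1 - poleSq k / (poleSq k - x ^ 2))) (fun k x hx => by
      have := ((((hasDerivAt_id x).pow 2).const_sub (poleSq k)).inv hx).const_mul (poleSq k)
      have := (this.const_sub 1).neg
      refine (this.congr_deriv ?_)
      simp; field_simp)
    (cothSeries_real_series hδ0 (hδ y ⟨hy0, hyb⟩)).1.neg
  have h2 : HasDerivAt (fun y : ℝ => y * Real.cos y / Real.sin y)
      (-(4 * y * cothCoeff 2 (y ^ 2))) y := by
    have := (h1.const_mul (-2)).const_add 1
    refine (this.congr_deriv (by push_cast; ring)).congr_of_eventuallyEq ?_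
    filter_upwards [Ioo_mem_nhds hy0 (lt_min hyb hy)] with x hx
    have hx0 := hx.1
    have hxb := hx.2.trans_le (min_le_left _ _)
    have hxpi := hx.2.trans_le (min_le_right _ _)
    have := (cothSeries_real_series hδ0 (hδ x ⟨hx0, hxb⟩)).2
    rw [cothSeries_neg_sq hx0 hxpi, Complex.ofReal_re] at this
    rw [this, tsum_neg]
    ring
  have := (hasDerivAt_mul_cot hy0 hy).unique h2
  linarith

lemma deriv_theta_eq {y : ℝ} (hy0 : 0 < y) (hy : y < π) :
    2 * (Real.sin y - y * Real.cos y) / Real.sin y ^ 3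
      = 4 * cothCoeff 2 (y ^ 2) + 16 * y ^ 2 * cothCoeff 3 (y ^ 2) := by
  obtain ⟨b, δ, hyb, hδ0, hδ1, hδ⟩ := exists_gap hy0 hy
  have h1 := hasDerivAt_tsum_pole hy0 hy (j := 2) (by norm_num) (by norm_num)
    (g := fun k x => poleSq k / (poleSq k - x ^ 2) ^ 2) (fun k x hx => by
      have := (((((hasDerivAt_id x).pow 2).const_sub (poleSq k)).pow 2).inv
        (pow_ne_zero 2 hx)).const_mul (poleSq k)
      refine (this.congr_deriv ?_)
      simp; field_simp)
    (summable_cothCoeff (sq_nonneg y) hδ0 hδ1 (hδ y ⟨hy0, hyb⟩) le_rfl (by norm_num))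
  have h2 := ((hasDerivAt_id y).const_mul 4).mul h1
  refine (hasDerivAt_theta hy0 hy).unique
    ((h2.congr_deriv ?_).congr_of_eventuallyEq ?_)
  · simp [cothCoeff]; ring
  · filter_upwards [Ioo_mem_nhds hy0 hy] with x hx
    rw [theta_eq hx.1 hx.2]
    rfl

lemma cothSeries_sub_one_ge {r : ℝ} (hr : 0 ≤ r) :
    r ^ 2 / (7 * (1 + r)) ≤ (cothSeries ((r ^ 2 : ℝ) : ℂ)).re - 1 := by
  rcases le_or_gt r 2 with h2 | h2
  · have hδ : π ^ 2 ≤ π ^ 2 - 0 := by simp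
    have hpi : 0 < π ^ 2 := by positivity
    have hz : -0 ≤ ((r ^ 2 : ℝ) : ℂ).re := by
      rw [Complex.ofReal_re]; nlinarith
    have hpi10 : π ^ 2 < 10 := by
      have := Real.pi_lt_d2
      have := Real.pi_pos
      nlinarith
    rw [re_cothSeries le_rfl hpi hδ hz]
    have s := (Complex.hasSum_re (summable_cothSeries le_rfl hpi hδ hz).hasSum).summable
    have e : ∀ k, (((r ^ 2 : ℝ) : ℂ) / (((r ^ 2 : ℝ) : ℂ) + (poleSq k : ℂ))).re
        = r ^ 2 / (r ^ 2 + poleSq k) := fun k => by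
      rw [← Complex.ofReal_add, ← Complex.ofReal_div, Complex.ofReal_re]
    have h0 := s.le_tsum 0 (fun k _ => by
      have := poleSq_pos k
      rw [e]; positivity)
    rw [e] at h0
    have hp0 : poleSq 0 = π ^ 2 := by simp [poleSq]
    rw [hp0] at h0
    have h1 : r ^ 2 / (7 * (1 + r)) ≤ 2 * (r ^ 2 / (r ^ 2 + π ^ 2)) := by
      rw [← mul_div_assoc, div_le_div_iff₀ (by positivity) (by positivity)]
      have : r ^ 2 + π ^ 2 ≤ 2 * (7 * (1 + r)) := by nlinarith
      calc r ^ 2 * (r ^ 2 + π ^ 2) ≤ r ^ 2 * (2 * (7 * (1 + r))) := by gcongr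
        _ = _ := by ring
    linarith
  · have hr0 : 0 < r := by linarith
    rw [cothSeries_real hr0.ne', Complex.ofReal_re]
    have hsh : 0 < Real.sinh r := Real.sinh_pos_iff.2 hr0
    have hsc : Real.sinh r ≤ Real.cosh r := (Real.sinh_lt_cosh r).le
    have h1 : r ≤ r * Real.cosh r / Real.sinh r := by
      rw [le_div_iff₀ hsh]; gcongr
    have h3 : r ^ 2 / (7 * (1 + r)) ≤ r - 1 := by
      rw [div_le_iff₀ (by positivity)]
      nlinarith
    linarith

/-- If `theta y` is bounded then `y` stays away from `π`. -/
lemma exists_uniform_gap (C : ℝ) (hC : 0 < C) :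
    ∃ δ : ℝ, 0 < δ ∧ δ ≤ 1 ∧ ∀ y, 0 < y → y < π → theta y ≤ C → δ ≤ π ^ 2 - y ^ 2 := by
  refine ⟨min 1 (1 / C), by positivity, min_le_left _ _, fun y hy0 hy hθ => ?_⟩
  rcases le_or_gt y 1 with h1 | h1
  · refine (min_le_left _ _).trans ?_
    have := Real.pi_gt_three
    nlinarith
  by_contra! hlt
  have hg : 0 < π ^ 2 - y ^ 2 := by nlinarith
  have l1 := hlt.trans_le (min_le_left _ _)
  have l2 := hlt.trans_le (min_le_right _ _)
  have hS := pi_sq_div_le_cothCoeff_two (sq_nonneg y) hg l1.le le_rfl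
  rw [theta_eq hy0 hy] at hθ
  have hpi := Real.pi_gt_three
  have h3 : 1 / (π ^ 2 - y ^ 2) ≤ π ^ 2 / (π ^ 2 - y ^ 2) ^ 2 := by
    rw [div_le_div_iff₀ hg (by positivity)]
    have : (π ^ 2 - y ^ 2) ^ 2 ≤ 1 * (π ^ 2 - y ^ 2) := by
      rw [pow_two]; gcongr
    nlinarith
  have h4 : C < 1 / (π ^ 2 - y ^ 2) := by
    rw [lt_div_iff₀ hg]
    rw [lt_div_iff₀ hC] at l2
    linarith
  nlinarith

/-- Shift of the contour of integration from the real line to a parallel line. -/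
lemma integral_shift_line {f : ℂ → ℂ} {y C : ℝ} (hy : 0 ≤ y)
    (hd : ∀ w : ℂ, 0 ≤ w.im → w.im ≤ y → DifferentiableAt ℂ f w)
    (hb : ∀ u τ : ℝ, 0 ≤ τ → τ ≤ y → ‖f (u + τ * I)‖ ≤ C * (1 + u ^ 2)⁻¹) :
    ∫ u : ℝ, f u = ∫ u : ℝ, f (u + y * I) := by
  have hC : 0 ≤ C := by
    have := (norm_nonneg _).trans (hb 0 0 le_rfl hy)
    simpa using this
  have h_int : ∀ τ : ℝ, 0 ≤ τ → τ ≤ y → Integrable fun u : ℝ => f (u + τ * I) := by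
    intro τ h0 h1
    refine (integrable_inv_one_add_sq.const_mul C).mono' ?_
      (Filter.Eventually.of_forall fun u => hb u τ h0 h1)
    refine Continuous.aestronglyMeasurable (continuous_iff_continuousAt.2 fun u => ?_)
    have hf : ContinuousAt f ((u : ℂ) + τ * I) :=
      (hd _ (by simpa using h0) (by simpa using h1)).continuousAt
    exact ContinuousAt.comp (f := fun u : ℝ => (u : ℂ) + τ * I) hf (by fun_prop)
  have hi0 : Integrable fun u : ℝ => f u := by simpa using h_int 0 le_rfl hy
  have t0 := intervalIntegral_tendsto_integral hi0 Filter.tendsto_neg_atTop_atBot Filter.tendsto_id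
  have t1 := intervalIntegral_tendsto_integral (h_int y hy le_rfl)
    Filter.tendsto_neg_atTop_atBot Filter.tendsto_id
  have hv : ∀ T : ℝ, ‖∫ τ : ℝ in (0 : ℝ)..y, f (T + τ * I)‖ ≤ C * (1 + T ^ 2)⁻¹ * |y - 0| := by
    intro T
    refine intervalIntegral.norm_integral_le_of_norm_le_const fun τ hτ => ?_
    rw [Set.uIoc_of_le hy] at hτ
    exact hb T τ hτ.1.le hτ.2
  have hlim : Filter.Tendsto (fun T : ℝ => C * (1 + T ^ 2)⁻¹ * |y - 0|) Filter.atTop (nhds 0) := by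
    have h1 : Filter.Tendsto (fun T : ℝ => 1 + T ^ 2) Filter.atTop Filter.atTop :=
      Filter.tendsto_atTop_add_const_left _ _ (Filter.tendsto_pow_atTop two_ne_zero)
    simpa using (h1.inv_tendsto_atTop.const_mul C).mul_const |y - 0|
  have v1 : Filter.Tendsto (fun T : ℝ => ∫ τ : ℝ in (0 : ℝ)..y, f (T + τ * I))
      Filter.atTop (nhds 0) := squeeze_zero_norm hv hlim
  have v2 : Filter.Tendsto (fun T : ℝ => ∫ τ : ℝ in (0 : ℝ)..y, f (-T + τ * I))
      Filter.atTop (nhds 0) := by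
    refine squeeze_zero_norm (fun T => ?_) hlim
    simpa using hv (-T)
  have hz : ∀ T : ℝ, (∫ u : ℝ in -T..T, f u) - (∫ u : ℝ in -T..T, f (u + y * I))
      + I * (∫ τ : ℝ in (0 : ℝ)..y, f (T + τ * I))
      - I * (∫ τ : ℝ in (0 : ℝ)..y, f (-T + τ * I)) = 0 := by
    intro T
    have := integral_boundary_rect_eq_zero_of_differentiableOn f (-T) (T + y * I)
      (fun w hw => by
        rw [Complex.mem_reProdIm] at hw
        have h2 := hw.2
        simp only [Complex.neg_im, Complex.ofReal_im, neg_zero, Complex.add_im, Complex.mul_im,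
          Complex.ofReal_re, Complex.I_im, mul_one, Complex.I_re, mul_zero, add_zero, zero_add,
          Set.uIcc_of_le hy] at h2
        exact (hd w h2.1 h2.2).differentiableWithinAt)
    simpa using this
  have hlimz := ((t0.sub t1).add (v1.const_mul I)).sub (v2.const_mul I)
  have := tendsto_nhds_unique hlimz (tendsto_const_nhds.congr fun T => (hz T).symm)
  simp only [mul_zero, add_zero, sub_zero] at this
  exact sub_eq_zero.1 this

lemma measurePreserving_euclidean_succ (m : ℕ) :
    MeasurePreserving ((MeasurableEquiv.toLp 2 (Fin (m + 1) → ℝ)).symm.trans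
      (MeasurableEquiv.piFinSuccAbove (fun _ : Fin (m + 1) => ℝ) 0)) volume volume :=
  (volume_preserving_piFinSuccAbove (fun _ : Fin (m + 1) => ℝ) 0).comp
    (EuclideanSpace.volume_preserving_symm_measurableEquiv_toLp (Fin (m + 1)))

/-- Shift of the first variable of an integral over a Euclidean space into the complex domain. -/
lemma integral_shift_euclidean {m : ℕ} {f : ℂ → (Fin m → ℝ) → ℂ} {y C : ℝ} (hy : 0 ≤ y)
    (hd : ∀ v, ∀ w : ℂ, 0 ≤ w.im → w.im ≤ y → DifferentiableAt ℂ (fun w => f w v) w)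
    (hc : ∀ τ : ℝ, 0 ≤ τ → τ ≤ y →
      Continuous fun p : ℝ × (Fin m → ℝ) => f ((p.1 : ℂ) + τ * I) p.2)
    (hb : ∀ (l : EuclideanSpace ℝ (Fin (m + 1))) (τ : ℝ), 0 ≤ τ → τ ≤ y →
      ‖f ((l 0 : ℂ) + τ * I) (fun i => l i.succ)‖ ≤ C * (1 + ‖l‖) ^ (-((m + 2 : ℕ) : ℝ))) :
    Integrable (fun l : EuclideanSpace ℝ (Fin (m + 1)) =>
      f ((l 0 : ℂ) + y * I) (fun i => l i.succ)) ∧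
    ∫ l : EuclideanSpace ℝ (Fin (m + 1)), f (l 0 : ℂ) (fun i => l i.succ)
      = ∫ l : EuclideanSpace ℝ (Fin (m + 1)), f ((l 0 : ℂ) + y * I) (fun i => l i.succ) := by
  have hmp := measurePreserving_euclidean_succ m
  have hC : 0 ≤ C := by
    have := (norm_nonneg _).trans (hb 0 0 le_rfl hy)
    simpa using this
  have h_int : ∀ τ : ℝ, 0 ≤ τ → τ ≤ y → Integrable (fun l : EuclideanSpace ℝ (Fin (m + 1)) =>
      f ((l 0 : ℂ) + τ * I) (fun i => l i.succ)) := by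
    intro τ h0 h1
    have hfin : (Module.finrank ℝ (EuclideanSpace ℝ (Fin (m + 1))) : ℝ) < ((m + 2 : ℕ) : ℝ) := by
      rw [finrank_euclideanSpace_fin]; exact_mod_cast Nat.lt_succ_self _
    refine ((integrable_one_add_norm hfin).const_mul C).mono' ?_
      (Filter.Eventually.of_forall fun l => hb l τ h0 h1)
    have hcl : Continuous fun l : EuclideanSpace ℝ (Fin (m + 1)) =>
        ((l 0, fun i : Fin m => l i.succ) : ℝ × (Fin m → ℝ)) := by fun_prop
    exact ((hc τ h0 h1).comp hcl).aestronglyMeasurable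
  have hprod : ∀ τ : ℝ, 0 ≤ τ → τ ≤ y →
      Integrable (fun p : ℝ × (Fin m → ℝ) => f ((p.1 : ℂ) + τ * I) p.2) (volume.prod volume) ∧
      ∫ l : EuclideanSpace ℝ (Fin (m + 1)), f ((l 0 : ℂ) + τ * I) (fun i => l i.succ)
        = ∫ v : Fin m → ℝ, ∫ u : ℝ, f ((u : ℂ) + τ * I) v := by
    intro τ h0 h1
    have hi : Integrable (fun p : ℝ × (Fin m → ℝ) => f ((p.1 : ℂ) + τ * I) p.2)
        (volume.prod volume) :=
      (hmp.integrable_comp_emb (MeasurableEquiv.measurableEmbedding _)).1 (h_int τ h0 h1)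
    refine ⟨hi, ?_⟩
    have := hmp.integral_comp' (fun p : ℝ × (Fin m → ℝ) => f ((p.1 : ℂ) + τ * I) p.2)
    exact this.trans (integral_prod_symm _ hi)
  refine ⟨h_int y hy le_rfl, ?_⟩
  have e0 := (hprod 0 le_rfl hy).2
  have e1 := (hprod y hy le_rfl).2
  simp only [Complex.ofReal_zero, zero_mul, add_zero] at e0
  rw [e0, e1]
  refine integral_congr_ae (Filter.Eventually.of_forall fun v => ?_)
  refine integral_shift_line hy (hd v) (C := C) fun u τ h0 h1 => ?_
  have h := hb (WithLp.toLp 2 (Fin.cons u v)) τ h0 h1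
  simp only [Fin.cons_zero, Fin.cons_succ] at h
  refine h.trans ?_
  gcongr
  have hu : |u| ≤ ‖(WithLp.toLp 2 (Fin.cons u v) : EuclideanSpace ℝ (Fin (m + 1)))‖ := by
    have := PiLp.norm_apply_le (WithLp.toLp 2 (Fin.cons u v) : EuclideanSpace ℝ (Fin (m + 1))) 0
    simpa using this
  set r := ‖(WithLp.toLp 2 (Fin.cons u v) : EuclideanSpace ℝ (Fin (m + 1)))‖
  have hr : 0 ≤ r := norm_nonneg _
  rw [Real.rpow_neg (by positivity), Real.rpow_natCast]
  apply inv_anti₀ (by positivity)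
  have h2 : (1 + r) ^ 2 ≤ (1 + r) ^ (m + 2) := pow_le_pow_right₀ (by linarith) (by omega)
  have h3 : u ^ 2 ≤ r ^ 2 := by
    rw [← sq_abs u]; gcongr
  nlinarith

/-- `f` agrees with the real number `f₀` up to an error whose real part is quadratic and whose
imaginary part is linear in `r`, both with polynomial growth. -/
def NearReal (K : ℝ) (N : ℕ) (r f₀ : ℝ) (f : ℂ) : Prop :=
  |f₀| ≤ K ∧ |f.re - f₀| ≤ K * (r ^ 2 * (1 + r) ^ N) ∧ |f.im| ≤ K * (r * (1 + r) ^ N)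

lemma NearReal.mul {K₁ K₂ : ℝ} {N₁ N₂ : ℕ} {r f₀ g₀ : ℝ} {f g : ℂ} (hr : 0 ≤ r)
    (hf : NearReal K₁ N₁ r f₀ f) (hg : NearReal K₂ N₂ r g₀ g) :
    NearReal (4 * (K₁ * K₂)) (N₁ + N₂ + 2) r (f₀ * g₀) (f * g) := by
  obtain ⟨f1, f2, f3⟩ := hf
  obtain ⟨g1, g2, g3⟩ := hg
  have hK1 : 0 ≤ K₁ := (abs_nonneg _).trans f1
  have hK2 : 0 ≤ K₂ := (abs_nonneg _).trans g1
  have hP1 : 1 ≤ (1 + r) ^ N₁ := one_le_pow₀ (by linarith)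
  have hP2 : 1 ≤ (1 + r) ^ N₂ := one_le_pow₀ (by linarith)
  have hP3 : (1 + r) ^ (N₁ + N₂ + 2) = (1 + r) ^ N₁ * (1 + r) ^ N₂ * (1 + r) ^ 2 := by ring
  set P₁ := (1 + r) ^ N₁
  set P₂ := (1 + r) ^ N₂
  have hKK : 0 ≤ K₁ * K₂ := by positivity
  have hPP : 1 ≤ P₁ * P₂ := one_le_mul_of_one_le_of_one_le hP1 hP2
  have hPP1 : P₁ ≤ P₁ * P₂ := le_mul_of_one_le_right (by linarith) hP2
  have hPP2 : P₂ ≤ P₁ * P₂ := le_mul_of_one_le_left (by linarith) hP1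
  have hr2 : r ^ 2 ≤ (1 + r) ^ 2 := by gcongr; linarith
  have hr1 : 1 ≤ (1 + r) ^ 2 := one_le_pow₀ (by linarith)
  have hS : P₁ * P₂ ≤ P₁ * P₂ * (1 + r) ^ 2 := le_mul_of_one_le_right (by positivity) hr1
  rw [NearReal, hP3]
  refine ⟨?_, ?_, ?_⟩
  · rw [abs_mul]
    nlinarith [mul_le_mul f1 g1 (abs_nonneg _) hK1]
  · have e : (f * g).re - f₀ * g₀ = (f.re - f₀) * (g.re - g₀) + (f.re - f₀) * g₀
        + f₀ * (g.re - g₀) - f.im * g.im := by rw [Complex.mul_re]; ring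
    have h1 : |(f.re - f₀) * (g.re - g₀)| ≤ K₁ * K₂ * (r ^ 2 * (P₁ * P₂ * (1 + r) ^ 2)) := by
      rw [abs_mul]
      refine (mul_le_mul f2 g2 (abs_nonneg _) (by positivity)).trans ?_
      calc _ = K₁ * K₂ * (r ^ 2 * (P₁ * P₂ * r ^ 2)) := by ring
        _ ≤ _ := by gcongr
    have h2 : |(f.re - f₀) * g₀| ≤ K₁ * K₂ * (r ^ 2 * (P₁ * P₂ * (1 + r) ^ 2)) := by
      rw [abs_mul]
      refine (mul_le_mul f2 g1 (abs_nonneg _) (by positivity)).trans ?_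
      calc _ = K₁ * K₂ * (r ^ 2 * P₁) := by ring
        _ ≤ _ := by gcongr; linarith
    have h3 : |f₀ * (g.re - g₀)| ≤ K₁ * K₂ * (r ^ 2 * (P₁ * P₂ * (1 + r) ^ 2)) := by
      rw [abs_mul]
      refine (mul_le_mul f1 g2 (abs_nonneg _) (by positivity)).trans ?_
      calc _ = K₁ * K₂ * (r ^ 2 * P₂) := by ring
        _ ≤ _ := by gcongr; linarith
    have h4 : |f.im * g.im| ≤ K₁ * K₂ * (r ^ 2 * (P₁ * P₂ * (1 + r) ^ 2)) := by
      rw [abs_mul]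
      refine (mul_le_mul f3 g3 (abs_nonneg _) (by positivity)).trans ?_
      calc _ = K₁ * K₂ * (r ^ 2 * (P₁ * P₂)) := by ring
        _ ≤ _ := by gcongr
    rw [e]
    rw [abs_le] at *
    constructor <;> linarith [h1.1, h1.2, h2.1, h2.2, h3.1, h3.2, h4.1, h4.2]
  · have hfre : |f.re| ≤ 2 * K₁ * (P₁ * (1 + r) ^ 2) := by
      have : |f.re| ≤ |f.re - f₀| + |f₀| := by
        simpa using abs_add_le (f.re - f₀) f₀
      have h1 : K₁ * (r ^ 2 * P₁) ≤ K₁ * (P₁ * (1 + r) ^ 2) := by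
        rw [mul_comm P₁]; gcongr
      have h2 : K₁ * 1 ≤ K₁ * (P₁ * (1 + r) ^ 2) := by
        gcongr; exact one_le_mul_of_one_le_of_one_le hP1 hr1
      linarith
    have hgre : |g.re| ≤ 2 * K₂ * (P₂ * (1 + r) ^ 2) := by
      have : |g.re| ≤ |g.re - g₀| + |g₀| := by
        simpa using abs_add_le (g.re - g₀) g₀
      have h1 : K₂ * (r ^ 2 * P₂) ≤ K₂ * (P₂ * (1 + r) ^ 2) := by
        rw [mul_comm P₂]; gcongr
      have h2 : K₂ * 1 ≤ K₂ * (P₂ * (1 + r) ^ 2) := by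
        gcongr; exact one_le_mul_of_one_le_of_one_le hP2 hr1
      linarith
    have h1 : |f.re * g.im| ≤ 2 * (K₁ * K₂) * (r * (P₁ * P₂ * (1 + r) ^ 2)) := by
      rw [abs_mul]
      refine (mul_le_mul hfre g3 (abs_nonneg _) (by positivity)).trans (le_of_eq (by ring))
    have h2 : |f.im * g.re| ≤ 2 * (K₁ * K₂) * (r * (P₁ * P₂ * (1 + r) ^ 2)) := by
      rw [abs_mul]
      refine (mul_le_mul f3 hgre (abs_nonneg _) (by positivity)).trans (le_of_eq (by ring))
    rw [Complex.mul_im]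
    refine (abs_add_le _ _).trans ?_
    linarith

lemma NearReal.pow (k : ℕ) (K : ℝ) (N : ℕ) :
    ∃ (K' : ℝ) (N' : ℕ), ∀ (r f₀ : ℝ) (f : ℂ), 0 ≤ r → NearReal K N r f₀ f →
      NearReal K' N' r (f₀ ^ k) (f ^ k) := by
  induction k with
  | zero =>
    refine ⟨1, 0, fun r f₀ f hr _ => ⟨by simp, ?_, ?_⟩⟩ <;> simp <;> positivity
  | succ k ih =>
    obtain ⟨K', N', h⟩ := ih
    refine ⟨4 * (K' * K), N' + N + 2, fun r f₀ f hr hf => ?_⟩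
    rw [pow_succ, pow_succ]
    exact (h r f₀ f hr hf).mul hr hf

/-- Distance of the shifted squared frequency from `-y²`. -/
lemma norm_shift_le {y r l : ℝ} (hy0 : 0 < y) (hy : y < π) (hl : |l| ≤ r) :
    ‖((r ^ 2 : ℝ) : ℂ) + (2 * y * l : ℝ) * I‖ ≤ 7 * (r * (1 + r)) := by
  have hr : 0 ≤ r := (abs_nonneg _).trans hl
  refine (norm_add_le _ _).trans ?_
  rw [norm_mul, Complex.norm_I, Complex.norm_real, Complex.norm_real, mul_one, Real.norm_eq_abs,
    Real.norm_eq_abs, abs_of_nonneg (sq_nonneg r), abs_mul, abs_of_pos (by positivity : 0 < 2 * y)]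
  have : 2 * y * |l| ≤ 7 * r := by
    have : 2 * y ≤ 7 := by linarith [Real.pi_lt_d2]
    gcongr
  nlinarith

lemma sinhQuot_nearReal {δ : ℝ} (hδ0 : 0 < δ) :
    ∃ (K : ℝ) (N : ℕ), ∀ y r l : ℝ, 0 < y → y < π → δ ≤ π ^ 2 - y ^ 2 → |l| ≤ r →
      NearReal K N r (y / Real.sin y)
        (sinhQuot ((-(y ^ 2) : ℝ) + ((r ^ 2 : ℝ) + (2 * y * l : ℝ) * I))) := by
  set E := Real.exp (π ^ 2 / δ * invSqSum)
  set s := invSqSum / δ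
  have hs : 0 ≤ s := div_nonneg invSqSum_nonneg hδ0.le
  have hE : 0 ≤ E := (Real.exp_pos _).le
  refine ⟨E * (1 + 7 * s + 49 * s ^ 2), 3, fun y r l hy0 hy hδ hl => ?_⟩
  have hr : 0 ≤ r := (abs_nonneg _).trans hl
  have hζ := norm_shift_le hy0 hy hl
  obtain ⟨σ, hσ0, hσ, hT⟩ := sinhQuot_taylor (sq_nonneg y) hδ0 hδ
  have hT := hT (((r ^ 2 : ℝ) : ℂ) + (2 * y * l : ℝ) * I)
    (by simp [-Complex.ofReal_pow]; positivity)
  have hS : ‖sinhQuot ((-(y ^ 2) : ℝ) : ℂ)‖ ≤ E := by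
    refine (norm_sinhQuot_le (sq_nonneg y) hδ0 hδ (by simp [-Complex.ofReal_pow])).trans ?_
    refine Real.exp_le_exp.2 (mul_le_mul_of_nonneg_right ?_ invSqSum_nonneg)
    gcongr
  rw [sinhQuot_neg_sq hy0 hy] at hT hS
  rw [Complex.norm_real, Real.norm_eq_abs] at hT hS
  set S := y / Real.sin y
  set f := sinhQuot ((-(y ^ 2) : ℝ) + ((r ^ 2 : ℝ) + (2 * y * l : ℝ) * I))
  set ζ := ((r ^ 2 : ℝ) : ℂ) + (2 * y * l : ℝ) * I with hζdef
  have hζ2 : ‖ζ‖ ^ 2 ≤ 49 * (r ^ 2 * (1 + r) ^ 2) := by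
    calc ‖ζ‖ ^ 2 ≤ (7 * (r * (1 + r))) ^ 2 := by gcongr
      _ = _ := by ring
  have herr : ‖f - S * (1 - σ * ζ)‖ ≤ E * (49 * s ^ 2) * (r ^ 2 * (1 + r) ^ 2) := by
    refine hT.trans ?_
    calc |S| * (σ ^ 2 * ‖ζ‖ ^ 2) ≤ E * (s ^ 2 * (49 * (r ^ 2 * (1 + r) ^ 2))) := by gcongr
      _ = _ := by ring
  have hre := (Complex.abs_re_le_norm _).trans herr
  have him := (Complex.abs_im_le_norm _).trans herr
  have e1 : (f - S * (1 - σ * ζ)).re = f.re - S + S * σ * r ^ 2 := by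
    simp [hζdef, -Complex.ofReal_pow]; ring
  have e2 : (f - S * (1 - σ * ζ)).im = f.im + S * σ * (2 * y * l) := by
    simp [hζdef, -Complex.ofReal_pow]; ring
  rw [e1] at hre
  rw [e2] at him
  have hSσ : |S * σ| ≤ E * s := by
    rw [abs_mul, abs_of_nonneg hσ0]; gcongr
  refine ⟨?_, ?_, ?_⟩
  · refine hS.trans (le_mul_of_one_le_right hE ?_)
    nlinarith [sq_nonneg s]
  · have h1 : |S * σ * r ^ 2| ≤ E * s * r ^ 2 := by
      rw [abs_mul, abs_of_nonneg (sq_nonneg r)]; gcongr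
    have h2 : |f.re - S| ≤ E * (49 * s ^ 2) * (r ^ 2 * (1 + r) ^ 2) + E * s * r ^ 2 := by
      rw [abs_le] at *; constructor <;> linarith [hre.1, hre.2, h1.1, h1.2]
    refine h2.trans ?_
    have h3 : r ^ 2 * (1 + r) ^ 2 ≤ r ^ 2 * (1 + r) ^ 3 := by
      gcongr; exacts [by linarith, by norm_num]
    have h4 : r ^ 2 * 1 ≤ r ^ 2 * (1 + r) ^ 3 := by
      gcongr; exact one_le_pow₀ (by linarith)
    have h5 := mul_le_mul_of_nonneg_left h3 (by positivity : 0 ≤ E * (49 * s ^ 2))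
    have h6 := mul_le_mul_of_nonneg_left h4 (by positivity : 0 ≤ E * s)
    have h7 : 0 ≤ E * (1 + 6 * s) * (r ^ 2 * (1 + r) ^ 3) := by positivity
    linarith
  · have h1 : |S * σ * (2 * y * l)| ≤ E * s * (7 * r) := by
      rw [abs_mul, abs_mul (2 * y), abs_of_pos (by positivity : 0 < 2 * y)]
      have : 2 * y ≤ 7 := by linarith [Real.pi_lt_d2]
      gcongr
    have h2 : |f.im| ≤ E * (49 * s ^ 2) * (r ^ 2 * (1 + r) ^ 2) + E * s * (7 * r) := by
      rw [abs_le] at *; constructor <;> linarith [him.1, him.2, h1.1, h1.2]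
    refine h2.trans ?_
    have h3 : r ^ 2 * (1 + r) ^ 2 ≤ r * (1 + r) ^ 3 := by
      calc r ^ 2 * (1 + r) ^ 2 = r * (r * (1 + r) ^ 2) := by ring
        _ ≤ r * ((1 + r) * (1 + r) ^ 2) := by gcongr; linarith
        _ = _ := by ring
    have h4 : r * 1 ≤ r * (1 + r) ^ 3 := by
      gcongr; exact one_le_pow₀ (by linarith)
    have h5 := mul_le_mul_of_nonneg_left h3 (by positivity : 0 ≤ E * (49 * s ^ 2))
    have h6 := mul_le_mul_of_nonneg_left h4 (by positivity : 0 ≤ E * s)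
    have h7 : 0 ≤ E * (r * (1 + r) ^ 3) := by positivity
    linarith

lemma cothSeries_nearReal {δ : ℝ} (hδ0 : 0 < δ) (hδ1 : δ ≤ 1) :
    ∃ (K : ℝ) (N : ℕ), ∀ y r l : ℝ, 0 < y → y < π → δ ≤ π ^ 2 - y ^ 2 → |l| ≤ r →
      NearReal K N r (y * Real.cos y / Real.sin y)
        (cothSeries ((-(y ^ 2) : ℝ) + ((r ^ 2 : ℝ) + (2 * y * l : ℝ) * I))) := by
  set B := π ^ 2 / δ ^ 5 * invSqSum
  set c := 1 + 2 * (π ^ 2 / δ * invSqSum)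
  have hB : 0 ≤ B := mul_nonneg (by positivity) invSqSum_nonneg
  have hc : 0 ≤ c := by
    have : 0 ≤ π ^ 2 / δ * invSqSum := mul_nonneg (by positivity) invSqSum_nonneg
    simp only [c]; linarith
  refine ⟨c + 6000 * B, 7, fun y r l hy0 hy hδ hl => ?_⟩
  have hr : 0 ≤ r := (abs_nonneg _).trans hl
  have hζ := norm_shift_le hy0 hy hl
  have hT := cothSeries_taylor (sq_nonneg y) hδ0 hδ1 hδ
    (ζ := ((r ^ 2 : ℝ) : ℂ) + (2 * y * l : ℝ) * I) (by simp [-Complex.ofReal_pow]; positivity)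
  have hS : ‖cothSeries ((-(y ^ 2) : ℝ) : ℂ)‖ ≤ c := by
    refine (norm_cothSeries_le (sq_nonneg y) hδ0 hδ (by simp [-Complex.ofReal_pow])).trans ?_
    have h := invSqSum_nonneg
    rw [Complex.norm_real, Real.norm_eq_abs, abs_neg, abs_of_nonneg (sq_nonneg y)]
    simp only [c]
    gcongr
  rw [cothSeries_neg_sq hy0 hy] at hT hS
  rw [Complex.norm_real, Real.norm_eq_abs] at hS
  set S := y * Real.cos y / Real.sin y
  set f := cothSeries ((-(y ^ 2) : ℝ) + ((r ^ 2 : ℝ) + (2 * y * l : ℝ) * I))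
  set ζ := ((r ^ 2 : ℝ) : ℂ) + (2 * y * l : ℝ) * I with hζdef
  have c2 := cothCoeff_le (sq_nonneg y) hδ0 hδ1 hδ (j := 2) (by norm_num) (by norm_num)
  have c3 := cothCoeff_le (sq_nonneg y) hδ0 hδ1 hδ (j := 3) (by norm_num) (by norm_num)
  have c4 := cothCoeff_le (sq_nonneg y) hδ0 hδ1 hδ (j := 4) (by norm_num) (by norm_num)
  have c5 := cothCoeff_le (sq_nonneg y) hδ0 hδ1 hδ (j := 5) (by norm_num) (by norm_num)
  have p2 := cothCoeff_nonneg (sq_nonneg y) hδ0 hδ 2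
  have p3 := cothCoeff_nonneg (sq_nonneg y) hδ0 hδ 3
  have p4 := cothCoeff_nonneg (sq_nonneg y) hδ0 hδ 4
  have p5 := cothCoeff_nonneg (sq_nonneg y) hδ0 hδ 5
  change _ ≤ B at c2 c3 c4 c5
  set C2 := cothCoeff 2 (y ^ 2)
  set C3 := cothCoeff 3 (y ^ 2)
  set C4 := cothCoeff 4 (y ^ 2)
  set C5 := cothCoeff 5 (y ^ 2)
  have hζ2 : ‖ζ‖ ^ 2 ≤ 49 * (r ^ 2 * (1 + r) ^ 6) := by
    calc ‖ζ‖ ^ 2 ≤ (7 * (r * (1 + r))) ^ 2 := by gcongr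
      _ = 49 * (r ^ 2 * (1 + r) ^ 2) := by ring
      _ ≤ _ := by gcongr; exacts [by linarith, by norm_num]
  have hζ3 : ‖ζ‖ ^ 3 ≤ 343 * (r ^ 2 * (1 + r) ^ 6) := by
    calc ‖ζ‖ ^ 3 ≤ (7 * (r * (1 + r))) ^ 3 := by gcongr
      _ = 343 * (r ^ 2 * (r * (1 + r) ^ 3)) := by ring
      _ ≤ 343 * (r ^ 2 * ((1 + r) * (1 + r) ^ 3)) := by gcongr; linarith
      _ = 343 * (r ^ 2 * (1 + r) ^ 4) := by ring
      _ ≤ _ := by gcongr; exacts [by linarith, by norm_num]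
  have hζ4 : ‖ζ‖ ^ 4 ≤ 2401 * (r ^ 2 * (1 + r) ^ 6) := by
    calc ‖ζ‖ ^ 4 ≤ (7 * (r * (1 + r))) ^ 4 := by gcongr
      _ = 2401 * (r ^ 2 * (r ^ 2 * (1 + r) ^ 4)) := by ring
      _ ≤ 2401 * (r ^ 2 * ((1 + r) ^ 2 * (1 + r) ^ 4)) := by gcongr; linarith
      _ = _ := by ring
  have herr : ‖f - (S + 2 * C2 * ζ)‖ ≤ 5586 * B * (r ^ 2 * (1 + r) ^ 6) := by
    have e : f - (S + 2 * C2 * ζ)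
        = (f - (S + 2 * C2 * ζ - 2 * C3 * ζ ^ 2 + 2 * C4 * ζ ^ 3))
          + (-(2 * C3 * ζ ^ 2) + 2 * C4 * ζ ^ 3) := by ring
    rw [e]
    refine (norm_add_le _ _).trans ?_
    have h1 : ‖-(2 * (C3 : ℂ) * ζ ^ 2) + 2 * C4 * ζ ^ 3‖
        ≤ 2 * C3 * ‖ζ‖ ^ 2 + 2 * C4 * ‖ζ‖ ^ 3 := by
      refine (norm_add_le _ _).trans (le_of_eq ?_)
      simp [abs_of_nonneg p3, abs_of_nonneg p4]
    have h2 : 2 * C3 * ‖ζ‖ ^ 2 ≤ 2 * B * (49 * (r ^ 2 * (1 + r) ^ 6)) := by gcongr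
    have h3 : 2 * C4 * ‖ζ‖ ^ 3 ≤ 2 * B * (343 * (r ^ 2 * (1 + r) ^ 6)) := by gcongr
    have h4 : 2 * C5 * ‖ζ‖ ^ 4 ≤ 2 * B * (2401 * (r ^ 2 * (1 + r) ^ 6)) := by gcongr
    linarith
  have hre := (Complex.abs_re_le_norm _).trans herr
  have him := (Complex.abs_im_le_norm _).trans herr
  have e1 : (f - (S + 2 * C2 * ζ)).re = f.re - S - 2 * C2 * r ^ 2 := by
    simp [hζdef, -Complex.ofReal_pow]; ring
  have e2 : (f - (S + 2 * C2 * ζ)).im = f.im - 2 * C2 * (2 * y * l) := by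
    simp [hζdef, -Complex.ofReal_pow]
  rw [e1] at hre
  rw [e2] at him
  refine ⟨?_, ?_, ?_⟩
  · linarith
  · have h1 : |2 * C2 * r ^ 2| ≤ 2 * B * r ^ 2 := by
      rw [abs_of_nonneg (by positivity)]; gcongr
    have h2 : |f.re - S| ≤ 5586 * B * (r ^ 2 * (1 + r) ^ 6) + 2 * B * r ^ 2 := by
      rw [abs_le] at *; constructor <;> linarith [hre.1, hre.2, h1.1, h1.2]
    refine h2.trans ?_
    have h3 : r ^ 2 * (1 + r) ^ 6 ≤ r ^ 2 * (1 + r) ^ 7 := by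
      gcongr; exacts [by linarith, by norm_num]
    have h4 : r ^ 2 * 1 ≤ r ^ 2 * (1 + r) ^ 7 := by
      gcongr; exact one_le_pow₀ (by linarith)
    have h5 := mul_le_mul_of_nonneg_left h3 (by positivity : 0 ≤ 5586 * B)
    have h6 := mul_le_mul_of_nonneg_left h4 (by positivity : 0 ≤ 2 * B)
    have h7 : 0 ≤ (c + 412 * B) * (r ^ 2 * (1 + r) ^ 7) := by positivity
    linarith
  · have h1 : |2 * C2 * (2 * y * l)| ≤ 2 * B * (7 * r) := by
      rw [abs_mul, abs_mul (2 * y), abs_of_pos (by positivity : 0 < 2 * y),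
        abs_of_nonneg (by positivity : 0 ≤ 2 * C2)]
      have : 2 * y ≤ 7 := by linarith [Real.pi_lt_d2]
      gcongr
    have h2 : |f.im| ≤ 5586 * B * (r ^ 2 * (1 + r) ^ 6) + 2 * B * (7 * r) := by
      rw [abs_le] at *; constructor <;> linarith [him.1, him.2, h1.1, h1.2]
    refine h2.trans ?_
    have h3 : r ^ 2 * (1 + r) ^ 6 ≤ r * (1 + r) ^ 7 := by
      calc r ^ 2 * (1 + r) ^ 6 = r * (r * (1 + r) ^ 6) := by ring
        _ ≤ r * ((1 + r) * (1 + r) ^ 6) := by gcongr; linarith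
        _ = _ := by ring
    have h4 : r * 1 ≤ r * (1 + r) ^ 7 := by
      gcongr; exact one_le_pow₀ (by linarith)
    have h5 := mul_le_mul_of_nonneg_left h3 (by positivity : 0 ≤ 5586 * B)
    have h6 := mul_le_mul_of_nonneg_left h4 (by positivity : 0 ≤ 2 * B)
    have h7 : 0 ≤ (c + 400 * B) * (r * (1 + r) ^ 7) := by positivity
    linarith

/-- The amplitude on the shifted contour is close to its value at the saddle point. -/
lemma amplitude_nearReal (n k₁ k₂ : ℕ) {δ : ℝ} (hδ0 : 0 < δ) (hδ1 : δ ≤ 1) :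
    ∃ (K : ℝ) (N : ℕ), ∀ y r l : ℝ, 0 < y → y < π → δ ≤ π ^ 2 - y ^ 2 → |l| ≤ r →
      NearReal K N r
        ((y / Real.sin y) ^ n * (y * Real.cos y / Real.sin y) ^ k₁ * y ^ k₂)
        (sinhQuot ((-(y ^ 2) : ℝ) + ((r ^ 2 : ℝ) + (2 * y * l : ℝ) * I)) ^ n *
          cothSeries ((-(y ^ 2) : ℝ) + ((r ^ 2 : ℝ) + (2 * y * l : ℝ) * I)) ^ k₁ *
          ((y : ℂ) - l * I) ^ k₂) := by
  obtain ⟨K1, N1, h1⟩ := sinhQuot_nearReal hδ0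
  obtain ⟨K2, N2, h2⟩ := cothSeries_nearReal hδ0 hδ1
  have h3 : ∀ y r l : ℝ, 0 < y → y < π → |l| ≤ r → NearReal 4 0 r y ((y : ℂ) - l * I) := by
    intro y r l hy0 hy hl
    have := Real.pi_lt_d2
    refine ⟨by rw [abs_of_pos hy0]; linarith, ?_, ?_⟩
    · simp; positivity
    · simp; linarith [abs_nonneg l]
  obtain ⟨K1', N1', h1'⟩ := NearReal.pow n K1 N1
  obtain ⟨K2', N2', h2'⟩ := NearReal.pow k₁ K2 N2
  obtain ⟨K3', N3', h3'⟩ := NearReal.pow k₂ 4 0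
  refine ⟨4 * (4 * (K1' * K2') * K3'), N1' + N2' + 2 + N3' + 2, fun y r l hy0 hy hδ hl => ?_⟩
  have hr : 0 ≤ r := (abs_nonneg _).trans hl
  exact ((h1' _ _ _ hr (h1 y r l hy0 hy hδ hl)).mul hr
    (h2' _ _ _ hr (h2 y r l hy0 hy hδ hl))).mul hr
    (h3' _ _ _ hr (h3 y r l hy0 hy hl))

/-- The phase on the shifted contour, normalised to vanish at the saddle point. -/
noncomputable def saddlePhase (y r l : ℝ) : ℂ :=
  cothSeries ((-(y ^ 2) : ℝ) + ((r ^ 2 : ℝ) + (2 * y * l : ℝ) * I))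
    - (y * Real.cos y / Real.sin y : ℝ) - (theta y * l : ℝ) * I

/-- The quadratic part of the phase at the saddle point. -/
noncomputable def saddleForm (y r l : ℝ) : ℝ :=
  2 * cothCoeff 2 (y ^ 2) * r ^ 2 + 8 * cothCoeff 3 (y ^ 2) * y ^ 2 * l ^ 2

lemma re_saddlePhase_ge {y r l δ : ℝ} (hy0 : 0 < y) (hy : y < π) (hδ0 : 0 < δ)
    (hδ : δ ≤ π ^ 2 - y ^ 2) (hr : 0 ≤ r) : r ^ 2 / (7 * (1 + r)) ≤ (saddlePhase y r l).re := by
  have h1 := cothSeries_sub_one_ge hr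
  have h2 := re_cothSeries_ge (sq_nonneg y) hδ0 hδ (sq_nonneg r)
    (z := (-(y ^ 2) : ℝ) + ((r ^ 2 : ℝ) + (2 * y * l : ℝ) * I)) (by simp [-Complex.ofReal_pow])
  rw [cothSeries_neg_sq hy0 hy, Complex.ofReal_re] at h2
  rw [saddlePhase, Complex.sub_re, Complex.sub_re, Complex.ofReal_re, Complex.re_ofReal_mul,
    Complex.I_re]
  linarith

lemma saddlePhase_taylor {δ : ℝ} (hδ0 : 0 < δ) (hδ1 : δ ≤ 1) :
    ∃ K : ℝ, 0 ≤ K ∧ ∀ y r l : ℝ, 0 < y → y < π → δ ≤ π ^ 2 - y ^ 2 → |l| ≤ r →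
      |(saddlePhase y r l).re - saddleForm y r l| ≤ K * (r ^ 4 * (1 + r) ^ 4) ∧
      |(saddlePhase y r l).im| ≤ K * (r ^ 3 * (1 + r) ^ 5) := by
  set B := π ^ 2 / δ ^ 5 * invSqSum with hBdef
  have hB : 0 ≤ B := mul_nonneg (by positivity) invSqSum_nonneg
  refine ⟨6000 * B, by positivity, fun y r l hy0 hy hδ hl => ?_⟩
  have hr : 0 ≤ r := (abs_nonneg _).trans hl
  have hζ := norm_shift_le hy0 hy hl
  have hT := cothSeries_taylor (sq_nonneg y) hδ0 hδ1 hδ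
    (ζ := ((r ^ 2 : ℝ) : ℂ) + (2 * y * l : ℝ) * I)
    (by simp [-Complex.ofReal_pow]; positivity)
  rw [cothSeries_neg_sq hy0 hy] at hT
  rw [saddlePhase, saddleForm, theta_eq hy0 hy]
  have c2 := cothCoeff_le (sq_nonneg y) hδ0 hδ1 hδ (j := 2) (by norm_num) (by norm_num)
  have c3 := cothCoeff_le (sq_nonneg y) hδ0 hδ1 hδ (j := 3) (by norm_num) (by norm_num)
  have c4 := cothCoeff_le (sq_nonneg y) hδ0 hδ1 hδ (j := 4) (by norm_num) (by norm_num)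
  have c5 := cothCoeff_le (sq_nonneg y) hδ0 hδ1 hδ (j := 5) (by norm_num) (by norm_num)
  have p2 := cothCoeff_nonneg (sq_nonneg y) hδ0 hδ 2
  have p3 := cothCoeff_nonneg (sq_nonneg y) hδ0 hδ 3
  have p4 := cothCoeff_nonneg (sq_nonneg y) hδ0 hδ 4
  have p5 := cothCoeff_nonneg (sq_nonneg y) hδ0 hδ 5
  rw [← hBdef] at c2 c3 c4 c5
  set S := y * Real.cos y / Real.sin y
  set f := cothSeries ((-(y ^ 2) : ℝ) + ((r ^ 2 : ℝ) + (2 * y * l : ℝ) * I))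
  set C2 := cothCoeff 2 (y ^ 2)
  set C3 := cothCoeff 3 (y ^ 2)
  set C4 := cothCoeff 4 (y ^ 2)
  set C5 := cothCoeff 5 (y ^ 2)
  set ζ := ((r ^ 2 : ℝ) : ℂ) + (2 * y * l : ℝ) * I with hζdef
  have herr : ‖f - (S + 2 * C2 * ζ - 2 * C3 * ζ ^ 2 + 2 * C4 * ζ ^ 3)‖
      ≤ 4802 * B * (r ^ 4 * (1 + r) ^ 4) := by
    refine hT.trans ?_
    calc 2 * C5 * ‖ζ‖ ^ 4 ≤ 2 * B * (7 * (r * (1 + r))) ^ 4 := by gcongr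
      _ = _ := by ring
  have hre := (Complex.abs_re_le_norm _).trans herr
  have him := (Complex.abs_im_le_norm _).trans herr
  set q := 2 * y * l with hq
  have hq7 : |q| ≤ 7 * r := by
    rw [hq, abs_mul, abs_of_pos (by positivity : 0 < 2 * y)]
    have : 2 * y ≤ 7 := by linarith [Real.pi_lt_d2]
    gcongr
  have hq2 : q ^ 2 ≤ 49 * r ^ 2 := by
    rw [← sq_abs]
    calc |q| ^ 2 ≤ (7 * r) ^ 2 := by gcongr
      _ = _ := by ring
  have hq3 : |q ^ 3| ≤ 343 * r ^ 3 := by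
    rw [abs_pow]
    calc |q| ^ 3 ≤ (7 * r) ^ 3 := by gcongr
      _ = _ := by ring
  have hζ2 : ζ ^ 2 = ((r ^ 4 - q ^ 2 : ℝ) : ℂ) + (2 * r ^ 2 * q : ℝ) * I := by
    rw [hζdef]; push_cast; ring_nf; rw [Complex.I_sq]; ring
  have hζ3 : ζ ^ 3 = ((r ^ 6 - 3 * r ^ 2 * q ^ 2 : ℝ) : ℂ) + (3 * r ^ 4 * q - q ^ 3 : ℝ) * I := by
    rw [hζdef]; push_cast; ring_nf
    rw [show (I : ℂ) ^ 3 = I ^ 2 * I by ring, Complex.I_sq]; ring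
  have hexp : f - (S + 2 * C2 * ζ - 2 * C3 * ζ ^ 2 + 2 * C4 * ζ ^ 3)
      = f - (S + (2 * C2 : ℝ) * ζ - (2 * C3 : ℝ) * ζ ^ 2 + (2 * C4 : ℝ) * ζ ^ 3) := by
    push_cast; ring
  rw [hexp, hζ2, hζ3, hζdef] at hre him
  simp only [Complex.sub_re, Complex.add_re, Complex.re_ofReal_mul, Complex.ofReal_re,
    Complex.I_re, mul_zero, add_zero] at hre
  simp only [Complex.sub_im, Complex.add_im, Complex.im_ofReal_mul, Complex.ofReal_im,
    Complex.I_im, mul_one, zero_add] at him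
  simp only [Complex.sub_re, Complex.sub_im, Complex.re_ofReal_mul, Complex.im_ofReal_mul,
    Complex.ofReal_re, Complex.ofReal_im, Complex.I_re, Complex.I_im, mul_zero, mul_one, sub_zero]
  have hr1 : 1 ≤ (1 + r) ^ 4 := one_le_pow₀ (by linarith)
  constructor
  · have h1 : |2 * C3 * r ^ 4| ≤ 2 * B * (r ^ 4 * (1 + r) ^ 4) := by
      rw [abs_of_nonneg (by positivity)]
      have : r ^ 4 ≤ r ^ 4 * (1 + r) ^ 4 := le_mul_of_one_le_right (by positivity) hr1
      gcongr
    have h2 : |2 * C4 * (r ^ 6 - 3 * r ^ 2 * q ^ 2)| ≤ 2 * B * (148 * (r ^ 4 * (1 + r) ^ 4)) := by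
      rw [abs_mul, abs_of_nonneg (by positivity : 0 ≤ 2 * C4)]
      have h3 : |r ^ 6 - 3 * r ^ 2 * q ^ 2| ≤ r ^ 6 + 3 * r ^ 2 * (49 * r ^ 2) := by
        have : 3 * r ^ 2 * q ^ 2 ≤ 3 * r ^ 2 * (49 * r ^ 2) := by gcongr
        have h6 : 0 ≤ r ^ 6 := by positivity
        have h7 : 0 ≤ 3 * r ^ 2 * q ^ 2 := by positivity
        rw [abs_le]; constructor <;> linarith
      have h4 : r ^ 6 ≤ r ^ 4 * (1 + r) ^ 4 := by
        calc r ^ 6 = r ^ 4 * (r ^ 2 * 1) := by ring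
          _ ≤ r ^ 4 * ((1 + r) ^ 2 * (1 + r) ^ 2) := by
            gcongr
            · linarith
            · exact one_le_pow₀ (by linarith)
          _ = _ := by ring
      have h5 : r ^ 4 * 1 ≤ r ^ 4 * (1 + r) ^ 4 := by gcongr
      have : |r ^ 6 - 3 * r ^ 2 * q ^ 2| ≤ 148 * (r ^ 4 * (1 + r) ^ 4) := by linarith
      gcongr
    have e : f.re - S - (2 * C2 * r ^ 2 + 8 * C3 * y ^ 2 * l ^ 2)
        = (f.re - (S + 2 * C2 * r ^ 2 - 2 * C3 * (r ^ 4 - q ^ 2)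
            + 2 * C4 * (r ^ 6 - 3 * r ^ 2 * q ^ 2)))
          + (2 * C4 * (r ^ 6 - 3 * r ^ 2 * q ^ 2) - 2 * C3 * r ^ 4) := by
      rw [hq]; ring
    rw [e]
    have h8 : 0 ≤ B * (r ^ 4 * (1 + r) ^ 4) := by positivity
    rw [abs_le] at *
    constructor <;> linarith [hre.1, hre.2, h1.1, h1.2, h2.1, h2.2]
  · have hQ : r ^ 3 * 1 ≤ r ^ 3 * (1 + r) ^ 5 := by
      gcongr; exact one_le_pow₀ (by linarith)
    have h1 : |2 * C3 * (2 * r ^ 2 * q)| ≤ 2 * B * (14 * (r ^ 3 * (1 + r) ^ 5)) := by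
      rw [abs_mul, abs_mul (2 * r ^ 2), abs_of_nonneg (by positivity : 0 ≤ 2 * C3),
        abs_of_nonneg (by positivity : 0 ≤ 2 * r ^ 2)]
      have : 2 * r ^ 2 * |q| ≤ 14 * (r ^ 3 * (1 + r) ^ 5) := by
        calc 2 * r ^ 2 * |q| ≤ 2 * r ^ 2 * (7 * r) := by gcongr
          _ = 14 * (r ^ 3 * 1) := by ring
          _ ≤ _ := by gcongr
      gcongr
    have h2 : |2 * C4 * (3 * r ^ 4 * q - q ^ 3)| ≤ 2 * B * (364 * (r ^ 3 * (1 + r) ^ 5)) := by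
      rw [abs_mul, abs_of_nonneg (by positivity : 0 ≤ 2 * C4)]
      have h3 : |3 * r ^ 4 * q| ≤ 21 * (r ^ 3 * (1 + r) ^ 5) := by
        rw [abs_mul, abs_of_nonneg (by positivity : 0 ≤ 3 * r ^ 4)]
        calc 3 * r ^ 4 * |q| ≤ 3 * r ^ 4 * (7 * r) := by gcongr
          _ = 21 * (r ^ 3 * (r ^ 2 * 1)) := by ring
          _ ≤ 21 * (r ^ 3 * ((1 + r) ^ 2 * (1 + r) ^ 3)) := by
            gcongr
            · linarith
            · exact one_le_pow₀ (by linarith)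
          _ = _ := by ring
      have : |3 * r ^ 4 * q - q ^ 3| ≤ 364 * (r ^ 3 * (1 + r) ^ 5) := by
        rw [abs_le] at *
        constructor <;> linarith [h3.1, h3.2, hq3.1, hq3.2]
      gcongr
    have h9 : 4802 * B * (r ^ 4 * (1 + r) ^ 4) ≤ 4802 * B * (r ^ 3 * (1 + r) ^ 5) := by
      have : r ^ 4 * (1 + r) ^ 4 ≤ r ^ 3 * (1 + r) ^ 5 := by
        calc r ^ 4 * (1 + r) ^ 4 = r ^ 3 * (r * (1 + r) ^ 4) := by ring
          _ ≤ r ^ 3 * ((1 + r) * (1 + r) ^ 4) := by gcongr; linarith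
          _ = _ := by ring
      gcongr
    have e : f.im - 4 * y * C2 * l
        = (f.im - (2 * C2 * q - 2 * C3 * (2 * r ^ 2 * q)
            + 2 * C4 * (3 * r ^ 4 * q - q ^ 3)))
          + (2 * C4 * (3 * r ^ 4 * q - q ^ 3) - 2 * C3 * (2 * r ^ 2 * q)) := by
      rw [hq]; ring
    rw [e]
    have h8 : 0 ≤ B * (r ^ 3 * (1 + r) ^ 5) := by positivity
    rw [abs_le] at *
    constructor <;> linarith [him.1, him.2, h1.1, h1.2, h2.1, h2.2]

lemma abs_exp_neg_sub_le {a b s : ℝ} (ha : s ≤ a) (hb : s ≤ b) :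
    |Real.exp (-a) - Real.exp (-b)| ≤ Real.exp (-s) * |a - b| := by
  wlog h : a ≤ b generalizing a b
  · rw [abs_sub_comm, abs_sub_comm a]; exact this hb ha (le_of_not_ge h)
  have h1 : Real.exp (-b) = Real.exp (-a) * Real.exp (a - b) := by
    rw [← Real.exp_add]; ring_nf
  have h2 := Real.add_one_le_exp (a - b)
  have h3 : Real.exp (a - b) ≤ 1 := Real.exp_le_one_iff.2 (by linarith)
  have h4 : Real.exp (-a) ≤ Real.exp (-s) := Real.exp_le_exp.2 (by linarith)
  rw [h1, abs_of_nonneg (by nlinarith [Real.exp_pos (-a)]), abs_of_nonpos (by linarith)]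
  calc _ = Real.exp (-a) * (1 - Real.exp (a - b)) := by ring
    _ ≤ Real.exp (-s) * (-(a - b)) := by gcongr; linarith

/-- Second order estimate for the real part of a perturbed real exponential integrand. -/
lemma re_exp_mul_sub_le {W η s g g₁ h b₀ : ℝ} {b : ℂ} (hW : 1 ≤ W) (hη0 : 0 ≤ η) (hη1 : η ≤ 1)
    (hg : s ≤ g) (hg₁ : s ≤ g₁) (h1 : |g₁ - g| ≤ η ^ 2 * W) (h2 : |h| ≤ η * W)
    (h3 : |b.re - b₀| ≤ η ^ 2 * W) (h4 : |b.im| ≤ η * W) (h5 : |b₀| ≤ W) :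
    |(Complex.exp (-(g₁ + h * I)) * b).re - Real.exp (-g) * b₀|
      ≤ η ^ 2 * (4 * W ^ 3) * Real.exp (-s) := by
  have hre : (Complex.exp (-(g₁ + h * I)) * b).re
      = Real.exp (-g₁) * (Real.cos h * b.re + Real.sin h * b.im) := by
    rw [Complex.mul_re, Complex.exp_re, Complex.exp_im]
    simp
    ring
  have hE : Real.exp (-g₁) ≤ Real.exp (-s) := Real.exp_le_exp.2 (by linarith)
  have hE0 := Real.exp_pos (-g₁)
  have hE1 := Real.exp_pos (-s)
  have e : (Complex.exp (-(g₁ + h * I)) * b).re - Real.exp (-g) * b₀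
      = Real.exp (-g₁) * ((Real.cos h - 1) * b.re + (b.re - b₀) + Real.sin h * b.im)
        + (Real.exp (-g₁) - Real.exp (-g)) * b₀ := by rw [hre]; ring
  have hW2 : W ≤ W ^ 2 := by nlinarith
  have hW3 : W ^ 2 ≤ W ^ 3 := by nlinarith [sq_nonneg W]
  have hη2 : η ^ 2 ≤ 1 := by nlinarith
  have hbre : |b.re| ≤ 2 * W := by
    have : |b.re| ≤ |b.re - b₀| + |b₀| := by simpa using abs_add_le (b.re - b₀) b₀
    nlinarith
  have hcos : |Real.cos h - 1| ≤ h ^ 2 / 2 := by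
    rw [abs_of_nonpos (by linarith [Real.cos_le_one h])]
    linarith [Real.one_sub_sq_div_two_le_cos (x := h)]
  have hh2 : h ^ 2 ≤ η ^ 2 * W ^ 2 := by
    rw [← sq_abs, ← mul_pow]; gcongr
  have t1 : |(Real.cos h - 1) * b.re| ≤ η ^ 2 * W ^ 3 := by
    rw [abs_mul]
    calc _ ≤ (η ^ 2 * W ^ 2 / 2) * (2 * W) :=
          mul_le_mul (hcos.trans (by linarith)) hbre (abs_nonneg _) (by positivity)
      _ = _ := by ring
  have t2 : |b.re - b₀| ≤ η ^ 2 * W ^ 3 := h3.trans (by gcongr; linarith)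
  have t3 : |Real.sin h * b.im| ≤ η ^ 2 * W ^ 3 := by
    rw [abs_mul]
    have hs : |Real.sin h| ≤ η * W := Real.abs_sin_le_abs.trans h2
    calc _ ≤ (η * W) * (η * W) := mul_le_mul hs h4 (abs_nonneg _) (by positivity)
      _ = η ^ 2 * W ^ 2 := by ring
      _ ≤ _ := by gcongr
  have t4 : |(Real.exp (-g₁) - Real.exp (-g)) * b₀| ≤ η ^ 2 * W ^ 3 * Real.exp (-s) := by
    rw [abs_mul]
    calc _ ≤ (Real.exp (-s) * (η ^ 2 * W)) * W :=
          mul_le_mul ((abs_exp_neg_sub_le hg₁ hg).trans (by gcongr)) h5 (abs_nonneg _)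
            (by positivity)
      _ = η ^ 2 * W ^ 2 * Real.exp (-s) := by ring
      _ ≤ _ := by gcongr
  have t5 : |Real.exp (-g₁) * ((Real.cos h - 1) * b.re + (b.re - b₀) + Real.sin h * b.im)|
      ≤ Real.exp (-s) * (3 * (η ^ 2 * W ^ 3)) := by
    rw [abs_mul, abs_of_pos hE0]
    have : |(Real.cos h - 1) * b.re + (b.re - b₀) + Real.sin h * b.im| ≤ 3 * (η ^ 2 * W ^ 3) := by
      refine (abs_add_le _ _).trans ?_
      have := abs_add_le ((Real.cos h - 1) * b.re) (b.re - b₀)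
      linarith
    gcongr
  rw [e]
  refine (abs_add_le _ _).trans ?_
  linarith

/-- Polynomial times exponential decay is dominated by any inverse power. -/
lemma exists_pow_mul_exp_le (N M : ℕ) :
    ∃ K : ℝ, 0 ≤ K ∧ ∀ u : ℝ, 0 ≤ u →
      (1 + u) ^ N * Real.exp (-((u - 1) / 7)) ≤ K * (1 + u) ^ (-(M : ℝ)) := by
  refine ⟨7 ^ (N + M) * (N + M).factorial * Real.exp (2 / 7), by positivity, fun u hu => ?_⟩
  have h1 := Real.pow_div_factorial_le_exp ((1 + u) / 7) (by positivity) (N + M)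
  have hf : (0 : ℝ) < (N + M).factorial := by positivity
  have hu1 : 0 < 1 + u := by linarith
  rw [div_pow, div_div, div_le_iff₀ (by positivity)] at h1
  rw [Real.rpow_neg hu1.le, Real.rpow_natCast]
  have h2 : Real.exp (-((u - 1) / 7)) = Real.exp (2 / 7) / Real.exp ((1 + u) / 7) := by
    rw [← Real.exp_sub]; ring_nf
  rw [h2, ← div_eq_mul_inv, mul_div_assoc', div_le_div_iff₀ (Real.exp_pos _) (by positivity)]
  calc (1 + u) ^ N * Real.exp (2 / 7) * (1 + u) ^ M
      = (1 + u) ^ (N + M) * Real.exp (2 / 7) := by ring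
    _ ≤ (Real.exp ((1 + u) / 7) * (7 ^ (N + M) * (N + M).factorial)) * Real.exp (2 / 7) := by
        gcongr
    _ = _ := by ring

/-- The amplitude on the shifted contour. -/
noncomputable def saddleAmp (n k₁ k₂ : ℕ) (y r l : ℝ) : ℂ :=
  sinhQuot ((-(y ^ 2) : ℝ) + ((r ^ 2 : ℝ) + (2 * y * l : ℝ) * I)) ^ n *
    cothSeries ((-(y ^ 2) : ℝ) + ((r ^ 2 : ℝ) + (2 * y * l : ℝ) * I)) ^ k₁ *
    ((y : ℂ) - l * I) ^ k₂

/-- The amplitude at the saddle point. -/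
noncomputable def saddleAmpZero (n k₁ k₂ : ℕ) (y : ℝ) : ℝ :=
  (y / Real.sin y) ^ n * (y * Real.cos y / Real.sin y) ^ k₁ * y ^ k₂

/-- The rescaled integrand on the shifted contour, with the saddle point value factored out. -/
noncomputable def saddleIntegrand (n k₁ k₂ : ℕ) (y η u l : ℝ) : ℂ :=
  Complex.exp (-(((η ^ 2)⁻¹ : ℝ) * saddlePhase y (η * u) (η * l))) *
    saddleAmp n k₁ k₂ y (η * u) (η * l)

lemma saddleForm_ge {y u l δ : ℝ} (hδ0 : 0 < δ) (hδ1 : δ ≤ 1)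
    (hδ : δ ≤ π ^ 2 - y ^ 2) : (u - 1) / 7 ≤ saddleForm y u l := by
  have p3 := cothCoeff_nonneg (sq_nonneg y) hδ0 hδ 3
  have h2 := pi_sq_div_le_cothCoeff_two (sq_nonneg y) hδ0 hδ1 hδ
  have h3 : 1 / 10 ≤ π ^ 2 / (π ^ 2 - y ^ 2) ^ 2 := by
    rw [div_le_div_iff₀ (by norm_num) (by have : 0 < π ^ 2 - y ^ 2 := by linarith
                                          positivity)]
    have h4 : (π ^ 2 - y ^ 2) ^ 2 ≤ (π ^ 2) ^ 2 := by
      apply pow_le_pow_left₀ (by linarith)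
      nlinarith
    have h5 : π ^ 2 ≤ 10 := by nlinarith [Real.pi_lt_d2, Real.pi_pos]
    nlinarith [sq_nonneg π]
  have h6 : 0 ≤ 8 * cothCoeff 3 (y ^ 2) * y ^ 2 * l ^ 2 := by positivity
  have h7 : 1 / 10 * u ^ 2 ≤ cothCoeff 2 (y ^ 2) * u ^ 2 := by
    gcongr; linarith
  rw [saddleForm]
  nlinarith [sq_nonneg (u - 1 / 2)]

lemma sub_one_div_le {r : ℝ} (hr : 0 ≤ r) : (r - 1) / 7 ≤ r ^ 2 / (7 * (1 + r)) := by
  rw [div_le_div_iff₀ (by norm_num) (by positivity)]; nlinarith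

/-- Second order pointwise asymptotics of the rescaled integrand. -/
lemma saddleIntegrand_sub_le (n k₁ k₂ M : ℕ) {δ : ℝ} (hδ0 : 0 < δ) (hδ1 : δ ≤ 1) :
    ∃ K : ℝ, 0 ≤ K ∧ ∀ y η u l : ℝ, 0 < y → y < π → δ ≤ π ^ 2 - y ^ 2 → 0 < η → η ≤ 1 → |l| ≤ u →
      |(saddleIntegrand n k₁ k₂ y η u l).re
          - Real.exp (-saddleForm y u l) * saddleAmpZero n k₁ k₂ y|
        ≤ η ^ 2 * (K * (1 + u) ^ (-(M : ℝ))) := by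
  obtain ⟨Kp, hKp, hp⟩ := saddlePhase_taylor hδ0 hδ1
  obtain ⟨Ka, Na, ha⟩ := amplitude_nearReal n k₁ k₂ hδ0 hδ1
  have hKa : 0 ≤ Ka := by
    have := ha 1 0 0 one_pos (by linarith [Real.pi_gt_three])
      (by nlinarith [Real.pi_gt_three]) (by simp)
    exact (abs_nonneg _).trans this.1
  obtain ⟨K, hK, hexp⟩ := exists_pow_mul_exp_le (3 * (Na + 8)) M
  set A := 1 + Kp + Ka
  refine ⟨4 * A ^ 3 * K, by positivity, fun y η u l hy0 hy hδ hη0 hη1 hl => ?_⟩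
  have hu : 0 ≤ u := (abs_nonneg _).trans hl
  have hl' : |η * l| ≤ η * u := by rw [abs_mul, abs_of_pos hη0]; gcongr
  obtain ⟨hp1, hp2⟩ := hp y (η * u) (η * l) hy0 hy hδ hl'
  obtain ⟨ha1, ha2, ha3⟩ := ha y (η * u) (η * l) hy0 hy hδ hl'
  have hp3 := (sub_one_div_le (by positivity : 0 ≤ η * u)).trans
    (re_saddlePhase_ge (l := η * l) hy0 hy hδ0 hδ (by positivity : 0 ≤ η * u))
  have hηu : 1 + η * u ≤ 1 + u := by nlinarith
  have hη2 : 0 < η ^ 2 := by positivity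
  have hQ : saddleForm y (η * u) (η * l) = η ^ 2 * saddleForm y u l := by
    unfold saddleForm; ring
  set W := A * (1 + u) ^ (Na + 8)
  have hP : 1 ≤ (1 + u) ^ (Na + 8) := one_le_pow₀ (by linarith)
  have hKpA : Kp ≤ A := by simp only [A]; linarith
  have hKaA : Ka ≤ A := by simp only [A]; linarith
  have hA1 : 1 ≤ A := by simp only [A]; linarith
  have hW : 1 ≤ W := one_le_mul_of_one_le_of_one_le hA1 hP
  set G := saddlePhase y (η * u) (η * l)
  set b := saddleAmp n k₁ k₂ y (η * u) (η * l) with hbdef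
  have hmono : ∀ i j : ℕ, i + j ≤ Na + 8 → u ^ i * (1 + η * u) ^ j ≤ (1 + u) ^ (Na + 8) := by
    intro i j hij
    calc u ^ i * (1 + η * u) ^ j ≤ (1 + u) ^ i * (1 + u) ^ j := by gcongr; linarith
      _ = (1 + u) ^ (i + j) := by ring
      _ ≤ _ := pow_le_pow_right₀ (by linarith) hij
  have hscale : ∀ a c : ℝ, |(η ^ 2)⁻¹ * a| ≤ c ↔ |a| ≤ η ^ 2 * c := by
    intro a c
    rw [abs_mul, abs_of_pos (by positivity : 0 < (η ^ 2)⁻¹), inv_mul_le_iff₀ hη2]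
  have key := re_exp_mul_sub_le (W := W) (η := η) (s := (u - 1) / 7) (g := saddleForm y u l)
    (g₁ := (η ^ 2)⁻¹ * G.re) (h := (η ^ 2)⁻¹ * G.im) (b₀ := saddleAmpZero n k₁ k₂ y) (b := b)
    hW hη0.le hη1 (saddleForm_ge hδ0 hδ1 hδ) ?_ ?_ ?_ ?_ ?_ ?_
  · have e : saddleIntegrand n k₁ k₂ y η u l = Complex.exp (-((((η ^ 2)⁻¹ * G.re : ℝ) : ℂ)
        + (((η ^ 2)⁻¹ * G.im : ℝ) : ℂ) * I)) * b := by
      rw [saddleIntegrand, ← Complex.re_add_im (saddlePhase y (η * u) (η * l))]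
      congr 3
      push_cast; ring
    rw [e]
    refine key.trans ?_
    have := hexp u hu
    calc η ^ 2 * (4 * W ^ 3) * Real.exp (-((u - 1) / 7))
        = η ^ 2 * (4 * A ^ 3 * ((1 + u) ^ (3 * (Na + 8)) * Real.exp (-((u - 1) / 7)))) := by
          simp only [W]; ring
      _ ≤ η ^ 2 * (4 * A ^ 3 * (K * (1 + u) ^ (-(M : ℝ)))) := by gcongr
      _ = _ := by ring
  · have h := re_saddlePhase_ge (l := η * l) hy0 hy hδ0 hδ (by positivity : 0 ≤ η * u)
    refine (sub_one_div_le hu).trans ?_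
    calc u ^ 2 / (7 * (1 + u)) ≤ u ^ 2 / (7 * (1 + η * u)) := by gcongr
      _ = (η ^ 2)⁻¹ * ((η * u) ^ 2 / (7 * (1 + η * u))) := by field_simp
      _ ≤ _ := by gcongr
  · have e : (η ^ 2)⁻¹ * G.re - saddleForm y u l
        = (η ^ 2)⁻¹ * (G.re - saddleForm y (η * u) (η * l)) := by
      rw [hQ]; field_simp
    rw [e, hscale]
    refine hp1.trans ?_
    have := hmono 4 4 (by omega)
    calc Kp * ((η * u) ^ 4 * (1 + η * u) ^ 4)
        = η ^ 2 * (η ^ 2 * (Kp * (u ^ 4 * (1 + η * u) ^ 4))) := by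
          ring
      _ ≤ η ^ 2 * (η ^ 2 * W) := by simp only [W]; gcongr
  · rw [hscale]
    refine hp2.trans ?_
    have := hmono 3 5 (by omega)
    calc Kp * ((η * u) ^ 3 * (1 + η * u) ^ 5) = η ^ 2 * (η * (Kp * (u ^ 3 * (1 + η * u) ^ 5))) := by
          ring
      _ ≤ η ^ 2 * (η * W) := by simp only [W]; gcongr
  · refine ha2.trans ?_
    have := hmono 2 Na (by omega)
    calc Ka * ((η * u) ^ 2 * (1 + η * u) ^ Na) = η ^ 2 * (Ka * (u ^ 2 * (1 + η * u) ^ Na)) := by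
          ring
      _ ≤ η ^ 2 * W := by simp only [W]; gcongr
  · refine ha3.trans ?_
    have := hmono 1 Na (by omega)
    rw [pow_one] at this
    calc Ka * ((η * u) * (1 + η * u) ^ Na) = η * (Ka * (u * (1 + η * u) ^ Na)) := by
          ring
      _ ≤ η * W := by simp only [W]; gcongr
  · refine ha1.trans (hKaA.trans (le_mul_of_one_le_right (by linarith) hP))

/-- The heat kernel integrand, as a function of the first frequency `w` and the sum `ρ` of the
squares of the other frequencies. -/
noncomputable def heatIntegrand (n k₁ k₂ : ℕ) (R T : ℝ) (w ρ : ℂ) : ℂ :=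
  Complex.exp (I * T * w - R * cothSeries (ρ + w ^ 2)) *
    (sinhQuot (ρ + w ^ 2) ^ n * cothSeries (ρ + w ^ 2) ^ k₁) * w ^ k₂

lemma heatIntegrand_shift (n k₁ k₂ : ℕ) {R y r l : ℝ} (hy0 : 0 < y) (hy : y < π) :
    heatIntegrand n k₁ k₂ R (theta y * R) ((l : ℂ) + y * I) ((r ^ 2 - l ^ 2 : ℝ) : ℂ)
      = I ^ k₂ * (Real.exp (-(R * (y ^ 2 / Real.sin y ^ 2))) : ℝ) *
        (Complex.exp (-((R : ℂ) * saddlePhase y r l)) * saddleAmp n k₁ k₂ y r l) := by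
  have hs : Real.sin y ≠ 0 := (Real.sin_pos_of_pos_of_lt_pi hy0 hy).ne'
  have hz : ((r ^ 2 - l ^ 2 : ℝ) : ℂ) + ((l : ℂ) + y * I) ^ 2
      = (-(y ^ 2) : ℝ) + ((r ^ 2 : ℝ) + (2 * y * l : ℝ) * I) := by
    push_cast; ring_nf; rw [Complex.I_sq]; ring
  have hw : (l : ℂ) + y * I = I * ((y : ℂ) - l * I) := by
    ring_nf; rw [Complex.I_sq]; ring
  have hth : theta y * y + y * Real.cos y / Real.sin y = y ^ 2 / Real.sin y ^ 2 := by
    rw [theta_of_pos hy0, Real.sin_two_mul]; field_simp; ring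
  rw [heatIntegrand, hz, saddleAmp, hw, mul_pow]
  have hE : Complex.exp (I * ((theta y * R : ℝ) : ℂ) * (I * ((y : ℂ) - l * I))
        - R * cothSeries ((-(y ^ 2) : ℝ) + ((r ^ 2 : ℝ) + (2 * y * l : ℝ) * I)))
      = (Real.exp (-(R * (y ^ 2 / Real.sin y ^ 2))) : ℝ) *
        Complex.exp (-((R : ℂ) * saddlePhase y r l)) := by
    rw [Complex.ofReal_exp, ← Complex.exp_add, ← hth, saddlePhase]
    congr 1
    push_cast; ring_nf; rw [show (I : ℂ) ^ 3 = I ^ 2 * I by ring, Complex.I_sq]; ring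
  rw [hE]; ring

/-- Uniform decay of the integrand on the strip swept by the contour shift. -/
lemma norm_heatIntegrand_le (n k₁ k₂ M : ℕ) {R T y : ℝ} (hR : 1 ≤ R) (hT : 0 ≤ T) (hy0 : 0 < y)
    (hy : y < π) :
    ∃ K : ℝ, ∀ r l τ : ℝ, |l| ≤ r → 0 ≤ τ → τ ≤ y →
      ‖heatIntegrand n k₁ k₂ R T ((l : ℂ) + τ * I) ((r ^ 2 - l ^ 2 : ℝ) : ℂ)‖
        ≤ K * (1 + r) ^ (-(M : ℝ)) := by
  have hδ0 : 0 < π ^ 2 - y ^ 2 := by nlinarith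
  set δ := π ^ 2 - y ^ 2 with hδdef
  have hδ : δ ≤ π ^ 2 - y ^ 2 := le_rfl
  obtain ⟨K, hK, hexp⟩ := exists_pow_mul_exp_le (2 * k₁ + k₂) M
  set Z := invSqSum
  have hZ : 0 ≤ Z := invSqSum_nonneg
  set S := y * Real.cos y / Real.sin y
  set E := Real.exp (y ^ 2 / δ * Z)
  set c := 1 + 2 * (16 / δ * Z)
  have hc : 0 ≤ c := by positivity
  refine ⟨Real.exp (-(R * S)) * (E ^ n * c ^ k₁) * 4 ^ k₂ * K, fun r l τ hl hτ0 hτy => ?_⟩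
  have hr : 0 ≤ r := (abs_nonneg _).trans hl
  have hz : ((r ^ 2 - l ^ 2 : ℝ) : ℂ) + ((l : ℂ) + τ * I) ^ 2
      = ((r ^ 2 - τ ^ 2 : ℝ) : ℂ) + (2 * τ * l : ℝ) * I := by
    push_cast; ring_nf; rw [Complex.I_sq]; ring
  rw [heatIntegrand, hz]
  set z := ((r ^ 2 - τ ^ 2 : ℝ) : ℂ) + (2 * τ * l : ℝ) * I with hzdef
  have hτ2 : τ ^ 2 ≤ y ^ 2 := by gcongr
  have hzre : z.re = r ^ 2 - τ ^ 2 := by simp [hzdef, -Complex.ofReal_pow, -Complex.ofReal_sub]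
  have hzr : -(y ^ 2) + r ^ 2 ≤ z.re := by rw [hzre]; linarith
  have hzr0 : -(y ^ 2) ≤ z.re := by nlinarith
  have hτ4 : τ ≤ 4 := by linarith [Real.pi_lt_d2]
  have hznorm : ‖z‖ ≤ 16 * (1 + r) ^ 2 := by
    have h1 : ‖z‖ ≤ |r ^ 2 - τ ^ 2| + |2 * τ * l| := by
      refine (norm_add_le _ _).trans ?_
      rw [norm_mul, Complex.norm_I, mul_one, Complex.norm_real, Complex.norm_real,
        Real.norm_eq_abs, Real.norm_eq_abs]
    have h2 : |2 * τ * l| ≤ 2 * τ * r := by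
      rw [abs_mul, abs_of_nonneg (by positivity : 0 ≤ 2 * τ)]; gcongr
    have h3 : |r ^ 2 - τ ^ 2| ≤ r ^ 2 + τ ^ 2 := by
      rw [abs_le]; constructor <;> nlinarith [sq_nonneg r, sq_nonneg τ]
    nlinarith
  have b1 : ‖Complex.exp (I * T * ((l : ℂ) + τ * I) - R * cothSeries z)‖
      ≤ Real.exp (-(R * S)) * Real.exp (-((r - 1) / 7)) := by
    rw [Complex.norm_exp, ← Real.exp_add]
    apply Real.exp_le_exp.2
    have h1 := cothSeries_sub_one_ge hr
    have h2 := re_cothSeries_ge (sq_nonneg y) hδ0 hδ (sq_nonneg r) hzr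
    rw [cothSeries_neg_sq hy0 hy, Complex.ofReal_re] at h2
    have h3 := sub_one_div_le hr
    have h4 : 0 ≤ r ^ 2 / (7 * (1 + r)) := by positivity
    have e : (I * T * ((l : ℂ) + τ * I) - R * cothSeries z).re
        = -(T * τ) - R * (cothSeries z).re := by
      simp [Complex.mul_re, Complex.mul_im]
    rw [e]
    change S + _ - _ ≤ _ at h2
    have h5 : 0 ≤ T * τ := by positivity
    have h6 : R * (S + r ^ 2 / (7 * (1 + r))) ≤ R * (cothSeries z).re := by
      gcongr; linarith
    have h7 : 1 * (r ^ 2 / (7 * (1 + r))) ≤ R * (r ^ 2 / (7 * (1 + r))) := by gcongr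
    linarith
  have b2 : ‖sinhQuot z‖ ≤ E := norm_sinhQuot_le (sq_nonneg y) hδ0 hδ hzr0
  have b3 : ‖cothSeries z‖ ≤ c * (1 + r) ^ 2 := by
    refine (norm_cothSeries_le (sq_nonneg y) hδ0 hδ hzr0).trans ?_
    have h1 : 1 ≤ (1 + r) ^ 2 := one_le_pow₀ (by linarith)
    have h2 : ‖z‖ / δ * Z ≤ 16 * (1 + r) ^ 2 / δ * Z := by gcongr
    have h3 : 16 * (1 + r) ^ 2 / δ * Z = 16 / δ * Z * (1 + r) ^ 2 := by ring
    simp only [c]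
    linarith
  have b4 : ‖(l : ℂ) + τ * I‖ ≤ 4 * (1 + r) := by
    refine (norm_add_le _ _).trans ?_
    rw [norm_mul, Complex.norm_I, mul_one, Complex.norm_real, Complex.norm_real,
        Real.norm_eq_abs, Real.norm_eq_abs, abs_of_nonneg hτ0]
    linarith
  rw [norm_mul, norm_mul, norm_mul, norm_pow, norm_pow, norm_pow]
  calc _ ≤ Real.exp (-(R * S)) * Real.exp (-((r - 1) / 7)) * (E ^ n * (c * (1 + r) ^ 2) ^ k₁)
        * (4 * (1 + r)) ^ k₂ := by gcongr
    _ = Real.exp (-(R * S)) * (E ^ n * c ^ k₁) * 4 ^ k₂ *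
        ((1 + r) ^ (2 * k₁ + k₂) * Real.exp (-((r - 1) / 7))) := by
        rw [mul_pow, mul_pow, ← pow_mul, pow_add]; ring
    _ ≤ Real.exp (-(R * S)) * (E ^ n * c ^ k₁) * 4 ^ k₂ * (K * (1 + r) ^ (-(M : ℝ))) := by
        exact mul_le_mul_of_nonneg_left (hexp r hr) (by positivity)
    _ = _ := by ring

lemma euclidean_norm_sq_succ {m : ℕ} (l : EuclideanSpace ℝ (Fin (m + 1))) :
    ‖l‖ ^ 2 = l 0 ^ 2 + ∑ i : Fin m, l i.succ ^ 2 := by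
  rw [EuclideanSpace.real_norm_sq_eq, Fin.sum_univ_succ]

lemma abs_coord_le_norm {m : ℕ} (l : EuclideanSpace ℝ (Fin (m + 1))) : |l 0| ≤ ‖l‖ :=
  PiLp.norm_apply_le l 0

lemma pT_eq_integral (n m k₁ k₂ : ℕ) (hm : 0 < m + 1) (x : EuclideanSpace ℝ (Fin (2 * n)))
    (t : EuclideanSpace ℝ (Fin (m + 1))) :
    pT n (m + 1) k₁ k₂ hm x t =
      ((-1 : ℂ) ^ k₁ * Complex.I ^ k₂ / ((4 * (π : ℂ)) ^ n * (2 * (π : ℂ)) ^ (m + 1))) *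
        ∫ l : EuclideanSpace ℝ (Fin (m + 1)),
          heatIntegrand n k₁ k₂ (‖x‖ ^ 2 / 4) ‖t‖ (l 0) ((∑ i : Fin m, l i.succ ^ 2 : ℝ) : ℂ) := by
  rw [pT]
  congr 1
  refine integral_congr_ae (Filter.Eventually.of_forall fun l => ?_)
  have h0 : (⟨0, hm⟩ : Fin (m + 1)) = 0 := rfl
  have hρ : ((∑ i : Fin m, l i.succ ^ 2 : ℝ) : ℂ) + (l 0 : ℂ) ^ 2 = ((‖l‖ ^ 2 : ℝ) : ℂ) := by
    rw [euclidean_norm_sq_succ]; push_cast; ring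
  simp only [h0]
  rw [heatIntegrand, hρ]
  split_ifs with hl hk
  · subst hl; subst hk
    simp [cothSeries_zero, sinhQuot_zero]
  · subst hl
    simp [hk]
  · have hn : ‖l‖ ≠ 0 := norm_ne_zero_iff.2 hl
    rw [cothSeries_real hn, sinhQuot_real hn]
    have e1 : ((‖x‖ ^ 2 / 4 * ‖l‖ * Real.cosh ‖l‖ / Real.sinh ‖l‖ : ℝ) : ℂ)
        = ((‖x‖ ^ 2 / 4 : ℝ) : ℂ) * ((‖l‖ * Real.cosh ‖l‖ / Real.sinh ‖l‖ : ℝ) : ℂ) := by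
      push_cast; ring
    rw [e1]
    congr 2
    rw [Complex.ofReal_div, Complex.ofReal_div, Complex.ofReal_mul, div_pow, div_pow, mul_pow,
      div_mul_div_comm]
    ring

lemma differentiableAt_heatIntegrand (n k₁ k₂ : ℕ) (R T : ℝ) {w ρ : ℂ}
    (h : -π ^ 2 < (ρ + w ^ 2).re) :
    DifferentiableAt ℂ (fun p : ℂ × ℂ => heatIntegrand n k₁ k₂ R T p.1 p.2) (w, ρ) := by
  have hz : DifferentiableAt ℂ (fun p : ℂ × ℂ => p.2 + p.1 ^ 2) (w, ρ) := by fun_prop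
  have h1 : DifferentiableAt ℂ (fun p : ℂ × ℂ => cothSeries (p.2 + p.1 ^ 2)) (w, ρ) :=
    DifferentiableAt.comp (w, ρ) (g := cothSeries) (differentiableAt_cothSeries h) hz
  have h2 : DifferentiableAt ℂ (fun p : ℂ × ℂ => sinhQuot (p.2 + p.1 ^ 2)) (w, ρ) :=
    DifferentiableAt.comp (w, ρ) (g := sinhQuot) (differentiableAt_sinhQuot h) hz
  unfold heatIntegrand
  fun_prop

lemma heatIntegrand_re_gt {y : ℝ} (hy : y < π) {v w : ℂ} (hv : 0 ≤ v.re)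
    (h0 : 0 ≤ w.im) (h1 : w.im ≤ y) : -π ^ 2 < (v + w ^ 2).re := by
  have : (v + w ^ 2).re = v.re + w.re ^ 2 - w.im ^ 2 := by
    rw [sq, Complex.add_re, Complex.mul_re]; ring
  rw [this]
  nlinarith [sq_nonneg w.re]

/-- The integral after the contour shift through the saddle point. -/
lemma integral_heatIntegrand (n k₁ k₂ m : ℕ) {R y : ℝ} (hR : 1 ≤ R) (hy0 : 0 < y) (hy : y < π)
    (hth : 0 ≤ theta y) :
    Integrable (fun l : EuclideanSpace ℝ (Fin (m + 1)) =>
      Complex.exp (-((R : ℂ) * saddlePhase y ‖l‖ (l 0))) * saddleAmp n k₁ k₂ y ‖l‖ (l 0)) ∧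
    ∫ l : EuclideanSpace ℝ (Fin (m + 1)),
        heatIntegrand n k₁ k₂ R (theta y * R) (l 0) ((∑ i : Fin m, l i.succ ^ 2 : ℝ) : ℂ)
      = I ^ k₂ * (Real.exp (-(R * (y ^ 2 / Real.sin y ^ 2))) : ℝ) *
        ∫ l : EuclideanSpace ℝ (Fin (m + 1)),
          Complex.exp (-((R : ℂ) * saddlePhase y ‖l‖ (l 0))) * saddleAmp n k₁ k₂ y ‖l‖ (l 0) := by
  obtain ⟨K, hK⟩ := norm_heatIntegrand_le n k₁ k₂ (m + 2) (T := theta y * R) hR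
    (mul_nonneg hth (by linarith)) hy0 hy
  have hsum : ∀ l : EuclideanSpace ℝ (Fin (m + 1)),
      ((∑ i : Fin m, l i.succ ^ 2 : ℝ) : ℂ) = ((‖l‖ ^ 2 - l 0 ^ 2 : ℝ) : ℂ) := by
    intro l; rw [euclidean_norm_sq_succ]; ring_nf
  have hv0 : ∀ v : Fin m → ℝ, 0 ≤ (((∑ i : Fin m, v i ^ 2 : ℝ) : ℂ)).re := by
    intro v; rw [Complex.ofReal_re]; positivity
  have key := integral_shift_euclidean (m := m) (y := y) (C := K)
    (f := fun w v => heatIntegrand n k₁ k₂ R (theta y * R) w ((∑ i : Fin m, v i ^ 2 : ℝ) : ℂ))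
    hy0.le ?_ ?_ ?_
  · have hsh : ∀ l : EuclideanSpace ℝ (Fin (m + 1)),
        heatIntegrand n k₁ k₂ R (theta y * R) ((l 0 : ℂ) + y * I)
          ((∑ i : Fin m, l i.succ ^ 2 : ℝ) : ℂ)
        = I ^ k₂ * (Real.exp (-(R * (y ^ 2 / Real.sin y ^ 2))) : ℝ) *
          (Complex.exp (-((R : ℂ) * saddlePhase y ‖l‖ (l 0))) *
            saddleAmp n k₁ k₂ y ‖l‖ (l 0)) := by
      intro l; rw [hsum, heatIntegrand_shift n k₁ k₂ hy0 hy]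
    simp only [hsh] at key
    have hne : I ^ k₂ * (Real.exp (-(R * (y ^ 2 / Real.sin y ^ 2))) : ℂ) ≠ 0 :=
      mul_ne_zero (pow_ne_zero _ Complex.I_ne_zero)
        (Complex.ofReal_ne_zero.2 (Real.exp_pos _).ne')
    refine ⟨?_, ?_⟩
    · exact (integrable_const_mul_iff (isUnit_iff_ne_zero.2 hne) _).1 key.1
    · rw [key.2, integral_const_mul]
  · intro v w h0 h1
    exact DifferentiableAt.comp w (f := fun w : ℂ => (w, ((∑ i : Fin m, v i ^ 2 : ℝ) : ℂ)))
      (differentiableAt_heatIntegrand n k₁ k₂ R (theta y * R)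
        (heatIntegrand_re_gt hy (hv0 v) h0 h1)) (by fun_prop)
  · intro τ h0 h1
    refine continuous_iff_continuousAt.2 fun p => ?_
    have hd := (differentiableAt_heatIntegrand n k₁ k₂ R (theta y * R)
      (heatIntegrand_re_gt (w := (p.1 : ℂ) + τ * I) hy (hv0 p.2) (by simpa using h0)
        (by simpa using h1))).continuousAt
    exact ContinuousAt.comp (f := fun p : ℝ × (Fin m → ℝ) =>
      ((p.1 : ℂ) + τ * I, ((∑ i : Fin m, p.2 i ^ 2 : ℝ) : ℂ))) hd (by fun_prop)
  · intro l τ h0 h1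
    simp only []
    rw [hsum]
    exact hK ‖l‖ (l 0) τ (abs_coord_le_norm l) h0 h1

lemma saddleIntegrand_neg (n k₁ k₂ : ℕ) (y η u l : ℝ) :
    saddleIntegrand n k₁ k₂ y η u (-l) = starRingEnd ℂ (saddleIntegrand n k₁ k₂ y η u l) := by
  have hz : ((-(y ^ 2) : ℝ) : ℂ) + (((η * u) ^ 2 : ℝ) + (2 * y * (η * -l) : ℝ) * I)
      = starRingEnd ℂ (((-(y ^ 2) : ℝ) : ℂ) + (((η * u) ^ 2 : ℝ) + (2 * y * (η * l) : ℝ) * I)) := by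
    simp [map_ofNat]
  rw [saddleIntegrand, saddleIntegrand, saddlePhase, saddlePhase, saddleAmp, saddleAmp, hz,
    cothSeries_conj, sinhQuot_conj]
  simp only [map_mul, map_pow, map_sub, ← Complex.exp_conj, map_neg, Complex.conj_ofReal,
    Complex.conj_I]
  push_cast
  congr 1
  · congr 1; ring
  · congr 2; ring

/-- Gaussian integral of the quadratic part of the phase. -/
lemma integral_exp_neg_saddleForm (m : ℕ) (y : ℝ) :
    ∫ u : EuclideanSpace ℝ (Fin (m + 1)), Real.exp (-saddleForm y ‖u‖ (u 0))
      = √(π / (2 * cothCoeff 2 (y ^ 2) + 8 * y ^ 2 * cothCoeff 3 (y ^ 2))) *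
        √(π / (2 * cothCoeff 2 (y ^ 2))) ^ m := by
  set α := 2 * cothCoeff 2 (y ^ 2) + 8 * y ^ 2 * cothCoeff 3 (y ^ 2)
  set β := 2 * cothCoeff 2 (y ^ 2) with hβ
  set c : Fin (m + 1) → ℝ := Fin.cons α fun _ => β with hc
  have h1 : ∀ u : EuclideanSpace ℝ (Fin (m + 1)), Real.exp (-saddleForm y ‖u‖ (u 0))
      = ∏ i, Real.exp (-c i * u i ^ 2) := by
    intro u
    rw [← Real.exp_sum, Fin.sum_univ_succ, saddleForm, euclidean_norm_sq_succ]
    simp only [hc, Fin.cons_zero, Fin.cons_succ, ← Finset.mul_sum]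
    congr 1
    simp only [α, hβ]
    ring
  simp_rw [h1]
  have h2 := (EuclideanSpace.volume_preserving_symm_measurableEquiv_toLp
    (Fin (m + 1))).integral_comp' (fun v : Fin (m + 1) → ℝ => ∏ i, Real.exp (-c i * v i ^ 2))
  have h3 : ∫ u : EuclideanSpace ℝ (Fin (m + 1)), ∏ i, Real.exp (-c i * u i ^ 2)
      = ∫ v : Fin (m + 1) → ℝ, ∏ i, Real.exp (-c i * v i ^ 2) := h2
  rw [h3, integral_fintype_prod_volume_eq_prod (fun i (x : ℝ) => Real.exp (-c i * x ^ 2))]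
  simp_rw [integral_gaussian]
  rw [Fin.prod_univ_succ]
  simp [hc]

/-- Laplace asymptotics of the integral over the shifted contour. -/
lemma integral_saddle_sub_le (n k₁ k₂ m : ℕ) {δ : ℝ} (hδ0 : 0 < δ) (hδ1 : δ ≤ 1) :
    ∃ K : ℝ, 0 ≤ K ∧ ∀ y η : ℝ, 0 < y → y < π → δ ≤ π ^ 2 - y ^ 2 → 0 < η → η ≤ 1 →
      Integrable (fun l : EuclideanSpace ℝ (Fin (m + 1)) =>
        Complex.exp (-(((η ^ 2)⁻¹ : ℝ) * saddlePhase y ‖l‖ (l 0))) *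
          saddleAmp n k₁ k₂ y ‖l‖ (l 0)) →
      ‖(∫ l : EuclideanSpace ℝ (Fin (m + 1)),
          Complex.exp (-(((η ^ 2)⁻¹ : ℝ) * saddlePhase y ‖l‖ (l 0))) *
            saddleAmp n k₁ k₂ y ‖l‖ (l 0))
        - ((η ^ (m + 1) * (saddleAmpZero n k₁ k₂ y *
            ∫ u : EuclideanSpace ℝ (Fin (m + 1)), Real.exp (-saddleForm y ‖u‖ (u 0))) : ℝ) : ℂ)‖
        ≤ K * η ^ (m + 3) := by
  obtain ⟨K, hK, hpt⟩ := saddleIntegrand_sub_le n k₁ k₂ (m + 2) hδ0 hδ1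
  obtain ⟨K', hK', hexp⟩ := exists_pow_mul_exp_le 0 (m + 2)
  have hJint : Integrable (fun u : EuclideanSpace ℝ (Fin (m + 1)) =>
      (1 + ‖u‖) ^ (-((m + 2 : ℕ) : ℝ))) := by
    refine integrable_one_add_norm ?_
    rw [finrank_euclideanSpace_fin]; push_cast; linarith
  set J := ∫ u : EuclideanSpace ℝ (Fin (m + 1)), (1 + ‖u‖) ^ (-((m + 2 : ℕ) : ℝ))
  have hJ : 0 ≤ J := integral_nonneg fun u => by positivity
  refine ⟨K * J, by positivity, fun y η hy0 hy hδ hη0 hη1 h_int => ?_⟩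
  set F := fun l : EuclideanSpace ℝ (Fin (m + 1)) =>
    Complex.exp (-(((η ^ 2)⁻¹ : ℝ) * saddlePhase y ‖l‖ (l 0))) * saddleAmp n k₁ k₂ y ‖l‖ (l 0)
    with hF
  set H := fun u : EuclideanSpace ℝ (Fin (m + 1)) => saddleIntegrand n k₁ k₂ y η ‖u‖ (u 0) with hH
  set Q := fun u : EuclideanSpace ℝ (Fin (m + 1)) => Real.exp (-saddleForm y ‖u‖ (u 0)) with hQ
  have hFH : ∀ u, F (η • u) = H u := by
    intro u
    simp [hF, hH, saddleIntegrand, norm_smul, abs_of_pos hη0]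
  have hHint : Integrable H := by
    have := (integrable_comp_smul_iff volume F hη0.ne').2 h_int
    simpa only [hFH] using this
  have hscale : ∫ l, F l = ((η ^ (m + 1) : ℝ) : ℂ) * ∫ u, H u := by
    have := Measure.integral_comp_smul (volume : Measure (EuclideanSpace ℝ (Fin (m + 1)))) F η
    simp only [hFH] at this
    rw [this, finrank_euclideanSpace_fin, abs_of_pos (by positivity), Complex.real_smul,
      ← mul_assoc, ← Complex.ofReal_mul, mul_inv_cancel₀ (by positivity), Complex.ofReal_one,
      one_mul]
  have hreal : ∫ u, H u = ((∫ u, (H u).re : ℝ) : ℂ) := by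
    have h1 : starRingEnd ℂ (∫ u, H u) = ∫ u, H u := by
      rw [← integral_conj, ← integral_neg_eq_self (fun u => H u)]
      refine integral_congr_ae (Filter.Eventually.of_forall fun u => ?_)
      simp only [hH, norm_neg]
      rw [← saddleIntegrand_neg]
      rfl
    have h2 : ∫ u, (H u).re = (∫ u, H u).re := integral_re hHint
    rw [h2]
    exact (Complex.conj_eq_iff_re.1 h1).symm
  have hQint : Integrable Q := by
    refine (hJint.const_mul K').mono' ?_ (Filter.Eventually.of_forall fun u => ?_)
    · refine Continuous.aestronglyMeasurable ?_
      simp only [hQ, saddleForm]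
      fun_prop
    · rw [Real.norm_eq_abs, abs_of_pos (Real.exp_pos _)]
      have h1 := saddleForm_ge (u := ‖u‖) (l := u 0) hδ0 hδ1 hδ
      have h2 := hexp ‖u‖ (norm_nonneg u)
      rw [pow_zero, one_mul] at h2
      exact (Real.exp_le_exp.2 (neg_le_neg h1)).trans h2
  have hdiff : |(∫ u, (H u).re) - saddleAmpZero n k₁ k₂ y * ∫ u, Q u| ≤ η ^ 2 * (K * J) := by
    have hre : Integrable fun u => (H u).re := hHint.re
    rw [← integral_const_mul, ← integral_sub hre (hQint.const_mul _), ← Real.norm_eq_abs,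
      ← integral_const_mul, ← integral_const_mul]
    refine norm_integral_le_of_norm_le ((hJint.const_mul K).const_mul _)
      (Filter.Eventually.of_forall fun u => ?_)
    have := hpt y η ‖u‖ (u 0) hy0 hy hδ hη0 hη1 (abs_coord_le_norm u)
    rw [mul_comm (Real.exp _)] at this
    exact this
  rw [hscale, hreal, ← Complex.ofReal_mul, ← Complex.ofReal_sub, Complex.norm_real,
    Real.norm_eq_abs, ← mul_sub, abs_mul, abs_of_pos (by positivity)]
  calc _ ≤ η ^ (m + 1) * (η ^ 2 * (K * J)) := by gcongr
    _ = _ := by ring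

lemma gaussian_factor_eq {m : ℕ} {y δ : ℝ} (hy0 : 0 < y) (hy : y < π) (hδ0 : 0 < δ) (hδ1 : δ ≤ 1)
    (hδ : δ ≤ π ^ 2 - y ^ 2) :
    √((2 * π) ^ (m + 1) * y ^ m * Real.sin y ^ 3
        / (2 * theta y ^ m * (Real.sin y - y * Real.cos y)))
      = ∫ u : EuclideanSpace ℝ (Fin (m + 1)), Real.exp (-saddleForm y ‖u‖ (u 0)) := by
  have hs : 0 < Real.sin y := Real.sin_pos_of_pos_of_lt_pi hy0 hy
  have p2 : 0 < cothCoeff 2 (y ^ 2) := by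
    refine lt_of_lt_of_le ?_ (pi_sq_div_le_cothCoeff_two (sq_nonneg y) hδ0 hδ1 hδ)
    have : 0 < π ^ 2 - y ^ 2 := by linarith
    positivity
  have p3 := cothCoeff_nonneg (sq_nonneg y) hδ0 hδ 3
  have hd := deriv_theta_eq hy0 hy
  have hpow : ∀ a : ℝ, 0 ≤ a → √a ^ m = √(a ^ m) := fun a ha => by
    rw [eq_comm, Real.sqrt_eq_iff_mul_self_eq (by positivity) (by positivity), ← mul_pow,
      Real.mul_self_sqrt ha]
  rw [integral_exp_neg_saddleForm, theta_eq hy0 hy, hpow _ (by positivity),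
    ← Real.sqrt_mul (by positivity)]
  congr 1
  have hα : Real.sin y - y * Real.cos y = Real.sin y ^ 3 *
      (2 * cothCoeff 2 (y ^ 2) + 8 * y ^ 2 * cothCoeff 3 (y ^ 2)) := by
    rw [div_eq_iff (by positivity)] at hd
    linarith
  rw [hα]
  have : 0 < 2 * cothCoeff 2 (y ^ 2) + 8 * y ^ 2 * cothCoeff 3 (y ^ 2) := by positivity
  rw [div_pow, div_mul_div_comm, div_eq_div_iff (by positivity) (by positivity),
    show 4 * y * cothCoeff 2 (y ^ 2) = y * (2 * (2 * cothCoeff 2 (y ^ 2))) by ring,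
    mul_pow y, mul_pow 2 (2 * cothCoeff 2 (y ^ 2)), mul_pow 2 π]
  ring

/-- Uniform lower bound for the Gaussian factor. -/
lemma exists_gaussian_factor_ge (m : ℕ) {δ : ℝ} (hδ0 : 0 < δ) (hδ1 : δ ≤ 1) :
    ∃ c : ℝ, 0 < c ∧ ∀ y, 0 < y → y < π → δ ≤ π ^ 2 - y ^ 2 →
      c ≤ ∫ u : EuclideanSpace ℝ (Fin (m + 1)), Real.exp (-saddleForm y ‖u‖ (u 0)) := by
  set B := π ^ 2 / δ ^ 5 * invSqSum with hB
  have hB0 : 0 ≤ B := mul_nonneg (by positivity) invSqSum_nonneg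
  refine ⟨√(π / (1 + 130 * B)) * √(π / (1 + 130 * B)) ^ m, by positivity, fun y hy0 hy hδ => ?_⟩
  have c2 := cothCoeff_le (sq_nonneg y) hδ0 hδ1 hδ (j := 2) (by norm_num) (by norm_num)
  have c3 := cothCoeff_le (sq_nonneg y) hδ0 hδ1 hδ (j := 3) (by norm_num) (by norm_num)
  rw [← hB] at c2 c3
  have p2 : 0 < cothCoeff 2 (y ^ 2) := by
    refine lt_of_lt_of_le ?_ (pi_sq_div_le_cothCoeff_two (sq_nonneg y) hδ0 hδ1 hδ)
    have : 0 < π ^ 2 - y ^ 2 := by linarith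
    positivity
  have p3 := cothCoeff_nonneg (sq_nonneg y) hδ0 hδ 3
  have hy2 : y ^ 2 ≤ 16 := by nlinarith [Real.pi_lt_d2]
  have h1 : 8 * y ^ 2 * cothCoeff 3 (y ^ 2) ≤ 8 * 16 * B := by gcongr
  rw [integral_exp_neg_saddleForm]
  have hb1 : 2 * cothCoeff 2 (y ^ 2) + 8 * y ^ 2 * cothCoeff 3 (y ^ 2) ≤ 1 + 130 * B := by linarith
  have hb2 : 2 * cothCoeff 2 (y ^ 2) ≤ 1 + 130 * B := by linarith
  exact mul_le_mul
    (Real.sqrt_le_sqrt (div_le_div_of_nonneg_left (by positivity) (by positivity) hb1))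
    (pow_le_pow_left₀ (by positivity)
      (Real.sqrt_le_sqrt (div_le_div_of_nonneg_left (by positivity) (by positivity) hb2)) m)
    (by positivity) (by positivity)

/-- Case I asymptotics on H-type groups, for ω bounded away from 0 and π/2:
p_{1,k₁,k₂}(x,t) = |x|^{−m} e^{−d²/4} Ψ(ω)[(−1)^{k₁+k₂} y_ω^{n+k₁+k₂}cos(y_ω)^{k₁}/sin(y_ω)^{n+k₁}
+ O(|x|⁻²)]. -/
theorem htype_caseI (n m k₁ k₂ : ℕ) (hn : 1 ≤ n) (hm : 0 < m)
    (ε C : ℝ) (hε : 0 < ε) (hε' : ε < π / 4) (hC : π / 2 < C) :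
    ∃ K : ℝ, 0 < K ∧ ∃ M : ℝ, 0 < M ∧
      ∀ (x : EuclideanSpace ℝ (Fin (2 * n))) (t : EuclideanSpace ℝ (Fin m)) (yω ω d Ψ : ℝ),
        x ≠ 0 → M ≤ ‖x‖ →
        ω = 4 * ‖t‖ / ‖x‖ ^ 2 →
        ((ε ≤ ω ∧ ω ≤ π / 2 - ε) ∨ (π / 2 + ε ≤ ω ∧ ω ≤ C)) →
        yω ∈ Set.Ico 0 π → theta yω = ω →
        d = ‖x‖ * yω / Real.sin yω →
        Ψ = (1 / (4 ^ n * π ^ (n + m))) *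
              Real.sqrt ((2 * π) ^ m * yω ^ (m - 1) * Real.sin yω ^ 3
                / (2 * ω ^ (m - 1) * (Real.sin yω - yω * Real.cos yω))) →
        ‖pT n m k₁ k₂ hm x t -
            (((1 / ‖x‖ ^ m) * Real.exp (-d ^ 2 / 4) * Ψ *
              ((-1 : ℝ) ^ (k₁ + k₂) * yω ^ (n + k₁ + k₂) * Real.cos yω ^ k₁
                / Real.sin yω ^ (n + k₁)) : ℝ) : ℂ)‖
          ≤ K / ‖x‖ ^ (m + 2) * Real.exp (-d ^ 2 / 4) * Ψ := by
  obtain ⟨m, rfl⟩ : ∃ m', m = m' + 1 := ⟨m - 1, by omega⟩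
  have hpi := Real.pi_pos
  obtain ⟨δ, hδ0, hδ1, hgap⟩ := exists_uniform_gap C (by linarith)
  obtain ⟨K, hK, hlap⟩ := integral_saddle_sub_le n k₁ k₂ m hδ0 hδ1
  obtain ⟨c, hc, hgauss⟩ := exists_gaussian_factor_ge m hδ0 hδ1
  refine ⟨4 * K / c + 1, by positivity, 2, two_pos, ?_⟩
  intro x t y ω d Ψ hx hM hω hcase hyI hth hd hΨ
  have hωε : ε ≤ ω := by rcases hcase with h | h <;> linarith
  have hωC : ω ≤ C := by rcases hcase with h | h <;> linarith
  have hy : y < π := hyI.2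
  have hy0 : 0 < y := by
    refine lt_of_le_of_ne hyI.1 fun h => ?_
    rw [← h, theta, if_pos rfl] at hth
    linarith
  have hδ := hgap y hy0 hy (hth.le.trans hωC)
  have hs : 0 < Real.sin y := Real.sin_pos_of_pos_of_lt_pi hy0 hy
  have hx0 : 0 < ‖x‖ := by linarith
  rw [← hth, Nat.add_sub_cancel, gaussian_factor_eq hy0 hy hδ0 hδ1 hδ] at hΨ
  have hc𝒢 := hgauss y hy0 hy hδ
  have hR : ‖x‖ ^ 2 / 4 = ((2 / ‖x‖) ^ 2)⁻¹ := by field_simp; norm_num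
  have hR1 : 1 ≤ ‖x‖ ^ 2 / 4 := by nlinarith
  have ht : ‖t‖ = theta y * (‖x‖ ^ 2 / 4) := by rw [hth, hω]; field_simp
  obtain ⟨h_int, heq⟩ := integral_heatIntegrand n k₁ k₂ m hR1 hy0 hy (by linarith)
  have hE : -(‖x‖ ^ 2 / 4 * (y ^ 2 / Real.sin y ^ 2)) = -d ^ 2 / 4 := by
    rw [hd]; field_simp
  rw [pT_eq_integral, ht, heq, hE]
  rw [hR] at h_int ⊢
  have hL := hlap y (2 / ‖x‖) hy0 hy hδ (by positivity)
    (by rw [div_le_one hx0]; exact hM) h_int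
  set 𝓘 := ∫ l : EuclideanSpace ℝ (Fin (m + 1)),
    Complex.exp (-(((((2 / ‖x‖) ^ 2)⁻¹ : ℝ) : ℂ) * saddlePhase y ‖l‖ (l 0))) *
      saddleAmp n k₁ k₂ y ‖l‖ (l 0)
  set 𝒢 := ∫ u : EuclideanSpace ℝ (Fin (m + 1)), Real.exp (-saddleForm y ‖u‖ (u 0))
  set e := Real.exp (-d ^ 2 / 4)
  have he : 0 < e := Real.exp_pos _
  set D : ℝ := (4 * π) ^ n * (2 * π) ^ (m + 1) with hD
  have hD0 : 0 < D := by positivity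
  have hmain : (1 / ‖x‖ ^ (m + 1)) * e * Ψ *
        ((-1 : ℝ) ^ (k₁ + k₂) * y ^ (n + k₁ + k₂) * Real.cos y ^ k₁ / Real.sin y ^ (n + k₁))
      = (-1) ^ (k₁ + k₂) / D * e * ((2 / ‖x‖) ^ (m + 1) * (saddleAmpZero n k₁ k₂ y * 𝒢)) := by
    rw [hΨ, saddleAmpZero, hD]
    simp only [div_pow, mul_pow, pow_add, pow_one]
    field_simp
  have hpre : (-1 : ℂ) ^ k₁ * I ^ k₂ / ((4 * (π : ℂ)) ^ n * (2 * (π : ℂ)) ^ (m + 1)) *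
        (I ^ k₂ * (e : ℂ) * 𝓘) = (((-1) ^ (k₁ + k₂) / D * e : ℝ) : ℂ) * 𝓘 := by
    have hI : I ^ k₂ * I ^ k₂ = (-1 : ℂ) ^ k₂ := by rw [← mul_pow, Complex.I_mul_I]
    rw [hD]
    push_cast
    rw [pow_add (-1 : ℂ) k₁ k₂, ← hI]
    ring
  rw [hpre, hmain, Complex.ofReal_mul ((-1) ^ (k₁ + k₂) / D * e), ← mul_sub, norm_mul,
    Complex.norm_real, Real.norm_eq_abs, abs_mul, abs_div, abs_pow, abs_neg, abs_one, one_pow,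
    abs_of_pos he, abs_of_pos hD0]
  have h𝒢 : 0 < 𝒢 := hc.trans_le hc𝒢
  calc 1 / D * e * _ ≤ 1 / D * e * (K * (2 / ‖x‖) ^ (m + 3)) := by gcongr
    _ = 4 * K / 𝒢 / ‖x‖ ^ (m + 1 + 2) * e * Ψ := by
        rw [hΨ, hD]
        simp only [div_pow, mul_pow, pow_add, pow_one]
        field_simp
        ring
    _ ≤ (4 * K / c + 1) / ‖x‖ ^ (m + 1 + 2) * e * Ψ := by
        have hΨ0 : 0 ≤ Ψ := by rw [hΨ]; positivity
        gcongr
        have : 4 * K / 𝒢 ≤ 4 * K / c := by gcongr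
        linarith
end

section
/- Let m ≥ 3 be an odd integer and n ≥ 1, k₁, k₂ ≥ 0 integers. Then for every x ∈ ℝ^{2n} and every t ∈ ℝ^m with t ≠ 0, p^{(m)}_{1,k₁,k₂}(x,t) = Σ_{k=1}^{(m−1)/2} (c_{m,k} (−1)^k / (2π)^{(m−1)/2}) · Σ_{r=0}^{k₂} binom(k₂, r) · ((−1)^r (m−1−k)_r / |t|^{m−1−k+r}) · p^{(1)}_{1,k₁,k₂+k−r}(x, |t|), where c_{m,k} = (m−k−2)! / (2^{(m−1)/2−k} ((m−1)/2 − k)! (k−1)!) and (a)_r = a(a+1)⋯(a+r−1) is the Pochhammer symbol (with (a)₀ = 1). -/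
open Real Complex MeasureTheory
open scoped Classical

/-- p^{(1)}_{1,k₁,j}(x, τ) for τ ≥ 0: the Heisenberg-group radial heat-kernel derivative. -/
noncomputable def pH1 (n k₁ j : ℕ) (x : EuclideanSpace ℝ (Fin (2 * n))) (τ : ℝ) : ℂ :=
  (2 * (-1 : ℂ) ^ k₁ * Complex.I ^ j / (4 * (π : ℂ)) ^ (n + 1)) *
    ∫ lam : ℝ,
      if lam = 0 then (if j = 0 then Complex.exp (-((‖x‖ ^ 2 / 4 : ℝ) : ℂ)) else 0)
      else
        Complex.exp (Complex.I * (lam : ℂ) * (τ : ℂ)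
            - ((‖x‖ ^ 2 / 4 * lam * Real.cosh lam / Real.sinh lam : ℝ) : ℂ)) *
          ((lam : ℂ) ^ (n + k₁ + j) * ((Real.cosh lam : ℝ) : ℂ) ^ k₁
            / ((Real.sinh lam : ℝ) : ℂ) ^ (n + k₁))

/-- Splitting off the first coordinate of a Euclidean space. -/
noncomputable def euclideanSuccEquiv (d : ℕ) :
    EuclideanSpace ℝ (Fin (d + 1)) ≃ᵐ ℝ × EuclideanSpace ℝ (Fin d) :=
  (MeasurableEquiv.toLp 2 (Fin (d + 1) → ℝ)).symm.trans <|
    (MeasurableEquiv.piFinSuccAbove (fun _ => ℝ) 0).trans <|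
      (MeasurableEquiv.refl ℝ).prodCongr (MeasurableEquiv.toLp 2 (Fin d → ℝ))

theorem norm_eq_sqrt_euclideanSuccEquiv {d : ℕ} (v : EuclideanSpace ℝ (Fin (d + 1))) :
    ‖v‖ = √((euclideanSuccEquiv d v).1 ^ 2 + ‖(euclideanSuccEquiv d v).2‖ ^ 2) := by
  rw [EuclideanSpace.norm_eq, EuclideanSpace.norm_sq_eq, Fin.sum_univ_succ]
  simp only [Real.norm_eq_abs, sq_abs]
  rfl

theorem measurePreserving_euclideanSuccEquiv (d : ℕ) :
    MeasurePreserving (euclideanSuccEquiv d) := by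
  have h1 := EuclideanSpace.volume_preserving_symm_measurableEquiv_toLp (Fin (d + 1))
  have h2 := volume_preserving_piFinSuccAbove (fun _ : Fin (d + 1) => ℝ) 0
  have h3 : MeasurePreserving (Prod.map id (MeasurableEquiv.toLp 2 (Fin d → ℝ)))
      ((volume : Measure ℝ).prod volume) ((volume : Measure ℝ).prod volume) :=
    (MeasurePreserving.id volume).prod (PiLp.volume_preserving_toLp (Fin d))
  exact h3.comp (h2.comp h1)

theorem integral_mul_norm_eq_slice {d : ℕ} (g F : ℝ → ℂ)
    (hint : Integrable fun v : EuclideanSpace ℝ (Fin (d + 1)) => g (v 0) * F ‖v‖) :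
    ∫ v : EuclideanSpace ℝ (Fin (d + 1)), g (v 0) * F ‖v‖ =
      ∫ u : ℝ, g u * ∫ y : EuclideanSpace ℝ (Fin d), F √(u ^ 2 + ‖y‖ ^ 2) := by
  have he := measurePreserving_euclideanSuccEquiv d
  let G : ℝ × EuclideanSpace ℝ (Fin d) → ℂ := fun p => g p.1 * F √(p.1 ^ 2 + ‖p.2‖ ^ 2)
  have hG : ∀ v : EuclideanSpace ℝ (Fin (d + 1)),
      g (v 0) * F ‖v‖ = G (euclideanSuccEquiv d v) := fun v => by
    rw [norm_eq_sqrt_euclideanSuccEquiv v]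
    rfl
  simp_rw [hG] at hint ⊢
  rw [he.integral_comp (euclideanSuccEquiv d).measurableEmbedding]
  have hG' : Integrable G :=
    (he.integrable_comp_emb (euclideanSuccEquiv d).measurableEmbedding).1 hint
  rw [Measure.volume_eq_prod, integral_prod _ hG']
  simp only [G, integral_const_mul]

theorem image_sqrt_add_sq_Ioi (u : ℝ) :
    (fun ρ : ℝ => √(u ^ 2 + ρ ^ 2)) '' Set.Ioi 0 = Set.Ioi |u| := by
  ext v
  simp only [Set.mem_image, Set.mem_Ioi]
  constructor
  · rintro ⟨ρ, hρ, rfl⟩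
    exact Real.lt_sqrt_of_sq_lt (by rw [sq_abs]; nlinarith)
  · intro hv
    have hv0 : 0 < v := (abs_nonneg u).trans_lt hv
    have h : u ^ 2 < v ^ 2 := by
      rw [← sq_abs u]
      exact pow_lt_pow_left₀ hv (abs_nonneg u) two_ne_zero
    refine ⟨√(v ^ 2 - u ^ 2), Real.sqrt_pos.2 (by linarith), ?_⟩
    rw [Real.sq_sqrt (by linarith), add_sub_cancel, Real.sqrt_sq hv0.le]

theorem integral_Ioi_abs_eq (F : ℝ → ℂ) (M : ℕ) (u : ℝ) :
    ∫ v in Set.Ioi |u|, F v * ((v ^ 2 - u ^ 2 : ℝ) : ℂ) ^ M * v =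
      ∫ ρ in Set.Ioi (0 : ℝ), ρ ^ (2 * M + 1) • F √(u ^ 2 + ρ ^ 2) := by
  have hpos : ∀ ρ ∈ Set.Ioi (0 : ℝ), 0 < u ^ 2 + ρ ^ 2 := fun ρ hρ => by
    have : 0 < ρ := hρ
    positivity
  have hder : ∀ ρ ∈ Set.Ioi (0 : ℝ),
      HasDerivWithinAt (fun ρ : ℝ => √(u ^ 2 + ρ ^ 2)) (ρ / √(u ^ 2 + ρ ^ 2)) (Set.Ioi 0) ρ := by
    intro ρ hρ
    have h := (((hasDerivAt_pow 2 ρ).const_add (u ^ 2)).sqrt (hpos ρ hρ).ne').hasDerivWithinAt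
      (s := Set.Ioi 0)
    exact h.congr_deriv (by rw [Nat.cast_ofNat, pow_one, mul_div_mul_left _ _ two_ne_zero])
  have hinj : Set.InjOn (fun ρ : ℝ => √(u ^ 2 + ρ ^ 2)) (Set.Ioi 0) := by
    intro a ha b hb hab
    have h := (Real.sqrt_inj (hpos a ha).le (hpos b hb).le).1 hab
    exact (sq_eq_sq₀ (le_of_lt ha) (le_of_lt hb)).1 (by linarith)
  rw [← image_sqrt_add_sq_Ioi,
    integral_image_eq_integral_abs_deriv_smul measurableSet_Ioi hder hinj]
  refine setIntegral_congr_fun measurableSet_Ioi fun ρ hρ => ?_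
  have hρ0 : 0 < ρ := hρ
  have hs : 0 < √(u ^ 2 + ρ ^ 2) := Real.sqrt_pos.2 (hpos ρ hρ)
  have hs' : ((√(u ^ 2 + ρ ^ 2) : ℝ) : ℂ) ≠ 0 := by exact_mod_cast hs.ne'
  simp only [Complex.real_smul]
  rw [abs_of_pos (by positivity), Real.sq_sqrt (hpos ρ hρ).le]
  push_cast
  field_simp
  ring

theorem integral_euclidean_even_sqrt (F : ℝ → ℂ) (M : ℕ) (u : ℝ) :
    ∫ y : EuclideanSpace ℝ (Fin (2 * M + 2)), F √(u ^ 2 + ‖y‖ ^ 2) =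
      (2 * π ^ (M + 1) / M.factorial : ℂ) *
        ∫ v in Set.Ioi |u|, F v * ((v ^ 2 - u ^ 2 : ℝ) : ℂ) ^ M * v := by
  have hrank : Module.finrank ℝ (EuclideanSpace ℝ (Fin (2 * M + 2))) = 2 * (M + 1) := by
    simp [mul_add]
  rw [integral_fun_norm_addHaar volume (fun r => F √(u ^ 2 + r ^ 2)), integral_Ioi_abs_eq,
    Measure.real, InnerProductSpace.volume_ball_of_dim_even hrank, hrank]
  have h : 2 * (M + 1) - 1 = 2 * M + 1 := by omega
  have hM : ((M.factorial : ℕ) : ℂ) ≠ 0 := by exact_mod_cast M.factorial_ne_zero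
  have hM1 : (M : ℂ) + 1 ≠ 0 := by exact_mod_cast M.succ_ne_zero
  rw [h, ENNReal.toReal_mul, ENNReal.toReal_pow, ENNReal.toReal_ofReal zero_le_one,
    ENNReal.toReal_ofReal (by positivity), Nat.factorial_succ]
  simp only [one_pow, one_mul, nsmul_eq_mul, Complex.real_smul]
  push_cast
  field_simp

theorem integrable_mul_norm_of_moments {d j : ℕ} {g F : ℝ → ℂ} (hg : Continuous g)
    (hgb : ∀ u, ‖g u‖ ≤ |u| ^ j) (hF : Measurable F)
    (hFi : ∀ l : ℕ, IntegrableOn (fun v : ℝ => (v : ℂ) ^ l * F v) (Set.Ioi 0)) :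
    Integrable fun v : EuclideanSpace ℝ (Fin (d + 1)) => g (v 0) * F ‖v‖ := by
  have hdom : Integrable fun v : EuclideanSpace ℝ (Fin (d + 1)) => ((‖v‖ : ℝ) : ℂ) ^ j * F ‖v‖ := by
    rw [integrable_fun_norm_addHaar volume (f := fun r : ℝ => (r : ℂ) ^ j * F r)]
    refine (hFi (d + j)).congr_fun (fun v _ => ?_) measurableSet_Ioi
    simp only [finrank_euclideanSpace, Fintype.card_fin, Nat.add_sub_cancel, Complex.real_smul]
    push_cast
    ring
  refine hdom.mono ?_ (Filter.Eventually.of_forall fun v => ?_)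
  · exact ((hg.measurable.comp (by fun_prop)).mul (hF.comp measurable_norm)).aestronglyMeasurable
  · simp only [norm_mul, norm_pow, Complex.norm_real, norm_norm]
    refine mul_le_mul_of_nonneg_right ((hgb _).trans ?_) (norm_nonneg _)
    exact pow_le_pow_left₀ (abs_nonneg _) (PiLp.norm_apply_le v 0) _

theorem integrable_prod_indicator_abs_lt {j M : ℕ} {g F : ℝ → ℂ} (hg : Continuous g)
    (hgb : ∀ u, ‖g u‖ ≤ |u| ^ j) (hF : Measurable F)
    (hFi : ∀ l : ℕ, IntegrableOn (fun v : ℝ => (v : ℂ) ^ l * F v) (Set.Ioi 0)) :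
    Integrable ({p : ℝ × ℝ | |p.1| < p.2}.indicator fun p : ℝ × ℝ =>
      g p.1 * (F p.2 * ((p.2 ^ 2 - p.1 ^ 2 : ℝ) : ℂ) ^ M * p.2)) := by
  have hK : Integrable fun v : ℝ => (Set.Ioi (0 : ℝ)).indicator
      (fun v : ℝ => (v : ℂ) ^ (j + 2 * M + 1) * F v + (v : ℂ) ^ (j + 2 * M + 3) * F v) v :=
    (integrable_indicator_iff measurableSet_Ioi).2 ((hFi _).add (hFi _))
  have hdom := (integrable_inv_one_add_sq).mul_prod hK.norm
  have hS : MeasurableSet {p : ℝ × ℝ | |p.1| < p.2} :=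
    measurableSet_lt (by fun_prop) (by fun_prop)
  rw [Measure.volume_eq_prod]
  refine hdom.mono' ?_ (Filter.Eventually.of_forall fun p => ?_)
  · refine (Measurable.indicator ?_ hS).aestronglyMeasurable
    have := hg.measurable
    fun_prop
  · obtain ⟨u, v⟩ := p
    by_cases h : |u| < v
    · have hv : 0 < v := (abs_nonneg u).trans_lt h
      have huv : u ^ 2 ≤ v ^ 2 := by
        rw [← sq_abs u]
        exact pow_le_pow_left₀ (abs_nonneg u) h.le 2
      rw [Set.indicator_of_mem (by exact h), Set.indicator_of_mem (by exact hv)]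
      have e : (v : ℂ) ^ (j + 2 * M + 1) * F v + (v : ℂ) ^ (j + 2 * M + 3) * F v =
          ((v ^ j * (v ^ 2) ^ M * v * (1 + v ^ 2) : ℝ) : ℂ) * F v := by
        push_cast
        ring
      rw [e, norm_mul _ (F v), Complex.norm_of_nonneg (by positivity)]
      simp only [norm_mul, norm_pow, Complex.norm_real, Real.norm_eq_abs]
      rw [abs_of_pos hv, abs_of_nonneg (sub_nonneg.2 huv)]
      have h1 : ‖g u‖ ≤ v ^ j := (hgb u).trans (pow_le_pow_left₀ (abs_nonneg u) h.le _)
      have h2 : (v ^ 2 - u ^ 2) ^ M ≤ (v ^ 2) ^ M :=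
        pow_le_pow_left₀ (sub_nonneg.2 huv) (by nlinarith) _
      have h3 : 1 ≤ (1 + u ^ 2)⁻¹ * (1 + v ^ 2) := by
        rw [inv_mul_eq_div, one_le_div (by positivity)]
        linarith
      calc ‖g u‖ * (‖F v‖ * (v ^ 2 - u ^ 2) ^ M * v)
          ≤ v ^ j * (‖F v‖ * (v ^ 2) ^ M * v) := by gcongr
        _ ≤ v ^ j * (‖F v‖ * (v ^ 2) ^ M * v) * ((1 + u ^ 2)⁻¹ * (1 + v ^ 2)) :=
          le_mul_of_one_le_right (by positivity) h3
        _ = _ := by ring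
    · rw [Set.indicator_of_notMem (by exact h), norm_zero]
      positivity

/-- Integration over an odd-dimensional Euclidean space of a function of the first coordinate
times a radial function. -/
theorem integral_mul_norm_odd {j M : ℕ} {g F : ℝ → ℂ} (hg : Continuous g)
    (hgb : ∀ u, ‖g u‖ ≤ |u| ^ j) (hF : Measurable F)
    (hFi : ∀ l : ℕ, IntegrableOn (fun v : ℝ => (v : ℂ) ^ l * F v) (Set.Ioi 0)) :
    ∫ v : EuclideanSpace ℝ (Fin (2 * M + 2 + 1)), g (v 0) * F ‖v‖ =
      (2 * π ^ (M + 1) / M.factorial : ℂ) *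
        ∫ v in Set.Ioi (0 : ℝ), F v * (v * ∫ u in (-v)..v, g u * ((v ^ 2 - u ^ 2 : ℝ) : ℂ) ^ M) := by
  rw [integral_mul_norm_eq_slice g F (integrable_mul_norm_of_moments hg hgb hF hFi)]
  simp_rw [integral_euclidean_even_sqrt, mul_left_comm (g _), integral_const_mul]
  congr 1
  have hint := integrable_prod_indicator_abs_lt (M := M) hg hgb hF hFi
  set f : ℝ × ℝ → ℂ := {p : ℝ × ℝ | |p.1| < p.2}.indicator fun p : ℝ × ℝ =>
      g p.1 * (F p.2 * ((p.2 ^ 2 - p.1 ^ 2 : ℝ) : ℂ) ^ M * p.2) with hf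
  calc ∫ u, g u * ∫ v in Set.Ioi |u|, F v * ((v ^ 2 - u ^ 2 : ℝ) : ℂ) ^ M * v
      = ∫ u, ∫ v, f (u, v) := by
        congr 1 with u
        rw [← integral_const_mul, ← integral_indicator measurableSet_Ioi]
        rfl
    _ = ∫ v, ∫ u, f (u, v) := integral_integral_swap (f := fun u v => f (u, v)) hint
    _ = _ := by
        rw [← integral_indicator measurableSet_Ioi]
        congr 1 with v
        by_cases hv : 0 < v
        · rw [Set.indicator_of_mem (by exact hv), intervalIntegral.integral_of_le (by linarith),
            integral_Ioc_eq_integral_Ioo, ← integral_indicator measurableSet_Ioo,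
            ← mul_assoc, ← integral_const_mul]
          congr 1 with u
          by_cases hu : |u| < v
          · rw [hf, Set.indicator_of_mem (by exact hu),
              Set.indicator_of_mem (Set.mem_Ioo.2 (abs_lt.1 hu))]
            ring
          · rw [hf, Set.indicator_of_notMem (by exact hu),
              Set.indicator_of_notMem (fun h => hu (abs_lt.2 (Set.mem_Ioo.1 h))), mul_zero]
        · rw [Set.indicator_of_notMem (by exact hv)]
          have : ∀ u, f (u, v) = 0 := fun u => by
            have h : ¬|u| < v := fun h => hv ((abs_nonneg u).trans_lt h)
            rw [hf, Set.indicator_of_notMem (by exact h)]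
          simp [this]

/-- The Bessel polynomial coefficients occurring in the expansion of `(s⁻¹ d/ds)^(M+1)`. -/
noncomputable def besselCoeff (M i : ℕ) : ℂ :=
  ((2 * M - i).factorial : ℂ) / (2 ^ (M - i) * ((M - i).factorial : ℂ) * (i.factorial : ℂ))

theorem besselCoeff_succ_zero (M : ℕ) :
    besselCoeff (M + 1) 0 = (2 * M + 1) * besselCoeff M 0 := by
  have hM : ((M.factorial : ℕ) : ℂ) ≠ 0 := by exact_mod_cast M.factorial_ne_zero
  have hM1 : (M : ℂ) + 1 ≠ 0 := by exact_mod_cast M.succ_ne_zero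
  simp only [besselCoeff, Nat.sub_zero, mul_add, mul_one, Nat.factorial_succ]
  push_cast
  field_simp
  ring

theorem besselCoeff_succ_succ {M i : ℕ} (h : i < M) :
    besselCoeff (M + 1) (i + 1) =
      (2 * M - i : ℂ) * besselCoeff M (i + 1) + besselCoeff M i := by
  obtain ⟨q, rfl⟩ := Nat.exists_eq_add_of_lt h
  have hi : ((i.factorial : ℕ) : ℂ) ≠ 0 := by exact_mod_cast i.factorial_ne_zero
  have hi1 : (i : ℂ) + 1 ≠ 0 := by exact_mod_cast i.succ_ne_zero
  have hq : ((q.factorial : ℕ) : ℂ) ≠ 0 := by exact_mod_cast q.factorial_ne_zero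
  have hq1 : (q : ℂ) + 1 ≠ 0 := by exact_mod_cast q.succ_ne_zero
  have e1 : 2 * (i + q + 1 + 1) - (i + 1) = i + 2 * q + 1 + 1 + 1 := by omega
  have e2 : i + q + 1 + 1 - (i + 1) = q + 1 := by omega
  have e3 : 2 * (i + q + 1) - (i + 1) = i + 2 * q + 1 := by omega
  have e4 : i + q + 1 - (i + 1) = q := by omega
  have e5 : 2 * (i + q + 1) - i = i + 2 * q + 1 + 1 := by omega
  have e6 : i + q + 1 - i = q + 1 := by omega
  simp only [besselCoeff, e1, e2, e3, e4, e5, e6, Nat.factorial_succ, pow_succ]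
  push_cast
  field_simp
  ring

theorem besselCoeff_self (M : ℕ) : besselCoeff M M = 1 := by
  have hM : ((M.factorial : ℕ) : ℂ) ≠ 0 := by exact_mod_cast M.factorial_ne_zero
  simp [besselCoeff, two_mul, hM]

theorem sum_besselCoeff_succ (M : ℕ) (T : ℕ → ℂ) :
    ∑ i ∈ Finset.range (M + 2), besselCoeff (M + 1) i * T i =
      ∑ i ∈ Finset.range (M + 1),
        besselCoeff M i * ((((2 * M + 1 - i : ℕ) : ℝ) : ℂ) * T i + T (i + 1)) := by
  have h : ∀ i ∈ Finset.range (M + 1),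
      besselCoeff M i * ((((2 * M + 1 - i : ℕ) : ℝ) : ℂ) * T i + T (i + 1)) =
        (2 * M + 1 - i : ℂ) * besselCoeff M i * T i + besselCoeff M i * T (i + 1) := by
    intro i hi
    rw [Finset.mem_range] at hi
    rw [Nat.cast_sub (by omega)]
    push_cast
    ring
  rw [Finset.sum_congr rfl h, Finset.sum_add_distrib, Finset.sum_range_succ',
    Finset.sum_range_succ (fun i => besselCoeff (M + 1) (i + 1) * T (i + 1)),
    Finset.sum_range_succ' (fun i => (2 * M + 1 - i : ℂ) * besselCoeff M i * T i),
    Finset.sum_range_succ (fun i => besselCoeff M i * T (i + 1)),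
    besselCoeff_succ_zero, besselCoeff_self, besselCoeff_self]
  have h' : ∀ i ∈ Finset.range M, besselCoeff (M + 1) (i + 1) * T (i + 1) =
      (2 * M + 1 - (i + 1 : ℕ) : ℂ) * besselCoeff M (i + 1) * T (i + 1) +
        besselCoeff M i * T (i + 1) := by
    intro i hi
    rw [besselCoeff_succ_succ (Finset.mem_range.1 hi)]
    push_cast
    ring
  rw [Finset.sum_congr rfl h', Finset.sum_add_distrib]
  push_cast
  ring

/-- The `r`-th derivative of `s ↦ s⁻ᵃ`. -/
noncomputable def invPowDeriv (a r : ℕ) (s : ℝ) : ℂ :=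
  (-1) ^ r * (((ascPochhammer ℝ r).eval (a : ℝ) : ℝ) : ℂ) / (s : ℂ) ^ (a + r)

theorem hasDerivAt_invPowDeriv (a r : ℕ) {s : ℝ} (hs : 0 < s) :
    HasDerivAt (invPowDeriv a r) (invPowDeriv a (r + 1) s) s := by
  have hs' : (s : ℂ) ≠ 0 := by exact_mod_cast hs.ne'
  have h := ((hasDerivAt_pow (a + r) (s : ℂ)).inv (pow_ne_zero _ hs')).const_mul
    ((-1) ^ r * (((ascPochhammer ℝ r).eval (a : ℝ) : ℝ) : ℂ))
  refine h.comp_ofReal.congr_deriv ?_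
  rw [invPowDeriv, ascPochhammer_succ_eval]
  push_cast
  rcases Nat.eq_zero_or_pos (a + r) with h0 | h0
  · obtain ⟨rfl, rfl⟩ : a = 0 ∧ r = 0 := by omega
    simp
  · obtain ⟨b, hb⟩ : ∃ b, a + r = b + 1 := ⟨a + r - 1, by omega⟩
    have hb' : (a : ℂ) + r = b + 1 := by exact_mod_cast hb
    rw [← add_assoc, hb, hb', Nat.add_sub_cancel]
    field_simp
    ring

/-- The `l`-th derivative of `s ↦ cos (s v)`. -/
noncomputable def cosDeriv (v : ℝ) (l : ℕ) (s : ℝ) : ℂ :=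
  ((I * v) ^ l * cexp (I * s * v) + (-(I * v)) ^ l * cexp (-(I * s * v))) / 2

theorem hasDerivAt_cosDeriv (v : ℝ) (l : ℕ) (s : ℝ) :
    HasDerivAt (cosDeriv v l) (cosDeriv v (l + 1) s) s := by
  have h0 : HasDerivAt (fun z : ℂ => I * z * v) (I * v) (s : ℂ) := by
    simpa using ((hasDerivAt_id (s : ℂ)).const_mul I).mul_const (v : ℂ)
  have h1 : HasDerivAt (fun z : ℂ => -(I * z * v)) (-(I * v)) (s : ℂ) := h0.neg
  have h := ((h0.cexp.const_mul ((I * v) ^ l)).add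
    (h1.cexp.const_mul ((-(I * v)) ^ l))).div_const 2
  refine h.comp_ofReal.congr_deriv ?_
  simp only [cosDeriv, pow_succ]
  ring

/-- The Leibniz expansion of the `j`-th derivative of a product `a₀ b₀`, where `aᵣ` and `bₗ`
are successive derivatives. -/
theorem hasDerivAt_leibniz {a b : ℕ → ℝ → ℂ} {s : ℝ}
    (ha : ∀ r, HasDerivAt (a r) (a (r + 1) s) s) (hb : ∀ l, HasDerivAt (b l) (b (l + 1) s) s)
    (j : ℕ) :
    HasDerivAt
      (fun s => ∑ q ∈ Finset.HasAntidiagonal.antidiagonal j,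
        (j.choose q.1 : ℂ) * (a q.1 s * b q.2 s))
      (∑ q ∈ Finset.HasAntidiagonal.antidiagonal (j + 1),
        ((j + 1).choose q.1 : ℂ) * (a q.1 s * b q.2 s)) s := by
  rw [Finset.sum_antidiagonal_choose_succ_mul (fun r l => a r s * b l s), ← Finset.sum_add_distrib]
  refine HasDerivAt.fun_sum fun q hq => ?_
  refine (((ha q.1).mul (hb q.2)).const_mul (j.choose q.1 : ℂ)).congr_deriv ?_
  rw [← Nat.choose_symm_of_eq_add (Finset.HasAntidiagonal.mem_antidiagonal.1 hq).symm]
  ring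

/-- The Fourier integral of `(v² - u²)^M` over `[-v, v]`, differentiated `j` times. -/
noncomputable def besselKernel (M j : ℕ) (v s : ℝ) : ℂ :=
  ∫ u in (-v)..v, cexp (I * s * u) * (I * u) ^ j * ((v ^ 2 - u ^ 2 : ℝ) : ℂ) ^ M

theorem norm_cexp_I_mul_ofReal_mul (s u : ℝ) : ‖cexp (I * s * u)‖ = 1 := by
  rw [mul_assoc, ← Complex.ofReal_mul, mul_comm]
  exact Complex.norm_exp_ofReal_mul_I _

theorem hasDerivAt_besselKernel (M j : ℕ) (v s : ℝ) :
    HasDerivAt (besselKernel M j v) (besselKernel M (j + 1) v s) s := by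
  have hcont : ∀ (j : ℕ) (s : ℝ), Continuous fun u : ℝ =>
      cexp (I * s * u) * (I * u) ^ j * ((v ^ 2 - u ^ 2 : ℝ) : ℂ) ^ M := by
    intro j s
    fun_prop
  refine (intervalIntegral.hasDerivAt_integral_of_dominated_loc_of_deriv_le
    (bound := fun u => ‖(I * u : ℂ) ^ (j + 1) * ((v ^ 2 - u ^ 2 : ℝ) : ℂ) ^ M‖)
    (F := fun (s : ℝ) u => cexp (I * s * u) * (I * u) ^ j * ((v ^ 2 - u ^ 2 : ℝ) : ℂ) ^ M)
    (F' := fun (s : ℝ) u => cexp (I * s * u) * (I * u) ^ (j + 1) * ((v ^ 2 - u ^ 2 : ℝ) : ℂ) ^ M)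
    Filter.univ_mem (Filter.Eventually.of_forall fun s => (hcont j s).aestronglyMeasurable)
    ((hcont j s).intervalIntegrable _ _) (hcont (j + 1) s).aestronglyMeasurable
    (Filter.Eventually.of_forall fun u _ s _ => ?_)
    (Continuous.intervalIntegrable (by fun_prop) _ _)
    (Filter.Eventually.of_forall fun u _ s _ => ?_)).2
  · rw [mul_assoc, norm_mul, norm_cexp_I_mul_ofReal_mul, one_mul]
  · have h0 : HasDerivAt (fun z : ℂ => I * z * u) (I * u) (s : ℂ) := by
      simpa using ((hasDerivAt_id (s : ℂ)).const_mul I).mul_const (u : ℂ)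
    refine ((h0.cexp.mul_const ((I * u) ^ j)).mul_const
      (((v ^ 2 - u ^ 2 : ℝ) : ℂ) ^ M)).comp_ofReal.congr_deriv ?_
    ring

theorem besselKernel_succ_zero (M : ℕ) (v : ℝ) {s : ℝ} (hs : 0 < s) :
    besselKernel (M + 1) 0 v s = -(2 * (M + 1) / s) * besselKernel M 1 v s := by
  have hs' : (s : ℂ) ≠ 0 := by exact_mod_cast hs.ne'
  have hderiv : ∀ u ∈ Set.uIcc (-v) v,
      HasDerivAt (fun u : ℝ => cexp (I * s * u) * ((v ^ 2 - u ^ 2 : ℝ) : ℂ) ^ (M + 1))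
        (I * s * (cexp (I * s * u) * (I * u) ^ 0 * ((v ^ 2 - u ^ 2 : ℝ) : ℂ) ^ (M + 1)) +
          I * (2 * (M + 1)) * (cexp (I * s * u) * (I * u) ^ 1 * ((v ^ 2 - u ^ 2 : ℝ) : ℂ) ^ M))
        u := by
    intro u _
    have h0 : HasDerivAt (fun z : ℂ => I * s * z) (I * s) (u : ℂ) := by
      simpa using (hasDerivAt_id (u : ℂ)).const_mul (I * s)
    have h1 := (((hasDerivAt_pow 2 (u : ℂ)).const_sub ((v : ℂ) ^ 2)).pow (M + 1))
    have h2 := (h0.cexp.mul h1).comp_ofReal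
    refine (h2.congr_deriv ?_).congr_of_eventuallyEq (Filter.Eventually.of_forall fun u => ?_)
    · simp only [Pi.pow_apply, Nat.add_sub_cancel]
      push_cast
      linear_combination (-2 * ((M : ℂ) + 1) * u * cexp (I * s * u) *
        ((v : ℂ) ^ 2 - (u : ℂ) ^ 2) ^ M) * I_sq
    · simp
  have hFTC := intervalIntegral.integral_eq_sub_of_hasDerivAt hderiv
    (Continuous.intervalIntegrable (by fun_prop) _ _)
  rw [intervalIntegral.integral_add (Continuous.intervalIntegrable (by fun_prop) _ _)
    (Continuous.intervalIntegrable (by fun_prop) _ _),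
    intervalIntegral.integral_const_mul, intervalIntegral.integral_const_mul] at hFTC
  change I * s * besselKernel (M + 1) 0 v s + I * (2 * (M + 1)) * besselKernel M 1 v s = _ at hFTC
  simp only [even_two, Even.neg_pow, sub_self, ofReal_zero, ne_eq, Nat.add_eq_zero_iff, one_ne_zero,
    and_false, not_false_eq_true, zero_pow, mul_zero] at hFTC
  have h3 : (s : ℂ) * besselKernel (M + 1) 0 v s + 2 * (M + 1) * besselKernel M 1 v s = 0 := by
    have : I * ((s : ℂ) * besselKernel (M + 1) 0 v s + 2 * (M + 1) * besselKernel M 1 v s) = 0 := by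
      linear_combination hFTC
    exact (mul_eq_zero.1 this).resolve_left I_ne_zero
  field_simp
  linear_combination h3

theorem mul_besselKernel_zero_zero (v : ℝ) {s : ℝ} (hs : 0 < s) :
    v * besselKernel 0 0 v s = -(2 / s) * cosDeriv v 1 s := by
  have hs' : (s : ℂ) ≠ 0 := by exact_mod_cast hs.ne'
  simp only [besselKernel, pow_zero, mul_one]
  rw [integral_exp_mul_complex (mul_ne_zero I_ne_zero hs'), cosDeriv]
  have : I * (s : ℂ) * ((-v : ℝ) : ℂ) = -(I * s * v) := by push_cast; ring
  rw [this]
  generalize cexp (I * s * v) = p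
  generalize cexp (-(I * s * v)) = q
  field_simp
  linear_combination (v * (p - q)) * I_sq

/-- The `j`-th derivative of `(-s⁻¹ d/ds)^(M+1) cos (s v)`, expanded. -/
noncomputable def kernelExpansion (M j : ℕ) (v s : ℝ) : ℂ :=
  ∑ i ∈ Finset.range (M + 1), (-1) ^ (i + 1) * besselCoeff M i *
    ∑ q ∈ Finset.HasAntidiagonal.antidiagonal j,
      (j.choose q.1 : ℂ) * (invPowDeriv (2 * M + 1 - i) q.1 s * cosDeriv v (i + 1 + q.2) s)

theorem hasDerivAt_kernelExpansion (M j : ℕ) (v : ℝ) {s : ℝ} (hs : 0 < s) :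
    HasDerivAt (kernelExpansion M j v) (kernelExpansion M (j + 1) v s) s :=
  HasDerivAt.fun_sum fun i _ => (hasDerivAt_leibniz (b := fun l => cosDeriv v (i + 1 + l))
    (fun r => hasDerivAt_invPowDeriv (2 * M + 1 - i) r hs)
    (fun l => hasDerivAt_cosDeriv v (i + 1 + l) s) j).const_mul _

theorem kernelExpansion_succ_zero (M : ℕ) (v : ℝ) {s : ℝ} (hs : 0 < s) :
    kernelExpansion (M + 1) 0 v s = -(1 / s) * kernelExpansion M 1 v s := by
  have hs' : (s : ℂ) ≠ 0 := by exact_mod_cast hs.ne'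
  have h := sum_besselCoeff_succ M fun i =>
    (-1) ^ (i + 1) * (invPowDeriv (2 * M + 3 - i) 0 s * cosDeriv v (i + 1) s)
  have hl : kernelExpansion (M + 1) 0 v s = ∑ i ∈ Finset.range (M + 2), besselCoeff (M + 1) i *
      ((-1) ^ (i + 1) * (invPowDeriv (2 * M + 3 - i) 0 s * cosDeriv v (i + 1) s)) := by
    refine Finset.sum_congr rfl fun i _ => ?_
    simp [mul_add]
    ring
  rw [hl, h, kernelExpansion, Finset.mul_sum]
  refine Finset.sum_congr rfl fun i hi => ?_
  rw [Finset.mem_range] at hi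
  have e1 : 2 * M + 3 - i = (2 * M + 1 - i) + 2 := by omega
  have e2 : 2 * M + 3 - (i + 1) = (2 * M + 1 - i) + 1 := by omega
  rw [e1, e2]
  generalize 2 * M + 1 - i = a
  simp only [Finset.Nat.antidiagonal_succ, Finset.Nat.antidiagonal_zero, invPowDeriv]
  simp
  field_simp
  ring

theorem mul_besselKernel_eq (M j : ℕ) (v : ℝ) {s : ℝ} (hs : 0 < s) :
    v * besselKernel M j v s = 2 ^ (M + 1) * M.factorial * kernelExpansion M j v s := by
  have hstep : ∀ M j, (∀ s : ℝ, 0 < s →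
      v * besselKernel M j v s = 2 ^ (M + 1) * M.factorial * kernelExpansion M j v s) →
      ∀ s : ℝ, 0 < s →
      v * besselKernel M (j + 1) v s =
        2 ^ (M + 1) * M.factorial * kernelExpansion M (j + 1) v s := by
    intro M j h s hs
    refine ((hasDerivAt_besselKernel M j v s).const_mul (v : ℂ)).unique ?_
    refine ((hasDerivAt_kernelExpansion M j v hs).const_mul _).congr_of_eventuallyEq ?_
    filter_upwards [lt_mem_nhds hs] with s hs using h s hs
  have hzero : ∀ M, ∀ s : ℝ, 0 < s →
      v * besselKernel M 0 v s = 2 ^ (M + 1) * M.factorial * kernelExpansion M 0 v s := by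
    intro M
    induction M with
    | zero =>
      intro s hs
      rw [mul_besselKernel_zero_zero v hs]
      simp [kernelExpansion, invPowDeriv, besselCoeff_self]
      ring
    | succ M ih =>
      intro s hs
      rw [besselKernel_succ_zero M v hs, kernelExpansion_succ_zero M v hs, mul_left_comm,
        hstep M 0 ih s hs, Nat.factorial_succ]
      push_cast
      ring
  induction j generalizing s with
  | zero => exact hzero M s hs
  | succ j ih => exact hstep M j (fun s hs => ih hs) s hs

/-- The radial profile `exp (-R v coth v) (v / sinh v)^(n+k₁) (cosh v)^k₁`. -/
noncomputable def heatProfile (n k₁ : ℕ) (R v : ℝ) : ℂ :=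
  cexp (-((R * v * Real.cosh v / Real.sinh v : ℝ) : ℂ)) *
    ((v : ℂ) ^ (n + k₁) * ((Real.cosh v : ℝ) : ℂ) ^ k₁ / ((Real.sinh v : ℝ) : ℂ) ^ (n + k₁))

theorem measurable_heatProfile (n k₁ : ℕ) (R : ℝ) : Measurable (heatProfile n k₁ R) := by
  unfold heatProfile
  fun_prop

theorem heatProfile_neg (n k₁ : ℕ) (R v : ℝ) : heatProfile n k₁ R (-v) = heatProfile n k₁ R v := by
  simp only [heatProfile, Real.cosh_neg, Real.sinh_neg, ofReal_neg, mul_neg, neg_mul, neg_div_neg_eq]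
  rw [neg_pow (v : ℂ), neg_pow ((Real.sinh v : ℝ) : ℂ), mul_assoc ((-1) ^ (n + k₁)),
    mul_div_mul_left _ _ (pow_ne_zero _ (neg_ne_zero.2 one_ne_zero))]

theorem norm_heatProfile_le {n k₁ : ℕ} (hn : 1 ≤ n) {R v : ℝ} (hR : 0 ≤ R) (hv : 0 < v) :
    ‖heatProfile n k₁ R v‖ ≤ 2 * (1 + v) ^ (k₁ + 1) * Real.exp (-v) := by
  have hs : 0 < Real.sinh v := Real.sinh_pos_iff.2 hv
  have hc : 0 < Real.cosh v := Real.cosh_pos v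
  have hvs : v ≤ Real.sinh v := Real.self_le_sinh_iff.2 hv.le
  have hcoth : v * Real.cosh v / Real.sinh v ≤ 1 + v := by
    rw [div_le_iff₀ hs]
    have h1 : Real.cosh v - Real.sinh v = Real.exp (-v) := Real.cosh_sub_sinh v
    have h2 : Real.exp (-v) ≤ 1 := Real.exp_le_one_iff.2 (by linarith)
    nlinarith
  have hdecay : v / Real.sinh v ≤ 2 * (1 + v) * Real.exp (-v) := by
    have h1 : Real.exp v / 2 ≤ Real.cosh v := by
      rw [Real.cosh_eq]
      linarith [Real.exp_pos (-v)]
    have h2 : v / Real.sinh v ≤ (1 + v) / Real.cosh v := by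
      rw [le_div_iff₀ hc]
      calc v / Real.sinh v * Real.cosh v = v * Real.cosh v / Real.sinh v := by ring
        _ ≤ _ := hcoth
    refine h2.trans ((div_le_div_of_nonneg_left (by positivity) (by positivity) h1).trans
      (le_of_eq ?_))
    rw [Real.exp_neg]
    field_simp
  have hle : (v / Real.sinh v) ^ n ≤ v / Real.sinh v :=
    pow_le_of_le_one (by positivity) ((div_le_one hs).2 hvs) (by omega)
  have hexp : Real.exp (-(R * v * Real.cosh v / Real.sinh v)) ≤ 1 :=
    Real.exp_le_one_iff.2 (neg_nonpos.2 (by positivity))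
  have hnorm : ‖heatProfile n k₁ R v‖ = Real.exp (-(R * v * Real.cosh v / Real.sinh v)) *
      ((v / Real.sinh v) ^ n * (v * Real.cosh v / Real.sinh v) ^ k₁) := by
    rw [heatProfile, norm_mul, ← Complex.ofReal_neg, Complex.norm_exp_ofReal]
    simp only [norm_div, norm_mul, norm_pow, Complex.norm_real, Real.norm_eq_abs]
    rw [abs_of_pos hv, abs_of_pos hs, abs_of_pos hc]
    congr 1
    rw [div_pow, div_pow, mul_pow, pow_add, pow_add]
    field_simp
  rw [hnorm]
  calc _ ≤ 1 * ((2 * (1 + v) * Real.exp (-v)) * (1 + v) ^ k₁) := by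
        gcongr
        exact hle.trans hdecay
    _ = _ := by ring

theorem integrableOn_pow_mul_heatProfile {n k₁ : ℕ} (hn : 1 ≤ n) {R : ℝ} (hR : 0 ≤ R) (l : ℕ) :
    IntegrableOn (fun v : ℝ => (v : ℂ) ^ l * heatProfile n k₁ R v) (Set.Ioi 0) := by
  set p := l + (k₁ + 1) with hp
  have hdom := (exp_neg_integrableOn_Ioi 0 (b := 1 / 2) (by norm_num)).const_mul
    (2 * 2 ^ p * p.factorial * Real.exp (1 / 2))
  have hF := measurable_heatProfile n k₁ R
  refine hdom.mono' (by fun_prop) ?_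
  refine (ae_restrict_iff' measurableSet_Ioi).2 (Filter.Eventually.of_forall fun v hv => ?_)
  have hv0 : 0 < v := hv
  have h1 : (1 + v) ^ p ≤ 2 ^ p * p.factorial * (Real.exp (1 / 2) * Real.exp (v / 2)) := by
    have h := Real.pow_div_factorial_le_exp (x := (1 + v) / 2) (by positivity) p
    rw [div_le_iff₀ (by positivity), div_pow, div_le_iff₀ (by positivity)] at h
    rw [← Real.exp_add, ← add_div]
    linarith
  have h2 : Real.exp (v / 2) * Real.exp (-v) = Real.exp (-(1 / 2) * v) := by
    rw [← Real.exp_add]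
    congr 1
    ring
  rw [norm_mul, norm_pow, Complex.norm_of_nonneg hv0.le]
  calc v ^ l * ‖heatProfile n k₁ R v‖
      ≤ (1 + v) ^ l * (2 * (1 + v) ^ (k₁ + 1) * Real.exp (-v)) := by
        gcongr
        · linarith
        · exact norm_heatProfile_le hn hR hv0
    _ = 2 * (1 + v) ^ p * Real.exp (-v) := by rw [hp, pow_add]; ring
    _ ≤ 2 * (2 ^ p * p.factorial * (Real.exp (1 / 2) * Real.exp (v / 2))) * Real.exp (-v) := by
        gcongr
    _ = _ := by rw [← h2]; ring

theorem integrableOn_mul_pow_mul_cexp {F : ℝ → ℂ} (hF : Measurable F) {l : ℕ}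
    (hFi : IntegrableOn (fun v : ℝ => (v : ℂ) ^ l * F v) (Set.Ioi 0)) (s : ℝ) :
    IntegrableOn (fun v : ℝ => F v * ((I * v) ^ l * cexp (I * s * v))) (Set.Ioi 0) := by
  refine Integrable.mono hFi (by fun_prop) (Filter.Eventually.of_forall fun v => ?_)
  simp only [norm_mul, norm_pow, norm_cexp_I_mul_ofReal_mul, norm_I, one_mul, mul_one]
  exact (mul_comm _ _).le

theorem integrableOn_mul_cosDeriv {F : ℝ → ℂ} (hF : Measurable F) {l : ℕ}
    (hFi : IntegrableOn (fun v : ℝ => (v : ℂ) ^ l * F v) (Set.Ioi 0)) (s : ℝ) :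
    IntegrableOn (fun v : ℝ => F v * cosDeriv v l s) (Set.Ioi 0) := by
  have h := ((integrableOn_mul_pow_mul_cexp hF hFi s).add
    ((integrableOn_mul_pow_mul_cexp hF hFi (-s)).const_mul ((-1) ^ l))).div_const 2
  refine IntegrableOn.congr_fun h (fun v _ => ?_) measurableSet_Ioi
  simp only [Pi.add_apply, cosDeriv, neg_pow (I * v : ℂ), ofReal_neg, mul_neg, neg_mul]
  ring

theorem integral_even_mul_pow_mul_cexp {F : ℝ → ℂ} (hF : Measurable F) (hFe : ∀ v, F (-v) = F v)
    {l : ℕ} (hFi : IntegrableOn (fun v : ℝ => (v : ℂ) ^ l * F v) (Set.Ioi 0)) (s : ℝ) :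
    ∫ v : ℝ, F v * ((I * v) ^ l * cexp (I * s * v)) =
      2 * ∫ v in Set.Ioi (0 : ℝ), F v * cosDeriv v l s := by
  set h : ℝ → ℂ := fun v => F v * ((I * v) ^ l * cexp (I * s * v)) with hh
  have hpos : IntegrableOn h (Set.Ioi 0) := integrableOn_mul_pow_mul_cexp hF hFi s
  have hneg : IntegrableOn (fun v => h (-v)) (Set.Ioi 0) := by
    refine IntegrableOn.congr_fun
      ((integrableOn_mul_pow_mul_cexp hF hFi (-s)).const_mul ((-1) ^ l)) (fun v _ => ?_) measurableSet_Ioi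
    simp only [hh, hFe, ofReal_neg, mul_neg, neg_mul, neg_pow (I * v : ℂ)]
    ring
  have hneg' : IntegrableOn h (Set.Iic 0) := by
    rw [← neg_zero] at hneg
    simpa only [neg_neg] using (integrableOn_Iic_iff_integrableOn_Iio (by simp)).2 hneg.comp_neg_Iio
  rw [← intervalIntegral.integral_Iic_add_Ioi hneg' hpos, ← neg_zero, ← integral_comp_neg_Ioi,
    neg_zero, ← integral_add hneg hpos, ← integral_const_mul]
  refine setIntegral_congr_fun measurableSet_Ioi fun v _ => ?_
  simp only [hh, hFe, cosDeriv, ofReal_neg, mul_neg]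
  ring

theorem pH1_eq {n k₁ : ℕ} (hn : 1 ≤ n) (j : ℕ) (x : EuclideanSpace ℝ (Fin (2 * n))) (τ : ℝ) :
    pH1 n k₁ j x τ = 4 * (-1 : ℂ) ^ k₁ / (4 * (π : ℂ)) ^ (n + 1) *
      ∫ v in Set.Ioi (0 : ℝ), heatProfile n k₁ (‖x‖ ^ 2 / 4) v * cosDeriv v j τ := by
  have h := integral_even_mul_pow_mul_cexp (l := j) (measurable_heatProfile n k₁ (‖x‖ ^ 2 / 4))
    (heatProfile_neg n k₁ _) (integrableOn_pow_mul_heatProfile hn (by positivity) j) τ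
  have hae : ∀ᵐ v : ℝ, v ≠ 0 := by simp [ae_iff]
  have h' : ∫ v : ℝ, heatProfile n k₁ (‖x‖ ^ 2 / 4) v * ((I * v) ^ j * cexp (I * τ * v)) =
      I ^ j * ∫ lam : ℝ,
      if lam = 0 then (if j = 0 then Complex.exp (-((‖x‖ ^ 2 / 4 : ℝ) : ℂ)) else 0)
      else
        Complex.exp (Complex.I * (lam : ℂ) * (τ : ℂ)
            - ((‖x‖ ^ 2 / 4 * lam * Real.cosh lam / Real.sinh lam : ℝ) : ℂ)) *
          ((lam : ℂ) ^ (n + k₁ + j) * ((Real.cosh lam : ℝ) : ℂ) ^ k₁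
            / ((Real.sinh lam : ℝ) : ℂ) ^ (n + k₁)) := by
    rw [← integral_const_mul]
    refine integral_congr_ae ?_
    filter_upwards [hae] with v hv
    rw [if_neg hv, heatProfile, sub_eq_add_neg, Complex.exp_add, pow_add _ (n + k₁), mul_pow,
      mul_right_comm I (v : ℂ)]
    ring
  rw [h] at h'
  rw [pH1]
  linear_combination (-2 * (-1 : ℂ) ^ k₁ / (4 * (π : ℂ)) ^ (n + 1)) * h'

theorem pT_eq {n k₁ : ℕ} (hn : 1 ≤ n) (M k₂ : ℕ) (hm : 0 < 2 * M + 2 + 1)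
    (x : EuclideanSpace ℝ (Fin (2 * n))) (t : EuclideanSpace ℝ (Fin (2 * M + 2 + 1)))
    (ht : t ≠ 0) :
    pT n (2 * M + 2 + 1) k₁ k₂ hm x t =
      4 * (-1 : ℂ) ^ k₁ / ((4 * (π : ℂ)) ^ (n + 1) * (2 * (π : ℂ)) ^ (M + 1)) *
        ∫ v in Set.Ioi (0 : ℝ),
          heatProfile n k₁ (‖x‖ ^ 2 / 4) v * kernelExpansion M k₂ v ‖t‖ := by
  have h := integral_mul_norm_odd (j := k₂) (M := M)
    (g := fun u => cexp (I * (‖t‖ : ℝ) * u) * (I * u) ^ k₂) (by fun_prop)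
    (fun u => by simp [norm_cexp_I_mul_ofReal_mul])
    (measurable_heatProfile n k₁ (‖x‖ ^ 2 / 4))
    (integrableOn_pow_mul_heatProfile hn (by positivity))
  have hae : ∀ᵐ v : EuclideanSpace ℝ (Fin (2 * M + 2 + 1)), v ≠ 0 := by simp [ae_iff]
  have h' : ∫ v : EuclideanSpace ℝ (Fin (2 * M + 2 + 1)),
      cexp (I * (‖t‖ : ℝ) * v 0) * (I * v 0) ^ k₂ * heatProfile n k₁ (‖x‖ ^ 2 / 4) ‖v‖ =
      I ^ k₂ * ∫ lam : EuclideanSpace ℝ (Fin (2 * M + 2 + 1)),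
      if lam = 0 then (if k₂ = 0 then Complex.exp (-((‖x‖ ^ 2 / 4 : ℝ) : ℂ)) else 0)
      else
        Complex.exp (Complex.I * ((‖t‖ : ℝ) : ℂ) * ((lam ⟨0, hm⟩ : ℝ) : ℂ)
            - ((‖x‖ ^ 2 / 4 * ‖lam‖ * Real.cosh ‖lam‖ / Real.sinh ‖lam‖ : ℝ) : ℂ)) *
          (((‖lam‖ : ℝ) : ℂ) ^ (n + k₁) * ((Real.cosh ‖lam‖ : ℝ) : ℂ) ^ k₁
            / ((Real.sinh ‖lam‖ : ℝ) : ℂ) ^ (n + k₁)) *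
          ((lam ⟨0, hm⟩ : ℝ) : ℂ) ^ k₂ := by
    rw [← integral_const_mul]
    refine integral_congr_ae ?_
    filter_upwards [hae] with v hv
    have h0 : (⟨0, hm⟩ : Fin (2 * M + 2 + 1)) = 0 := rfl
    rw [if_neg hv, heatProfile, sub_eq_add_neg, Complex.exp_add, mul_pow, h0]
    ring
  have hker : ∀ v : ℝ, heatProfile n k₁ (‖x‖ ^ 2 / 4) v * (v * ∫ u in (-v)..v,
      cexp (I * (‖t‖ : ℝ) * u) * (I * u) ^ k₂ * ((v ^ 2 - u ^ 2 : ℝ) : ℂ) ^ M) =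
      2 ^ (M + 1) * M.factorial *
        (heatProfile n k₁ (‖x‖ ^ 2 / 4) v * kernelExpansion M k₂ v ‖t‖) := fun v => by
    have := mul_besselKernel_eq M k₂ v (norm_pos_iff.2 ht)
    rw [besselKernel] at this
    rw [this]
    ring
  simp_rw [hker, integral_const_mul] at h
  rw [h'] at h
  rw [pT, mul_div_right_comm ((-1 : ℂ) ^ k₁) (I ^ k₂), mul_assoc, h]
  have hπ : (π : ℂ) ≠ 0 := by exact_mod_cast Real.pi_ne_zero
  have hM : ((M.factorial : ℕ) : ℂ) ≠ 0 := by exact_mod_cast M.factorial_ne_zero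
  field_simp
  ring

theorem integral_mul_kernelExpansion {F : ℝ → ℂ} (hF : Measurable F)
    (hFi : ∀ l : ℕ, IntegrableOn (fun v : ℝ => (v : ℂ) ^ l * F v) (Set.Ioi 0)) (M j : ℕ) (s : ℝ) :
    ∫ v in Set.Ioi (0 : ℝ), F v * kernelExpansion M j v s =
      ∑ i ∈ Finset.range (M + 1), (-1) ^ (i + 1) * besselCoeff M i *
        ∑ r ∈ Finset.range (j + 1), (j.choose r : ℂ) * invPowDeriv (2 * M + 1 - i) r s *
          ∫ v in Set.Ioi (0 : ℝ), F v * cosDeriv v (j + (i + 1) - r) s := by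
  have e : ∀ v, F v * kernelExpansion M j v s =
      ∑ i ∈ Finset.range (M + 1), ∑ r ∈ Finset.range (j + 1),
        ((-1) ^ (i + 1) * besselCoeff M i * ((j.choose r : ℂ) * invPowDeriv (2 * M + 1 - i) r s)) *
          (F v * cosDeriv v (j + (i + 1) - r) s) := by
    intro v
    rw [kernelExpansion, Finset.mul_sum]
    refine Finset.sum_congr rfl fun i _ => ?_
    rw [Finset.Nat.sum_antidiagonal_eq_sum_range_succ_mk, Finset.mul_sum, Finset.mul_sum]
    refine Finset.sum_congr rfl fun r hr => ?_
    rw [Finset.mem_range] at hr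
    have : i + 1 + (j - r) = j + (i + 1) - r := by omega
    simp only [this]
    ring
  have hint : ∀ (c : ℂ) (l : ℕ),
      Integrable (fun v => c * (F v * cosDeriv v l s)) (volume.restrict (Set.Ioi 0)) :=
    fun c l => Integrable.const_mul (integrableOn_mul_cosDeriv hF (hFi l) s) c
  simp_rw [e]
  rw [integral_finsetSum _ fun i _ => integrable_finsetSum _ fun r _ => hint _ _]
  refine Finset.sum_congr rfl fun i _ => ?_
  rw [integral_finsetSum _ fun r _ => hint _ _, Finset.mul_sum]
  refine Finset.sum_congr rfl fun r _ => ?_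
  rw [integral_const_mul]
  ring

/-- For m ≥ 3 odd, p^{(m)}_{1,k₁,k₂} is a finite combination of the p^{(1)}_{1,k₁,j}'s:
p^{(m)}_{1,k₁,k₂}(x,t) = Σ_{k=1}^{(m−1)/2} (c_{m,k}(−1)^k/(2π)^{(m−1)/2})
  Σ_{r=0}^{k₂} C(k₂,r) ((−1)^r (m−1−k)_r/|t|^{m−1−k+r}) p^{(1)}_{1,k₁,k₂+k−r}(x,|t|). -/
theorem descent_odd_m (n m k₁ k₂ : ℕ) (hn : 1 ≤ n) (hm : Odd m) (hm3 : 3 ≤ m)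
    (x : EuclideanSpace ℝ (Fin (2 * n))) (t : EuclideanSpace ℝ (Fin m)) (ht : t ≠ 0) :
    pT n m k₁ k₂ (by omega) x t =
      ∑ k ∈ Finset.Icc 1 ((m - 1) / 2),
        ((((Nat.factorial (m - k - 2) : ℕ) : ℂ) /
            ((2 : ℂ) ^ ((m - 1) / 2 - k) * ((Nat.factorial ((m - 1) / 2 - k) : ℕ) : ℂ) *
              ((Nat.factorial (k - 1) : ℕ) : ℂ))) *
          (-1 : ℂ) ^ k / (2 * (π : ℂ)) ^ ((m - 1) / 2)) *
        ∑ r ∈ Finset.range (k₂ + 1),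
          ((Nat.choose k₂ r : ℕ) : ℂ) *
            ((-1 : ℂ) ^ r * (((ascPochhammer ℝ r).eval ((m : ℝ) - 1 - k) : ℝ) : ℂ)
              / ((‖t‖ : ℝ) : ℂ) ^ (m - 1 - k + r)) *
          pH1 n k₁ (k₂ + k - r) x ‖t‖ := by
  obtain ⟨M, rfl⟩ : ∃ M, m = 2 * M + 2 + 1 := by
    obtain ⟨q, rfl⟩ := hm
    exact ⟨q - 1, by omega⟩
  have hhalf : (2 * M + 2 + 1 - 1) / 2 = M + 1 := by omega
  rw [pT_eq hn M k₂ _ x t ht, integral_mul_kernelExpansion (measurable_heatProfile n k₁ _)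
    (integrableOn_pow_mul_heatProfile hn (by positivity)), hhalf, Finset.mul_sum]
  refine Finset.sum_nbij' (fun i => i + 1) (fun k => k - 1) ?_ ?_ ?_ ?_ ?_
  · intro i hi
    rw [Finset.mem_range] at hi
    rw [Finset.mem_Icc]
    omega
  · intro k hk
    rw [Finset.mem_Icc] at hk
    rw [Finset.mem_range]
    omega
  · intro i _
    rfl
  · intro k hk
    rw [Finset.mem_Icc] at hk
    omega
  intro i hi
  rw [Finset.mem_range] at hi
  have e1 : 2 * M + 2 + 1 - (i + 1) - 2 = 2 * M - i := by omega
  have e2 : M + 1 - (i + 1) = M - i := by omega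
  have e3 : 2 * M + 2 + 1 - 1 - (i + 1) = 2 * M + 1 - i := by omega
  have e4 : ((2 * M + 2 + 1 : ℕ) : ℝ) - 1 - ((i + 1 : ℕ) : ℝ) = ((2 * M + 1 - i : ℕ) : ℝ) := by
    rw [Nat.cast_sub (by omega)]
    push_cast
    ring
  rw [e1, e2, e3, e4, Nat.add_sub_cancel, Finset.mul_sum, Finset.mul_sum, Finset.mul_sum]
  refine Finset.sum_congr rfl fun r _ => ?_
  rw [pH1_eq hn, besselCoeff, invPowDeriv]
  ring
end
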